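/- arXiv:1509.07803 — 3 statements merged into one kernel-verified Lean document; each statement's English description precedes it below -/
import Mathlib

section
/- Let k be a field of characteristic zero, let n ≥ 1 and m ≥ 2 be integers, and for λ ∈ k let B_λ = k[x₁,…,xₙ,y,z]/(x₁²⋯xₙ²·z − y^m − λ). Then for λ, λ' ∈ k, the k-algebras B_λ and B_{λ'} are isomorphic if and only if there exists α ∈ k* such that λ = α^m·λ'. -/
open MvPolynomial

/-- `B_λ = k[x₁,…,xₙ,y,z]/(x₁²⋯xₙ²·z − y^m − λ)`; the variables `x₁,…,xₙ` are indexed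
by `0,…,n-1`, `y` by `n` and `z` by `n+1` in `Fin (n+2)`. -/
noncomputable abbrev danielewskiRing (k : Type*) [Field k] (n m : ℕ) (lam : k) : Type _ :=
  MvPolynomial (Fin (n + 2)) k ⧸ Ideal.span
    {(∏ i : Fin n, (X (Fin.castAdd 2 i) : MvPolynomial (Fin (n + 2)) k) ^ 2) *
        X (⟨n + 1, by omega⟩ : Fin (n + 2)) -
      (X (⟨n, by omega⟩ : Fin (n + 2))) ^ m - MvPolynomial.C lam}

namespace Derivation

section LocallyNilpotent

variable {k T : Type*} [CommRing k] [CommRing T] [Algebra k T] (δ : Derivation k T T)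

/-- The general Leibniz rule for iterates of a derivation. -/
lemma iterate_apply_mul (N : ℕ) (f g : T) :
    δ^[N] (f * g) =
      ∑ ij ∈ Finset.HasAntidiagonal.antidiagonal N,
        (N.choose ij.1 : T) * (δ^[ij.1] f * δ^[ij.2] g) := by
  induction N with
  | zero => simp
  | succ N ih =>
    rw [Finset.sum_antidiagonal_choose_succ_mul (fun i j => δ^[i] f * δ^[j] g),
      Function.iterate_succ_apply', ih, map_sum, ← Finset.sum_add_distrib]
    refine Finset.sum_congr rfl fun ij hij => ?_
    rw [← Nat.choose_symm_of_eq_add (Finset.HasAntidiagonal.mem_antidiagonal.1 hij).symm]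
    simp only [leibniz, smul_eq_mul, map_natCast, Function.iterate_succ_apply']
    ring

lemma iterate_map_zero (N : ℕ) : δ^[N] 0 = 0 :=
  Function.iterate_fixed (map_zero δ) N

lemma iterate_eq_zero_of_le {f : T} {N M : ℕ} (h : δ^[N] f = 0) (hNM : N ≤ M) :
    δ^[M] f = 0 := by
  obtain ⟨d, rfl⟩ := Nat.exists_eq_add_of_le' hNM
  rw [Function.iterate_add_apply, h, iterate_map_zero]

/-- `f` has degree `a` for the degree function of the locally nilpotent part of `δ`. -/
def HasDeg (f : T) (a : ℕ) : Prop := δ^[a] f ≠ 0 ∧ δ^[a + 1] f = 0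

variable {δ}

lemma exists_hasDeg {f : T} (hf : f ≠ 0) (h : ∃ N, δ^[N] f = 0) : ∃ a, δ.HasDeg f a := by
  classical
  have h0 : Nat.find h ≠ 0 := fun h0 => hf (by simpa [h0] using Nat.find_spec h)
  obtain ⟨a, ha⟩ := Nat.exists_eq_succ_of_ne_zero h0
  refine ⟨a, Nat.find_min h (by omega), ?_⟩
  have := Nat.find_spec h
  rwa [ha] at this

lemma HasDeg.unique {f : T} {a b : ℕ} (ha : δ.HasDeg f a) (hb : δ.HasDeg f b) : a = b := by
  rcases lt_trichotomy a b with h | h | h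
  · exact absurd (δ.iterate_eq_zero_of_le ha.2 h) hb.1
  · exact h
  · exact absurd (δ.iterate_eq_zero_of_le hb.2 h) ha.1

lemma HasDeg.mul [IsDomain T] [CharZero T] {f g : T} {a b : ℕ} (hf : δ.HasDeg f a)
    (hg : δ.HasDeg g b) : δ.HasDeg (f * g) (a + b) := by
  constructor
  · rw [iterate_apply_mul, Finset.sum_eq_single (a, b)]
    · have : ((a + b).choose a : T) ≠ 0 :=
        Nat.cast_ne_zero.2 (Nat.choose_pos (Nat.le_add_right a b)).ne'
      exact mul_ne_zero this (mul_ne_zero hf.1 hg.1)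
    · rintro ⟨i, j⟩ hij hne
      rw [Finset.HasAntidiagonal.mem_antidiagonal] at hij
      rcases lt_trichotomy a i with h | h | h
      · simp [δ.iterate_eq_zero_of_le hf.2 h]
      · exact absurd (Prod.ext_iff.2 ⟨h.symm, by simp only at hij ⊢; omega⟩) hne
      · simp [δ.iterate_eq_zero_of_le hg.2 (show b + 1 ≤ j by simp only at hij; omega)]
    · simp
  · rw [iterate_apply_mul]
    refine Finset.sum_eq_zero fun ij hij => ?_
    rw [Finset.HasAntidiagonal.mem_antidiagonal] at hij
    by_cases h : a + 1 ≤ ij.1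
    · simp [δ.iterate_eq_zero_of_le hf.2 h]
    · simp [δ.iterate_eq_zero_of_le hg.2 (show b + 1 ≤ ij.2 by omega)]

lemma HasDeg.apply {f : T} {a : ℕ} (h : δ.HasDeg f (a + 1)) : δ.HasDeg (δ f) a := by
  simpa only [HasDeg, ← Function.iterate_succ_apply] using h

lemma HasDeg.ne_zero {f : T} {a : ℕ} (h : δ.HasDeg f a) : f ≠ 0 := by
  rintro rfl
  exact h.1 (δ.iterate_map_zero a)

/-- If `δ f` is nonzero then the degree of `f` exceeds that of any factor of `δ f`. -/
lemma HasDeg.lt_of_apply_eq_mul [IsDomain T] [CharZero T] {f g u : T} {a b : ℕ}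
    (hf : δ.HasDeg f a) (hg : δ.HasDeg g b) (hu : ∃ N, δ^[N] u = 0) (hu0 : u ≠ 0)
    (h : δ f = g * u) : b < a := by
  obtain ⟨c, hc⟩ := exists_hasDeg hu0 hu
  have hgu := hg.mul hc
  rw [← h] at hgu
  cases a with
  | zero => exact absurd (by simpa using hf.2) hgu.ne_zero
  | succ a =>
    have := hgu.unique hf.apply
    omega

/-- If `f` divides `δ f` then `δ f = 0`. -/
lemma apply_eq_zero_of_apply_eq_mul_self [IsDomain T] [CharZero T] {f u : T}
    (hf : ∃ N, δ^[N] f = 0) (hu : ∃ N, δ^[N] u = 0) (h : δ f = f * u) : δ f = 0 := by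
  by_contra h0
  have hf0 : f ≠ 0 := by rintro rfl; simp at h0
  have hu0 : u ≠ 0 := by rintro rfl; simp [h] at h0
  obtain ⟨a, ha⟩ := exists_hasDeg hf0 hf
  exact (ha.lt_of_apply_eq_mul ha hu hu0 h).false

/-- Two nonzero elements cannot have each its derivative divisible by the other. -/
lemma apply_eq_zero_of_apply_eq_mul_of_apply_eq_mul [IsDomain T] [CharZero T] {f g u v : T}
    (hf : ∃ N, δ^[N] f = 0) (hg : ∃ N, δ^[N] g = 0) (hu : ∃ N, δ^[N] u = 0)
    (hv : ∃ N, δ^[N] v = 0) (hg0 : g ≠ 0) (hfg : δ f = g * u) (hgf : δ g = f * v) (hv0 : v ≠ 0) :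
    δ f = 0 := by
  by_contra h0
  have hf0 : f ≠ 0 := by rintro rfl; simp at h0
  have hu0 : u ≠ 0 := by rintro rfl; simp [hfg] at h0
  obtain ⟨a, ha⟩ := exists_hasDeg hf0 hf
  obtain ⟨b, hb⟩ := exists_hasDeg hg0 hg
  exact (ha.lt_of_apply_eq_mul hb hu hu0 hfg).asymm (hb.lt_of_apply_eq_mul ha hv hv0 hgf)

/-- The kernel of a locally nilpotent derivation is factorially closed. -/
lemma apply_eq_zero_of_apply_mul_eq_zero [IsDomain T] [CharZero T] {f g : T}
    (hf : ∃ N, δ^[N] f = 0) (hg : ∃ N, δ^[N] g = 0) (h0 : f * g ≠ 0) (h : δ (f * g) = 0) :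
    δ f = 0 := by
  obtain ⟨a, ha⟩ := exists_hasDeg (left_ne_zero_of_mul h0) hf
  obtain ⟨b, hb⟩ := exists_hasDeg (right_ne_zero_of_mul h0) hg
  have h' : δ.HasDeg (f * g) 0 := ⟨by simpa using h0, by simpa using h⟩
  have := (ha.mul hb).unique h'
  obtain rfl : a = 0 := by omega
  simpa using ha.2

end LocallyNilpotent

/-- A derivation of `B` extends along an injection `ι : B → T` whose target consists of fractions
of elements of `B`. -/
lemma exists_extension {k B T : Type*} [CommRing k] [CommRing B] [Algebra k B] [CommRing T]
    [Algebra k T] (ι : B →ₐ[k] T) (hι : Function.Injective ι)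
    (hfrac : ∀ t, ∃ s b, IsUnit (ι s) ∧ ι b = ι s * t) (D : Derivation k B B) :
    ∃ D' : Derivation k T T, ∀ b, D' (ι b) = ι (D b) := by
  have key : ∀ t, ∃ u, ∀ s b, ι b = ι s * t → ι (D b) = ι s * u + ι (D s) * t := by
    intro t
    obtain ⟨s, b, ⟨w, hw⟩, hb⟩ := hfrac t
    refine ⟨↑w⁻¹ * (ι (D b) - ι (D s) * t), fun s' b' hb' => ?_⟩
    have h1 : s * b' = s' * b := hι (by rw [map_mul, map_mul, hb, hb']; ring)
    have h2 := congrArg (fun x => ι (D x)) h1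
    simp only [leibniz, smul_eq_mul, map_add, map_mul, hb, hb'] at h2
    have h3 : ι s * ↑w⁻¹ = 1 := by rw [← hw, w.mul_inv]
    have h4 : ι s * (ι s' * (↑w⁻¹ * (ι (D b) - ι (D s) * t)) + ι (D s') * t) =
        ι s * ι (D b') := by
      linear_combination (ι s' * (ι (D b) - ι (D s) * t)) * h3 - h2
    rw [← hw] at h4
    exact ((w.isUnit.mul_right_inj).1 h4).symm
  choose F hF using key
  have huniq : ∀ t u s b, IsUnit (ι s) → ι b = ι s * t → ι (D b) = ι s * u + ι (D s) * t →
      F t = u := by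
    intro t u s b hs hb hu
    have := hF t s b hb
    exact hs.mul_left_cancel (by linear_combination hu - this)
  refine ⟨Derivation.mk' { toFun := F, map_add' := ?_, map_smul' := ?_ } ?_, ?_⟩
  · intro t t'
    obtain ⟨s, b, hs, hb⟩ := hfrac t
    obtain ⟨s', b', hs', hb'⟩ := hfrac t'
    refine huniq _ _ (s * s') (s' * b + s * b') (by simpa using hs.mul hs')
      (by simp only [map_add, map_mul, hb, hb']; ring) ?_
    simp only [map_add, map_mul, leibniz, smul_eq_mul, hF t s b hb, hF t' s' b' hb', hb, hb']
    ring
  · intro c t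
    obtain ⟨s, b, hs, hb⟩ := hfrac t
    refine huniq _ _ s (c • b) hs (by simp [hb]) ?_
    simp [hF t s b hb]
  · intro t t'
    obtain ⟨s, b, hs, hb⟩ := hfrac t
    obtain ⟨s', b', hs', hb'⟩ := hfrac t'
    refine huniq _ _ (s * s') (b * b') (by simpa using hs.mul hs')
      (by simp only [map_mul, hb, hb']; ring) ?_
    simp only [LinearMap.coe_mk, AddHom.coe_mk, map_add, map_mul, leibniz, smul_eq_mul,
      hF t s b hb, hF t' s' b' hb', hb, hb']
    ring
  · intro b
    exact huniq _ _ 1 b (by simp) (by simp) (by simp)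

section Graded

variable {k L : Type*} [Field k] [Field L] [Algebra k L]

/-- The homogeneous derivation of degree `E` of `L[Y]` which is `p · Y ^ E` on `L` and sends `Y`
to `q · Y ^ (E + 1)`. -/
noncomputable def homogeneous (p : Derivation k L L) (q : L) (E : ℕ) :
    Derivation k (Polynomial L) (Polynomial L) :=
  (Polynomial.monomial E 1 : Polynomial L) •
    PolynomialModule.equivPolynomialSelf.compDer p.mapCoeffs +
    (Polynomial.monomial (E + 1) q : Polynomial L) • (Polynomial.derivative'.restrictScalars k)

@[simp]
lemma homogeneous_monomial (p : Derivation k L L) (q : L) (E d : ℕ) (c : L) :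
    p.homogeneous q E (Polynomial.monomial d c) =
      Polynomial.monomial (d + E) (p c + d * q * c) := by
  have h : PolynomialModule.equivPolynomialSelf.compDer p.mapCoeffs (Polynomial.monomial d c) =
      Polynomial.monomial d (p c) := by
    change PolynomialModule.equivPolynomialSelf (p.mapCoeffs (Polynomial.monomial d c)) = _
    rw [mapCoeffs_monomial]
    rfl
  simp only [homogeneous, add_apply, smul_apply, smul_eq_mul, h, coe_restrictScalars,
    Polynomial.derivative'_apply, Polynomial.derivative_monomial,
    Polynomial.monomial_mul_monomial, one_mul]
  cases d with
  | zero => simp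
  | succ d =>
    rw [show E + 1 + (d + 1 - 1) = d + 1 + E by omega, show E + (d + 1) = d + 1 + E by omega,
      ← map_add]
    congr 1
    ring

@[simp]
lemma homogeneous_C (p : Derivation k L L) (q : L) (E : ℕ) (c : L) :
    p.homogeneous q E (Polynomial.C c) = Polynomial.monomial E (p c) := by
  simpa using p.homogeneous_monomial q E 0 c

/-- Let `δ` be a homogeneous derivation of degree `E ≥ 0` of the graded ring
`⨁ d, A · (R²) ^ (-⌊d / m⌋) · Y ^ d`, with `m ≥ 2`. If `δ` is locally nilpotent then it kills `Y`
and every divisor of `R`. -/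
lemma eq_zero_of_homogeneous_locallyNilpotent {A : Type*} [CharZero k] [CommRing A] [Algebra A L]
    [Algebra k A] [IsScalarTower k A L] [FaithfulSMul A L] {R : A} (hR : R ≠ 0) {m : ℕ} (hm : 2 ≤ m)
    (p : Derivation k L L) (q : L) (E : ℕ)
    (hnil : ∀ d a, ∃ N, (p.homogeneous q E)^[N]
      (Polynomial.monomial d (algebraMap A L a / (algebraMap A L R ^ 2) ^ (d / m))) = 0)
    (hmem : ∀ d a, ∃ a', p (algebraMap A L a / (algebraMap A L R ^ 2) ^ (d / m)) +
      d * q * (algebraMap A L a / (algebraMap A L R ^ 2) ^ (d / m)) =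
        algebraMap A L a' / (algebraMap A L R ^ 2) ^ ((d + E) / m)) :
    q = 0 ∧ ∀ x, x ∣ R → p (algebraMap A L x) = 0 := by
  have : CharZero L := charZero_of_injective_algebraMap (algebraMap k L).injective
  set ρ := algebraMap A L R with hρ
  have hρ0 : ρ ≠ 0 := by simpa [hρ] using hR
  have h0m : 0 / m = 0 := Nat.zero_div m
  have h1m : 1 / m = 0 := Nat.div_eq_of_lt (by omega)
  have hmm : m / m = 1 := Nat.div_self (by omega)
  have hm0 : (m : L) ≠ 0 := Nat.cast_ne_zero.2 (by omega)
  set δ := p.homogeneous q E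
  have hY : δ (Polynomial.monomial 1 1) = Polynomial.monomial (1 + E) q := by simp [δ]
  have nilY : ∃ N, δ^[N] (Polynomial.monomial 1 1) = 0 := by simpa [h1m] using hnil 1 1
  have nil0 (a : A) : ∃ N, δ^[N] (Polynomial.monomial 0 (algebraMap A L a)) = 0 := by
    simpa using hnil 0 a
  have hZ : δ (Polynomial.monomial m (1 / ρ ^ 2)) =
      Polynomial.monomial (m + E) (p (1 / ρ ^ 2) + m * q * (1 / ρ ^ 2)) :=
    homogeneous_monomial ..
  have nilZ : ∃ N, δ^[N] (Polynomial.monomial m (1 / ρ ^ 2)) = 0 := by simpa [hmm] using hnil m 1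
  obtain ⟨q', hq'⟩ : ∃ q', q = algebraMap A L q' / (ρ ^ 2) ^ ((1 + E) / m) := by
    simpa [h1m] using hmem 1 1
  have hq : q = 0 := by
    by_cases hE : m ∣ E + 1
    · obtain ⟨r, hr⟩ := hE
      obtain ⟨r, rfl⟩ : ∃ s, r = s + 1 := Nat.exists_eq_succ_of_ne_zero (by rintro rfl; simp at hr)
      have d1 : (1 + E) / m = r + 1 := by
        rw [add_comm, hr, Nat.mul_div_cancel_left _ (by omega)]
      have hE' : E = m * r + (m - 1) := by rw [Nat.mul_succ] at hr; omega
      have d2 : E / m = r := by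
        rw [hE', Nat.mul_add_div (by omega), Nat.div_eq_of_lt (by omega), add_zero]
      have d3 : (E - 1) / m = r := by
        rw [hE', show m * r + (m - 1) - 1 = m * r + (m - 2) by omega,
          Nat.mul_add_div (by omega), Nat.div_eq_of_lt (by omega), add_zero]
      have d4 : (m + E) / m = r + 1 := by
        rw [Nat.add_div_left _ (by omega), d2]
      rw [d1] at hq'
      obtain ⟨s, hs⟩ := hmem m 1
      rw [hmm, map_one, pow_one, d4] at hs
      have hZ0 : δ (Polynomial.monomial m (1 / ρ ^ 2)) = 0 := by
        refine apply_eq_zero_of_apply_eq_mul_self nilZ (hnil E s) ?_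
        rw [hZ, hs, Polynomial.monomial_mul_monomial, d2]
        congr 1
        rw [pow_succ]
        field_simp
      rw [hZ, Polynomial.monomial_eq_zero_iff] at hZ0
      have hpq : (m : L) * q * ρ = 2 * p ρ := by
        have h2 : p (1 / ρ ^ 2) = - (1 / ρ ^ 2) ^ 2 * (2 * ρ * p ρ) := by
          rw [one_div, leibniz_inv, pow_two ρ, leibniz]
          simp only [smul_eq_mul]
          ring
        rw [h2] at hZ0
        field_simp at hZ0
        linear_combination hZ0
      obtain ⟨P, hP⟩ := hmem 0 R
      rw [h0m, pow_zero, div_one, zero_add, d2, Nat.cast_zero, zero_mul, zero_mul, add_zero,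
        ← hρ] at hP
      by_cases hP0 : P = 0
      · rw [hP, hP0] at hpq
        simpa [hm0, hρ0] using hpq
      have hδ : δ (Polynomial.monomial 1 1) = 0 := by
        refine apply_eq_zero_of_apply_eq_mul_of_apply_eq_mul nilY (nil0 R)
          (hnil (1 + E) (algebraMap k A (2 / m) * P)) (hnil (E - 1) P)
          (by simpa [← hρ] using hρ0) ?_ ?_ (by simpa [hρ0] using hP0)
        · rw [hY, Polynomial.monomial_mul_monomial, d1, zero_add]
          congr 1
          rw [map_mul (algebraMap A L), ← IsScalarTower.algebraMap_apply, map_div₀,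
            _root_.map_natCast, map_ofNat, ← hρ]
          rw [hP] at hpq
          field_simp at hpq ⊢
          linear_combination ρ * hpq
        · rw [Polynomial.monomial_mul_monomial, d3, show 1 + (E - 1) = 0 + E by
            have : 0 ≤ m * r := Nat.zero_le _
            omega]
          simp [δ, ← hρ, hP]
      simpa [hY] using hδ
    · have hdiv : (1 + E) / m = E / m := by
        rw [add_comm, Nat.succ_div_of_not_dvd hE]
      have hδ : δ (Polynomial.monomial 1 1) = 0 := by
        refine apply_eq_zero_of_apply_eq_mul_self nilY (hnil E q') ?_
        rw [hY, Polynomial.monomial_mul_monomial, one_mul, ← hdiv, ← hq']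
      simpa [hY] using hδ
  refine ⟨hq, ?_⟩
  rintro x ⟨w, hw⟩
  have hx : δ (Polynomial.monomial 0 (algebraMap A L x)) = 0 := by
    have hmul : Polynomial.monomial 0 (algebraMap A L x) *
        Polynomial.monomial m (algebraMap A L (w * R) / ρ ^ 2) =
        (Polynomial.monomial m 1 : Polynomial L) := by
      rw [Polynomial.monomial_mul_monomial, zero_add, ← mul_div_assoc, ← map_mul, ← mul_assoc,
        ← hw, map_mul, ← hρ, ← pow_two, div_self (pow_ne_zero 2 hρ0)]
    refine apply_eq_zero_of_apply_mul_eq_zero (nil0 x)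
      (g := Polynomial.monomial m (algebraMap A L (w * R) / ρ ^ 2))
      (by simpa [hmm] using hnil m (w * R)) ?_ ?_
    · simp only [hmul, ne_eq, Polynomial.monomial_eq_zero_iff, one_ne_zero, not_false_eq_true]
    · rw [hmul]
      simp [δ, hq]
  simpa [δ] using hx

end Graded
section Filtered

variable {k L : Type*} [Field k] [Field L] [Algebra k L]
  (D : Derivation k (Polynomial L) (Polynomial L))

/-- The coefficient of `Y ^ E` in `D c`, as a function of `c : L`. -/
noncomputable def constCoeff (E : ℕ) : Derivation k L L :=
  Derivation.mk' ((Polynomial.lcoeff L E).restrictScalars k ∘ₗ D.toLinearMap ∘ₗ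
    (Algebra.ofId L (Polynomial L)).toLinearMap.restrictScalars k) fun a b => by
      simp [Algebra.ofId_apply]

@[simp]
lemma constCoeff_apply (E : ℕ) (c : L) :
    D.constCoeff E c = (D (Polynomial.C c)).coeff E := rfl

/-- The leading form of `D`, when `D` raises degrees by at most `E`. -/
noncomputable def leadingForm (E : ℕ) : Derivation k (Polynomial L) (Polynomial L) :=
  (D.constCoeff E).homogeneous ((D Polynomial.X).coeff (E + 1)) E

variable {D} {E : ℕ}

lemma natDegree_apply_le_and_coeff (hC : ∀ c, (D (Polynomial.C c)).natDegree ≤ E)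
    (hX : (D Polynomial.X).natDegree ≤ E + 1) {d : ℕ} {f : Polynomial L} (hf : f.natDegree ≤ d) :
    (D f).natDegree ≤ d + E ∧ (D f).coeff (d + E) =
      D.constCoeff E (f.coeff d) + d * (D Polynomial.X).coeff (E + 1) * f.coeff d := by
  refine Polynomial.induction_with_natDegree_le (fun f => (D f).natDegree ≤ d + E ∧
    (D f).coeff (d + E) = D.constCoeff E (f.coeff d) +
      d * (D Polynomial.X).coeff (E + 1) * f.coeff d) d (by simp) (fun j c hc hj => ?_)
    (fun f g hfg hg ihf ihg => ?_) f hf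
  · have h1 : (Polynomial.X ^ j * D (Polynomial.C c)).natDegree ≤ j + E :=
      (Polynomial.natDegree_mul_le).trans (by
        rw [Polynomial.natDegree_X_pow]
        exact Nat.add_le_add_left (hC c) j)
    have hD : D (Polynomial.C c * Polynomial.X ^ j) = Polynomial.X ^ j * D (Polynomial.C c) +
        Polynomial.C (j * c) * (Polynomial.X ^ (j - 1) * D Polynomial.X) := by
      simp only [leibniz, leibniz_pow, smul_eq_mul, nsmul_eq_mul, map_mul,
        _root_.map_natCast]
      ring
    have h2 : (Polynomial.C (j * c) * (Polynomial.X ^ (j - 1) * D Polynomial.X)).natDegree ≤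
        j + E := by
      cases j with
      | zero => simp
      | succ j =>
        refine (Polynomial.natDegree_C_mul_le _ _).trans (Polynomial.natDegree_mul_le.trans ?_)
        rw [Polynomial.natDegree_X_pow]
        omega
    have h12 := Polynomial.natDegree_add_le_of_degree_le h1 h2
    rw [hD]
    refine ⟨h12.trans (by omega), ?_⟩
    rcases hj.eq_or_lt with rfl | hj
    · rw [Polynomial.coeff_add, add_comm j E, Polynomial.coeff_X_pow_mul, Polynomial.coeff_C_mul,
        Polynomial.coeff_C_mul_X_pow, if_pos rfl, constCoeff_apply]
      cases j with
      | zero => simp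
      | succ j =>
        rw [Nat.add_sub_cancel, show E + (j + 1) = E + 1 + j by omega, Polynomial.coeff_X_pow_mul]
        ring
    · rw [Polynomial.coeff_eq_zero_of_natDegree_lt (h12.trans_lt (by omega))]
      simp [Polynomial.coeff_X_pow, hj.ne']
  · obtain ⟨f1, f2⟩ := ihf
    obtain ⟨g1, g2⟩ := ihg
    refine ⟨by rw [map_add]; exact Polynomial.natDegree_add_le_of_degree_le f1 g1, ?_⟩
    rw [map_add, Polynomial.coeff_add, f2, g2, Polynomial.coeff_add, map_add]
    ring

lemma leadingForm_iterate (hC : ∀ c, (D (Polynomial.C c)).natDegree ≤ E)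
    (hX : (D Polynomial.X).natDegree ≤ E + 1) {d : ℕ} {f : Polynomial L}
    (hf : f.natDegree ≤ d) (N : ℕ) :
    (D^[N] f).natDegree ≤ d + N * E ∧ (D.leadingForm E)^[N] (Polynomial.monomial d (f.coeff d)) =
      Polynomial.monomial (d + N * E) ((D^[N] f).coeff (d + N * E)) := by
  induction N with
  | zero => simpa using hf
  | succ N ih =>
    obtain ⟨h1, h2⟩ := natDegree_apply_le_and_coeff hC hX ih.1
    rw [Function.iterate_succ_apply', Function.iterate_succ_apply', ih.2, leadingForm,
      homogeneous_monomial, ← h2, Nat.succ_mul, ← add_assoc]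
    exact ⟨h1, rfl⟩

end Filtered

/-- Let `S` be a subset of `L[Y]` whose elements of degree at most `d` have as coefficients of
`Y ^ d` exactly the elements of `A · (R²) ^ (-⌊d / m⌋)`. A derivation of `L[Y]` that is locally
nilpotent on `S` is then `L`-linear. -/
theorem apply_C_eq_zero_of_locallyNilpotent {k A L : Type*} [Field k] [CharZero k] [CommRing A]
    [IsDomain A] [Algebra k A] [Field L] [Algebra k L] [Algebra A L] [IsScalarTower k A L]
    [IsFractionRing A L] {R : A} (hR : R ≠ 0) {m : ℕ} (hm : 2 ≤ m) (s : Finset A)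
    (hs : Algebra.adjoin k (s : Set A) = ⊤) (hsR : ∀ x ∈ s, x ∣ R)
    (D : Derivation k (Polynomial L) (Polynomial L)) (S : Set (Polynomial L))
    (hlift : ∀ d a, ∃ f ∈ S, f.natDegree ≤ d ∧
      f.coeff d = algebraMap A L a / (algebraMap A L R ^ 2) ^ (d / m))
    (hcoeff : ∀ f ∈ S, ∀ d, f.natDegree ≤ d → ∃ a,
      f.coeff d = algebraMap A L a / (algebraMap A L R ^ 2) ^ (d / m))
    (hD : ∀ f ∈ S, D f ∈ S) (hnil : ∀ f ∈ S, ∃ N, D^[N] f = 0) (c : L) :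
    D (Polynomial.C c) = 0 := by
  have : FaithfulSMul A L := (faithfulSMul_iff_algebraMap_injective A L).2
    (IsFractionRing.injective A L)
  have toL {V : ℕ} (h : ∀ a : A, (D (Polynomial.C (algebraMap A L a))).natDegree ≤ V) (c : L) :
      (D (Polynomial.C c)).natDegree ≤ V := by
    obtain ⟨a, b, hb, rfl⟩ := IsFractionRing.div_surjective (A := A) c
    have hb0 : algebraMap A L b ≠ 0 := by
      simpa using nonZeroDivisors.ne_zero hb
    set β := algebraMap A L b
    set γ := algebraMap A L a / β with hγ
    have h1 : Polynomial.C β * D (Polynomial.C γ) =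
        D (Polynomial.C (algebraMap A L a)) - Polynomial.C γ * D (Polynomial.C β) := by
      have : algebraMap A L a = γ * β := by rw [hγ, div_mul_cancel₀ _ hb0]
      rw [this, map_mul, leibniz]
      simp only [smul_eq_mul]
      ring
    rw [← Polynomial.natDegree_C_mul hb0, h1]
    exact (Polynomial.natDegree_sub_le _ _).trans
      (max_le (h a) ((Polynomial.natDegree_C_mul_le _ _).trans (h b)))
  have toA (p : Derivation k L L) (h : ∀ x ∈ s, p (algebraMap A L x) = 0) (c : L) : p c = 0 := by
    have hA (a : A) : p (algebraMap A L a) = 0 := by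
      have ha : a ∈ Algebra.adjoin k (s : Set A) := hs ▸ Algebra.mem_top
      induction ha using Algebra.adjoin_induction with
      | mem x hx => exact h x hx
      | algebraMap r => rw [← IsScalarTower.algebraMap_apply, map_algebraMap]
      | add x y _ _ hx hy => rw [map_add, map_add, hx, hy, add_zero]
      | mul x y _ _ hx hy => rw [map_mul, leibniz, hx, hy, smul_zero, smul_zero, add_zero]
    obtain ⟨a, b, -, rfl⟩ := IsFractionRing.div_surjective (A := A) c
    rw [leibniz_div, hA, hA, smul_zero, smul_zero, sub_zero, smul_zero]
  have hbound : ∃ V, ∀ a : A, (D (Polynomial.C (algebraMap A L a))).natDegree ≤ V := by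
    refine ⟨s.sup fun x => (D (Polynomial.C (algebraMap A L x))).natDegree, fun a => ?_⟩
    have ha : a ∈ Algebra.adjoin k (s : Set A) := hs ▸ Algebra.mem_top
    induction ha using Algebra.adjoin_induction with
    | mem x hx =>
      exact Finset.le_sup (f := fun x => (D (Polynomial.C (algebraMap A L x))).natDegree) hx
    | algebraMap r =>
      have : Polynomial.C (algebraMap A L (algebraMap k A r)) =
          algebraMap k (Polynomial L) r := by
        rw [← IsScalarTower.algebraMap_apply]
        rfl
      rw [this, map_algebraMap, Polynomial.natDegree_zero]
      exact Nat.zero_le _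
    | add x y _ _ hx hy =>
      simp only [map_add]
      exact Polynomial.natDegree_add_le_of_degree_le hx hy
    | mul x y _ _ hx hy =>
      simp only [map_mul, leibniz, smul_eq_mul]
      exact Polynomial.natDegree_add_le_of_degree_le
        ((Polynomial.natDegree_C_mul_le _ _).trans hy)
        ((Polynomial.natDegree_C_mul_le _ _).trans hx)
  have hE : ∃ E, (∀ c, (D (Polynomial.C c)).natDegree ≤ E) ∧
      (D Polynomial.X).natDegree ≤ E + 1 := by
    obtain ⟨V, hV⟩ := hbound
    exact ⟨max V (D Polynomial.X).natDegree, fun c => (toL hV c).trans (le_max_left _ _),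
      (le_max_right _ _).trans (Nat.le_succ _)⟩
  classical
  obtain ⟨E, ⟨hC, hX⟩, hmin⟩ : ∃ E, ((∀ c, (D (Polynomial.C c)).natDegree ≤ E) ∧
      (D Polynomial.X).natDegree ≤ E + 1) ∧ ∀ E' < E, ¬ ((∀ c, (D (Polynomial.C c)).natDegree ≤ E')
        ∧ (D Polynomial.X).natDegree ≤ E' + 1) :=
    ⟨Nat.find hE, Nat.find_spec hE, fun E' h => Nat.find_min hE h⟩
  obtain ⟨hq, hp⟩ := eq_zero_of_homogeneous_locallyNilpotent hR hm (D.constCoeff E)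
    ((D Polynomial.X).coeff (E + 1)) E
    (fun d a => by
      obtain ⟨f, hfS, hfd, hf⟩ := hlift d a
      obtain ⟨N, hN⟩ := hnil f hfS
      refine ⟨N, ?_⟩
      have := (leadingForm_iterate hC hX hfd N).2
      rw [hN, hf] at this
      simpa [leadingForm] using this)
    (fun d a => by
      obtain ⟨f, hfS, hfd, hf⟩ := hlift d a
      obtain ⟨h1, h2⟩ := natDegree_apply_le_and_coeff hC hX hfd
      rw [← hf, ← h2]
      exact hcoeff _ (hD f hfS) _ h1)
  have hp := toA _ fun x hx => hp x (hsR x hx)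
  have hlow {f : Polynomial L} {V : ℕ} (h : f.natDegree ≤ V + 1) (h0 : f.coeff (V + 1) = 0) :
      f.natDegree ≤ V := by
    refine Polynomial.natDegree_le_iff_coeff_eq_zero.2 fun N hN => ?_
    rcases (show V + 1 ≤ N from hN).eq_or_lt with rfl | hN
    · exact h0
    · exact Polynomial.coeff_eq_zero_of_natDegree_lt (h.trans_lt hN)
  cases E with
  | zero =>
    rw [Polynomial.eq_C_of_natDegree_le_zero (hC c)]
    simpa using hp c
  | succ E => exact absurd ⟨fun c => hlow (hC c) (hp c), hlow hX hq⟩ (hmin E E.lt_succ_self)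

end Derivation

namespace Danielewski

section StandardForm

variable {A B : Type*} [CommRing A] [CommRing B]

/-- The sum `∑ d, α (a_d) · y ^ (d % m) · z ^ (d / m)` attached to a polynomial `∑ d, a_d · Y ^ d`
over `A`. -/
noncomputable def standardForm (α : A →+* B) (y z : B) (m : ℕ) (g : Polynomial A) : B :=
  g.sum fun d a => α a * (y ^ (d % m) * z ^ (d / m))

variable (α : A →+* B) (y z : B) (m : ℕ)

lemma standardForm_add (f g : Polynomial A) :
    standardForm α y z m (f + g) = standardForm α y z m f + standardForm α y z m g :=
  Polynomial.sum_add_index _ _ _ (by simp) (by simp [add_mul])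

@[simp]
lemma standardForm_zero : standardForm α y z m 0 = 0 := Polynomial.sum_zero_index _

@[simp]
lemma standardForm_monomial (d : ℕ) (a : A) :
    standardForm α y z m (Polynomial.monomial d a) = α a * (y ^ (d % m) * z ^ (d / m)) :=
  Polynomial.sum_monomial_index _ _ (by simp)

@[simp]
lemma standardForm_C (a : A) : standardForm α y z m (Polynomial.C a) = α a := by
  rw [← Polynomial.monomial_zero_left, standardForm_monomial]
  simp

lemma map_standardForm {C : Type*} [CommRing C] (φ : B →+* C) (g : Polynomial A) :
    φ (standardForm α y z m g) = standardForm (φ.comp α) (φ y) (φ z) m g := by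
  simp [standardForm, Polynomial.sum_def]

variable {α y z m}

lemma exists_standardForm_mul_map {b : B} (hb : ∃ g, b = standardForm α y z m g) (c : A) :
    ∃ g, b * α c = standardForm α y z m g := by
  obtain ⟨g, rfl⟩ := hb
  induction g using Polynomial.induction_on' with
  | add f g hf hg =>
    obtain ⟨f', hf⟩ := hf
    obtain ⟨g', hg⟩ := hg
    exact ⟨f' + g', by rw [standardForm_add, standardForm_add, add_mul, hf, hg]⟩
  | monomial d a =>
    refine ⟨Polynomial.monomial d (a * c), ?_⟩
    simp only [standardForm_monomial, map_mul]
    ring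

lemma exists_standardForm_mul_right (hm : 0 < m) {b : B} (hb : ∃ g, b = standardForm α y z m g) :
    ∃ g, b * z = standardForm α y z m g := by
  obtain ⟨g, rfl⟩ := hb
  induction g using Polynomial.induction_on' with
  | add f g hf hg =>
    obtain ⟨f', hf⟩ := hf
    obtain ⟨g', hg⟩ := hg
    exact ⟨f' + g', by rw [standardForm_add, standardForm_add, add_mul, hf, hg]⟩
  | monomial d a =>
    refine ⟨Polynomial.monomial (d + m) a, ?_⟩
    simp only [standardForm_monomial, Nat.add_mod_right, Nat.add_div_right _ hm]
    ring

lemma exists_standardForm_mul_left {r l : A} (hm : 0 < m) (rel : α r * z = y ^ m + α l) {b : B}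
    (hb : ∃ g, b = standardForm α y z m g) :
    ∃ g, b * y = standardForm α y z m g := by
  obtain ⟨g, rfl⟩ := hb
  induction g using Polynomial.induction_on' with
  | add f g hf hg =>
    obtain ⟨f', hf⟩ := hf
    obtain ⟨g', hg⟩ := hg
    exact ⟨f' + g', by rw [standardForm_add, standardForm_add, add_mul, hf, hg]⟩
  | monomial d a =>
    have hlt := Nat.mod_lt d hm
    have hd := Nat.div_add_mod d m
    rcases (show d % m + 1 ≤ m from hlt).lt_or_eq with h | h
    · refine ⟨Polynomial.monomial (d + 1) a, ?_⟩
      have h1 : (d + 1) / m = d / m := by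
        conv_lhs => rw [← hd, add_assoc, Nat.mul_add_div hm, Nat.div_eq_of_lt h, add_zero]
      have h2 : (d + 1) % m = d % m + 1 := by
        have := Nat.div_add_mod (d + 1) m
        rw [h1] at this
        omega
      simp only [standardForm_monomial, h1, h2]
      ring
    · have hq : d + 1 = m * (d / m + 1) := by rw [mul_add]; omega
      refine ⟨Polynomial.monomial (d + 1) (a * r) - Polynomial.monomial (m * (d / m)) (a * l), ?_⟩
      rw [sub_eq_add_neg, ← map_neg, standardForm_add]
      simp only [standardForm_monomial]
      rw [hq, Nat.mul_mod_right, Nat.mul_mod_right, Nat.mul_div_cancel_left _ hm,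
        Nat.mul_div_cancel_left _ hm]
      have hy : y ^ (d % m) * y = y ^ m := by rw [← pow_succ, h]
      simp only [map_neg, map_mul, pow_zero, one_mul, pow_succ]
      linear_combination (α a * z ^ (d / m)) * (hy - rel)

end StandardForm

section PolynomialStandardForm

variable {A L : Type*} [CommRing A] [Field L] [Algebra A L] {ρ : L} (l : L) {m : ℕ}

/-- The standard form inside `L[Y]`, where `z = ρ⁻¹ (Y ^ m + l)`. -/
noncomputable def polynomialStandardForm (A : Type*) {L : Type*} [CommRing A] [Field L]
    [Algebra A L] (ρ l : L) (m : ℕ) (g : Polynomial A) : Polynomial L :=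
  standardForm (Polynomial.C.comp (algebraMap A L)) Polynomial.X
    (Polynomial.C ρ⁻¹ * (Polynomial.X ^ m + Polynomial.C l)) m g

lemma polynomialStandardForm_natDegree_le_and_coeff (hm : 0 < m) {g : Polynomial A} {d : ℕ}
    (hg : g.natDegree ≤ d) : (polynomialStandardForm A ρ l m g).natDegree ≤ d ∧
      (polynomialStandardForm A ρ l m g).coeff d = algebraMap A L (g.coeff d) / ρ ^ (d / m) := by
  refine Polynomial.induction_with_natDegree_le (fun g =>
    (polynomialStandardForm A ρ l m g).natDegree ≤ d ∧
      (polynomialStandardForm A ρ l m g).coeff d = algebraMap A L (g.coeff d) / ρ ^ (d / m)) d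
    (by simp [polynomialStandardForm]) (fun j c _ hj => ?_) (fun f g _ _ ihf ihg => ?_) g hg
  · have hmon : (Polynomial.X ^ m + Polynomial.C l).Monic := Polynomial.monic_X_pow_add_C l hm.ne'
    have hmon' := (Polynomial.monic_X_pow (R := L) (j % m)).mul (hmon.pow (j / m))
    have hdeg : (Polynomial.X ^ (j % m) *
        (Polynomial.X ^ m + Polynomial.C l) ^ (j / m)).natDegree = j := by
      rw [(Polynomial.monic_X_pow (j % m)).natDegree_mul (hmon.pow _), Polynomial.natDegree_X_pow,
        hmon.natDegree_pow, Polynomial.natDegree_X_pow_add_C, mul_comm, Nat.mod_add_div]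
    have hform : polynomialStandardForm A ρ l m (Polynomial.C c * Polynomial.X ^ j) =
        Polynomial.C (algebraMap A L c / ρ ^ (j / m)) * (Polynomial.X ^ (j % m) *
          (Polynomial.X ^ m + Polynomial.C l) ^ (j / m)) := by
      rw [polynomialStandardForm, Polynomial.C_mul_X_pow_eq_monomial, standardForm_monomial,
        div_eq_mul_inv, ← inv_pow, mul_pow, map_mul, map_pow, RingHom.comp_apply]
      ring
    rw [hform]
    refine ⟨(Polynomial.natDegree_C_mul_le _ _).trans (hdeg.le.trans hj), ?_⟩
    rw [Polynomial.coeff_C_mul, Polynomial.coeff_C_mul_X_pow]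
    split_ifs with h
    · subst h
      have hone := hmon'.coeff_natDegree
      rw [hdeg] at hone
      rw [hone, mul_one]
    · rw [Polynomial.coeff_eq_zero_of_natDegree_lt (by omega), mul_zero, map_zero, zero_div]
  · simp only [polynomialStandardForm, standardForm_add, Polynomial.coeff_add, map_add,
      add_div] at ihf ihg ⊢
    exact ⟨Polynomial.natDegree_add_le_of_degree_le ihf.1 ihg.1, by rw [ihf.2, ihg.2]⟩

lemma natDegree_le_of_polynomialStandardForm [FaithfulSMul A L] (hρ : ρ ≠ 0) (hm : 0 < m)
    {g : Polynomial A} {d : ℕ}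
    (h : (polynomialStandardForm A ρ l m g).natDegree ≤ d) : g.natDegree ≤ d := by
  by_contra! hd
  have h1 := (polynomialStandardForm_natDegree_le_and_coeff (ρ := ρ) l hm (le_refl g.natDegree)).2
  rw [Polynomial.coeff_eq_zero_of_natDegree_lt (h.trans_lt hd), eq_comm, div_eq_zero_iff,
    or_iff_left (pow_ne_zero _ hρ), FaithfulSMul.algebraMap_eq_zero_iff,
    Polynomial.coeff_natDegree, Polynomial.leadingCoeff_eq_zero] at h1
  simp [h1] at hd

lemma eq_zero_of_polynomialStandardForm_eq_zero [FaithfulSMul A L] (hρ : ρ ≠ 0) (hm : 0 < m)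
    {g : Polynomial A}
    (h : polynomialStandardForm A ρ l m g = 0) : g = 0 := by
  have hdeg : g.natDegree ≤ 0 := natDegree_le_of_polynomialStandardForm l hρ hm (by simp [h])
  have h1 := (polynomialStandardForm_natDegree_le_and_coeff (ρ := ρ) l hm hdeg).2
  rw [h, Polynomial.coeff_zero, Nat.zero_div, pow_zero, div_one, eq_comm,
    FaithfulSMul.algebraMap_eq_zero_iff] at h1
  rw [Polynomial.eq_C_of_natDegree_le_zero hdeg, h1, map_zero]

end PolynomialStandardForm

/-- An abstract description of the ring `A[y, z] / (r z - y ^ m - l)` by its generators over `A`,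
together with its embedding into `L[Y]`, where `L` is the fraction field of `A`. -/
structure Model (k A L B : Type*) [Field k] [CommRing A] [Algebra k A] [Field L] [Algebra k L]
    [Algebra A L] [CommRing B] [Algebra k B] (r : A) (m : ℕ) (l : k) where
  coord : A →ₐ[k] B
  y : B
  z : B
  emb : B →ₐ[k] Polynomial L
  emb_coord : ∀ a, emb (coord a) = Polynomial.C (algebraMap A L a)
  emb_y : emb y = Polynomial.X
  emb_z : emb z = Polynomial.C (algebraMap A L r)⁻¹ *
    (Polynomial.X ^ m + Polynomial.C (algebraMap k L l))
  exists_standardForm : ∀ b, ∃ g, b = standardForm (coord : A →+* B) y z m g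

namespace Model

variable {k A L B : Type*} [Field k] [CommRing A] [Algebra k A] [Field L] [Algebra k L]
  [Algebra A L] [CommRing B] [Algebra k B] {r : A} {m : ℕ} {l : k} (M : Model k A L B r m l)

lemma emb_standardForm (g : Polynomial A) :
    M.emb (standardForm (M.coord : A →+* B) M.y M.z m g) =
      polynomialStandardForm A (algebraMap A L r) (algebraMap k L l) m g := by
  have h : ((M.emb : B →+* Polynomial L).comp (M.coord : A →+* B)) =
      Polynomial.C.comp (algebraMap A L) := RingHom.ext M.emb_coord
  have h' := map_standardForm (M.coord : A →+* B) M.y M.z m (M.emb : B →+* Polynomial L) g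
  rw [h] at h'
  simpa only [RingHom.coe_coe, M.emb_y, M.emb_z, polynomialStandardForm] using h'

lemma exists_emb_eq (b : B) : ∃ g, b = standardForm (M.coord : A →+* B) M.y M.z m g ∧
    M.emb b = polynomialStandardForm A (algebraMap A L r) (algebraMap k L l) m g := by
  obtain ⟨g, hg⟩ := M.exists_standardForm b
  exact ⟨g, hg, by rw [hg, emb_standardForm]⟩

variable [IsFractionRing A L]

lemma emb_injective (hr : r ≠ 0) (hm : 0 < m) : Function.Injective M.emb := by
  rw [injective_iff_map_eq_zero]
  intro b hb
  obtain ⟨g, hg, hgb⟩ := M.exists_emb_eq b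
  rw [hb] at hgb
  rw [hg, eq_zero_of_polynomialStandardForm_eq_zero _ (by simpa using hr) hm hgb.symm,
    standardForm_zero]

lemma exists_eq_coord (hr : r ≠ 0) (hm : 0 < m) {b : B} (hb : (M.emb b).natDegree = 0) :
    ∃ a, b = M.coord a := by
  obtain ⟨g, hg, hgb⟩ := M.exists_emb_eq b
  have hdeg : g.natDegree ≤ 0 :=
    natDegree_le_of_polynomialStandardForm _ (by simpa using hr) hm (hgb ▸ hb.le)
  refine ⟨g.coeff 0, ?_⟩
  conv_lhs => rw [hg, Polynomial.eq_C_of_natDegree_le_zero hdeg, standardForm_C]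
  rfl

lemma exists_eq_coord_mul_add (hr : r ≠ 0) (hm : 2 ≤ m) {b : B} (hb : (M.emb b).natDegree ≤ 1) :
    ∃ a c, b = M.coord a * M.y + M.coord c := by
  obtain ⟨g, hg, hgb⟩ := M.exists_emb_eq b
  have hdeg : g.natDegree ≤ 1 :=
    natDegree_le_of_polynomialStandardForm _ (by simpa using hr) (by omega) (hgb ▸ hb)
  refine ⟨g.coeff 1, g.coeff 0, ?_⟩
  conv_lhs => rw [hg, Polynomial.eq_X_add_C_of_natDegree_le_one hdeg,
    Polynomial.C_mul_X_eq_monomial, standardForm_add]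
  simp [Nat.mod_eq_of_lt (show 1 < m by omega), Nat.div_eq_of_lt (show 1 < m by omega)]

lemma exists_isUnit_emb_mul (t : Polynomial L) : ∃ s b, IsUnit (M.emb s) ∧
    M.emb b = M.emb s * t := by
  obtain ⟨a, ha0, ha⟩ := IsLocalization.integerNormalization_spec (nonZeroDivisors A) t
  have hX : ∀ p : Polynomial A, p.map (algebraMap A L) =
      M.emb (p.eval₂ (M.coord : A →+* B) M.y) := by
    intro p
    induction p using Polynomial.induction_on' with
    | add p q hp hq => simp only [Polynomial.map_add, Polynomial.eval₂_add, map_add, hp, hq]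
    | monomial d a =>
      simp [Polynomial.eval₂_monomial, M.emb_coord, M.emb_y, Polynomial.C_mul_X_pow_eq_monomial]
  refine ⟨M.coord a, _, ?_, (hX _).symm.trans (ha.trans ?_)⟩
  · rw [M.emb_coord, Polynomial.isUnit_C]
    exact IsLocalization.map_units L ⟨a, ha0⟩
  · rw [M.emb_coord, ← Polynomial.smul_eq_C_mul, algebraMap_smul]

/-- The derivation `r ∂/∂y` of a model. -/
lemma exists_derivation (hr : r ≠ 0) (hm : 0 < m) : ∃ D : Derivation k B B,
    ∀ b, M.emb (D b) = Polynomial.C (algebraMap A L r) * Polynomial.derivative (M.emb b) := by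
  have hinj := M.emb_injective hr hm
  have hr' : algebraMap A L r ≠ 0 := by simpa using hr
  let S : Subalgebra k B :=
  { carrier := {b | ∃ c, M.emb c =
      Polynomial.C (algebraMap A L r) * Polynomial.derivative (M.emb b)}
    mul_mem' := by
      rintro a b ⟨a', ha⟩ ⟨b', hb⟩
      refine ⟨a' * b + a * b', ?_⟩
      simp only [map_add, map_mul, ha, hb, Polynomial.derivative_mul]
      ring
    add_mem' := by
      rintro a b ⟨a', ha⟩ ⟨b', hb⟩
      exact ⟨a' + b', by simp only [map_add, ha, hb, mul_add]⟩
    algebraMap_mem' := fun c => ⟨0, by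
      rw [AlgHom.commutes, Polynomial.algebraMap_apply, Polynomial.derivative_C]; simp⟩ }
  have hS : ∀ b, b ∈ S := by
    intro b
    obtain ⟨g, rfl⟩ := M.exists_standardForm b
    refine S.sum_mem fun d _ => S.mul_mem ?_ (S.mul_mem (S.pow_mem ?_ _) (S.pow_mem ?_ _))
    · exact ⟨0, by simp [M.emb_coord]⟩
    · exact ⟨M.coord r, by simp [M.emb_coord, M.emb_y]⟩
    · refine ⟨(m : B) * M.y ^ (m - 1), ?_⟩
      simp only [map_mul, map_natCast, map_pow, M.emb_y, M.emb_z, Polynomial.derivative_C_mul,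
        Polynomial.derivative_add, Polynomial.derivative_X_pow, Polynomial.derivative_C, add_zero]
      rw [← mul_assoc, ← Polynomial.C_mul, mul_inv_cancel₀ hr', Polynomial.C_1, one_mul]
  choose D hD using hS
  refine ⟨Derivation.mk' (LinearMap.mk ⟨D, fun a b => hinj ?_⟩ fun c a => hinj ?_)
    fun a b => hinj ?_, hD⟩
  · simp only [map_add, hD, mul_add]
  · simp only [map_smul, hD, Polynomial.derivative_smul, mul_smul_comm, RingHom.id_apply]
  · simp only [LinearMap.coe_mk, AddHom.coe_mk, hD, map_add, smul_eq_mul, map_mul,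
      Polynomial.derivative_mul]
    ring

lemma emb_apply_of_locallyNilpotent [IsDomain A] [CharZero k] [IsScalarTower k A L] {R : A} {m : ℕ}
    (M : Model k A L B (R ^ 2) m l) (hR : R ≠ 0)
    (hm : 2 ≤ m) (s : Finset A) (hs : Algebra.adjoin k (s : Set A) = ⊤) (hsR : ∀ x ∈ s, x ∣ R)
    (D : Derivation k B B) (hD : ∀ b, ∃ N, D^[N] b = 0) (b : B) :
    M.emb (D b) = Polynomial.derivative (M.emb b) * M.emb (D M.y) := by
  have hr : R ^ 2 ≠ 0 := pow_ne_zero _ hR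
  have hρ : algebraMap A L (R ^ 2) ≠ 0 := by simpa using hR
  have hm0 : 0 < m := by omega
  have hinj := M.emb_injective hr hm0
  obtain ⟨D', hD'⟩ := Derivation.exists_extension M.emb hinj M.exists_isUnit_emb_mul D
  have hiter : ∀ N b, D'^[N] (M.emb b) = M.emb (D^[N] b) := by
    intro N b
    induction N with
    | zero => rfl
    | succ N ih => rw [Function.iterate_succ_apply', ih, hD', Function.iterate_succ_apply']
  have hC : ∀ c : L, D' (Polynomial.C c) = 0 := by
    refine Derivation.apply_C_eq_zero_of_locallyNilpotent hR hm s hs hsR D' (Set.range M.emb)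
      ?_ ?_ ?_ ?_
    · intro d a
      have h := polynomialStandardForm_natDegree_le_and_coeff (A := A)
        (ρ := algebraMap A L (R ^ 2)) (algebraMap k L l) hm0
        (Polynomial.natDegree_monomial_le a (m := d))
      refine ⟨_, ⟨_, M.emb_standardForm (Polynomial.monomial d a)⟩, ?_⟩
      rw [← map_pow]
      exact ⟨h.1, by simpa using h.2⟩
    · rintro _ ⟨b, rfl⟩ d hd
      obtain ⟨g, -, hg⟩ := M.exists_emb_eq b
      rw [hg] at hd ⊢
      exact ⟨_, by simpa using (polynomialStandardForm_natDegree_le_and_coeff _ hm0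
        (natDegree_le_of_polynomialStandardForm _ hρ hm0 hd)).2⟩
    · rintro _ ⟨b, rfl⟩
      exact ⟨_, (hD' b).symm⟩
    · rintro _ ⟨b, rfl⟩
      obtain ⟨N, hN⟩ := hD b
      exact ⟨N, by rw [hiter, hN, map_zero]⟩
  rw [← hD', ← hD', M.emb_y]
  induction M.emb b using Polynomial.induction_on' with
  | add p q hp hq => rw [map_add, hp, hq, Polynomial.derivative_add, add_mul]
  | monomial d a =>
    rw [← Polynomial.C_mul_X_pow_eq_monomial, Derivation.leibniz, hC, Derivation.leibniz_pow]
    simp only [smul_eq_mul, nsmul_eq_mul, mul_zero, add_zero, Polynomial.derivative_C_mul,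
      Polynomial.derivative_X_pow, Polynomial.C_eq_natCast]
    ring

end Model

lemma polynomialStandardForm_of_natDegree_lt {A L : Type*} [CommRing A] [Field L] [Algebra A L]
    {ρ l : L} {m : ℕ} {g : Polynomial A} (hg : g.natDegree < m) :
    polynomialStandardForm A ρ l m g = g.map (algebraMap A L) := by
  rw [polynomialStandardForm, standardForm, Polynomial.map, Polynomial.eval₂_eq_sum]
  refine Finset.sum_congr rfl fun d hd => ?_
  have hd : d < m := (Polynomial.le_natDegree_of_mem_supp d hd).trans_lt hg
  simp [Nat.mod_eq_of_lt hd, Nat.div_eq_of_lt hd]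

namespace Model

variable {k A L B B' : Type*} [Field k] [CommRing A] [Algebra k A] [Field L]
  [Algebra k L] [Algebra A L] [CommRing B] [Algebra k B] [CommRing B'] [Algebra k B']

/-- Transport of a model along an isomorphism. -/
noncomputable def ofAlgEquiv {r : A} {m : ℕ} {l : k} (M : Model k A L B r m l) (e : B ≃ₐ[k] B') :
    Model k A L B' r m l where
  coord := (e : B →ₐ[k] B').comp M.coord
  y := e M.y
  z := e M.z
  emb := M.emb.comp (e.symm : B' →ₐ[k] B)
  emb_coord a := by simp [M.emb_coord]
  emb_y := by simp [M.emb_y]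
  emb_z := by simp [M.emb_z]
  exists_standardForm b := by
    obtain ⟨g, hg⟩ := M.exists_standardForm (e.symm b)
    refine ⟨g, ?_⟩
    rw [AlgEquiv.symm_apply_eq] at hg
    rw [hg]
    exact map_standardForm (M.coord : A →+* B) M.y M.z m (e : B →+* B') g

lemma coord_mul_z {r : A} {m : ℕ} {l : k} [IsFractionRing A L] (M : Model k A L B r m l)
    (hr : r ≠ 0) (hm : 0 < m) : M.coord r * M.z = M.y ^ m + algebraMap k B l := by
  have hr' : algebraMap A L r ≠ 0 := by simpa using hr
  apply M.emb_injective hr hm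
  rw [map_mul, map_add, map_pow, M.emb_coord, M.emb_y, M.emb_z, AlgHom.commutes, ← mul_assoc,
    ← Polynomial.C_mul, mul_inv_cancel₀ hr', Polynomial.C_1, one_mul, Polynomial.algebraMap_apply]

/-- Comparison of the coefficients of `Y ^ m`, `Y ^ (m - 1)` and `1` in the relation of `M`, written
in terms of the coordinates of `M'`. -/
lemma exists_mul_eq [IsScalarTower k A L] [IsFractionRing A L] {r : A} {m : ℕ} {l l' : k}
    (M : Model k A L B r m l) (M' : Model k A L B r m l') (hr : r ≠ 0) (hm : 2 ≤ m) {g a b : A}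
    (hg : M.coord r = M'.coord g) (hy : M.y = M'.coord a * M'.y + M'.coord b) :
    (∃ c, g * c = a ^ m * r) ∧ (∃ c, g * c = m * (a ^ (m - 1) * b)) ∧
      ∃ c, g * c + a ^ m * algebraMap k A l' = b ^ m + algebraMap k A l := by
  have hm0 : 0 < m := by omega
  have hρ : algebraMap A L r ≠ 0 := by simpa using hr
  have hinj := FaithfulSMul.algebraMap_injective A L
  have hg0 : g ≠ 0 := by
    rintro rfl
    rw [map_zero] at hg
    have h := M.emb_coord r
    rw [hg, map_zero, eq_comm, Polynomial.C_eq_zero] at h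
    exact hρ h
  have hrel := congrArg M'.emb (M.coord_mul_z hr hm0)
  obtain ⟨h, -, hh⟩ := M'.exists_emb_eq M.z
  have hcoeff : ∀ d, ((Polynomial.C (algebraMap A L a) * Polynomial.X +
      Polynomial.C (algebraMap A L b)) ^ m).coeff d =
      algebraMap A L a ^ d * (algebraMap A L b ^ (m - d) * (m.choose d : L)) := by
    intro d
    have hcomp : (Polynomial.C (algebraMap A L a) * Polynomial.X +
        Polynomial.C (algebraMap A L b)) ^ m =
        ((Polynomial.X + Polynomial.C (algebraMap A L b)) ^ m).comp
          (Polynomial.C (algebraMap A L a) * Polynomial.X) := by simp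
    rw [hcomp, Polynomial.comp_C_mul_X_coeff, Polynomial.coeff_X_add_C_pow, mul_comm]
  rw [hg, hy, map_mul, map_add, map_pow, map_add, map_mul, M'.emb_coord, M'.emb_coord,
    M'.emb_coord, M'.emb_y, AlgHom.commutes, Polynomial.algebraMap_apply] at hrel
  have hdeg : (M'.emb M.z).natDegree ≤ m := by
    have h1 := congrArg Polynomial.natDegree hrel
    rw [Polynomial.natDegree_C_mul (by simpa using hg0)] at h1
    rw [h1]
    refine (Polynomial.natDegree_add_C).le.trans (Polynomial.natDegree_pow_le_of_le m
      Polynomial.natDegree_linear_le |>.trans (by simp))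
  have hh' := natDegree_le_of_polynomialStandardForm _ hρ hm0 (hh ▸ hdeg)
  have hsplit : ∃ c : A, ∃ q : Polynomial A, q.natDegree < m ∧ h = q + Polynomial.monomial m c := by
    refine ⟨h.coeff m, h.erase m, ?_, by rw [add_comm, Polynomial.monomial_add_erase]⟩
    refine Nat.lt_of_le_pred hm0 (Polynomial.natDegree_le_iff_coeff_eq_zero.2 fun d hd => ?_)
    rw [Polynomial.coeff_erase]
    split_ifs with hdm
    · rfl
    · exact Polynomial.coeff_eq_zero_of_natDegree_lt (by rw [Nat.pred_eq_sub_one] at hd; omega)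
  obtain ⟨c, q, hq, rfl⟩ := hsplit
  have hform : M'.emb M.z = q.map (algebraMap A L) + Polynomial.C (algebraMap A L c) *
      (Polynomial.C (algebraMap A L r)⁻¹ *
        (Polynomial.X ^ m + Polynomial.C (algebraMap k L l'))) := by
    rw [hh, ← polynomialStandardForm_of_natDegree_lt (ρ := algebraMap A L r)
      (l := algebraMap k L l') hq]
    simp only [polynomialStandardForm, standardForm_add, standardForm_monomial]
    simp [Nat.div_self hm0]
  have hc := fun d => congrArg (Polynomial.coeff · d) hrel
  simp only [hform, Polynomial.coeff_add, Polynomial.coeff_C_mul, hcoeff, Polynomial.coeff_map,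
    Polynomial.coeff_X_pow, Polynomial.coeff_C] at hc
  have hcm := hc m
  have hcm' := hc (m - 1)
  have hc0 := hc 0
  rw [if_pos rfl, if_neg hm0.ne', if_neg hm0.ne',
    Polynomial.coeff_eq_zero_of_natDegree_lt hq] at hcm
  rw [if_neg (by omega), if_neg (by omega), if_neg (by omega), Nat.sub_sub_self (by omega),
    Nat.choose_symm (by omega), Nat.choose_one_right] at hcm'
  rw [if_neg hm0.ne, if_pos rfl, if_pos rfl] at hc0
  simp only [map_zero, zero_add, add_zero, mul_one, Nat.sub_self, pow_zero, one_mul,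
    Nat.choose_self, Nat.cast_one, Nat.sub_zero, Nat.choose_zero_right, mul_zero, pow_one]
    at hcm hcm' hc0
  have hgc : algebraMap A L g * algebraMap A L c = algebraMap A L a ^ m * algebraMap A L r := by
    rw [← hcm]
    field_simp
  refine ⟨⟨c, hinj (by simpa using hgc)⟩, ⟨q.coeff (m - 1), hinj ?_⟩, ⟨q.coeff 0, hinj ?_⟩⟩
  · simp only [map_mul, map_pow, _root_.map_natCast, hcm']
    ring
  · simp only [map_mul, map_pow, map_add, ← IsScalarTower.algebraMap_apply]
    rw [← hc0]
    field_simp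
    linear_combination (-algebraMap k L l') * hgc

lemma isUnit_of_y_eq [FaithfulSMul A L] {r : A} {m : ℕ} {l l' : k} (M : Model k A L B r m l)
    (M' : Model k A L B r m l') (hσ : ∀ a, ∃ c, M.coord a = M'.coord c) {a b a' b' : A}
    (hy : M.y = M'.coord a * M'.y + M'.coord b) (hy' : M'.y = M.coord a' * M.y + M.coord b') :
    IsUnit a := by
  obtain ⟨c, hc⟩ := hσ a'
  obtain ⟨d, hd⟩ := hσ b'
  refine IsUnit.of_mul_eq_one_right c (FaithfulSMul.algebraMap_injective A L ?_)
  rw [hc, hd, hy] at hy'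
  have h := congrArg (fun b => (M'.emb b).coeff 1) hy'
  simp only [map_add, map_mul, M'.emb_coord, M'.emb_y, Polynomial.coeff_add,
    Polynomial.coeff_C_mul, Polynomial.coeff_X_one, mul_one, Polynomial.coeff_C_succ,
    add_zero] at h
  rw [map_mul, map_one, h]

variable [CharZero k] [IsScalarTower k A L] [IsDomain A] [IsFractionRing A L]
  {R : A} {m : ℕ} {l l' : k}

/-- Two models of the same ring have the same coordinate subring, and the `y`-coordinate of one is
affine in the `y`-coordinate of the other. -/
lemma exists_coord_eq_and_y_eq (M : Model k A L B (R ^ 2) m l) (M' : Model k A L B (R ^ 2) m l')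
    (hR : R ≠ 0) (hm : 2 ≤ m) {s : Finset A} (hs : Algebra.adjoin k (s : Set A) = ⊤)
    (hsR : ∀ x ∈ s, x ∣ R) :
    (∀ a, ∃ c, M.coord a = M'.coord c) ∧
    ∃ a c, M.y = M'.coord a * M'.y + M'.coord c := by
  have : CharZero L := charZero_of_injective_algebraMap (algebraMap k L).injective
  have hm0 : 0 < m := by omega
  have hr : R ^ 2 ≠ 0 := pow_ne_zero _ hR
  have hρ : algebraMap A L (R ^ 2) ≠ 0 := by simpa using hR
  obtain ⟨D, hD⟩ := M.exists_derivation hr hm0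
  have hiter : ∀ N b, M.emb (D^[N] b) = Polynomial.C (algebraMap A L (R ^ 2)) ^ N *
      Polynomial.derivative^[N] (M.emb b) := by
    intro N b
    induction N with
    | zero => simp
    | succ N ih =>
      rw [Function.iterate_succ_apply', hD, ih, ← Polynomial.C_pow, Polynomial.derivative_C_mul,
        Function.iterate_succ_apply', Polynomial.C_pow]
      ring
  have hnil : ∀ b, ∃ N, D^[N] b = 0 := fun b => ⟨(M.emb b).natDegree + 1,
    M.emb_injective hr hm0 (by
      rw [hiter, Polynomial.iterate_derivative_eq_zero (Nat.lt_succ_self _), mul_zero, map_zero])⟩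
  have hcoord : ∀ a, D (M.coord a) = 0 := fun a => M.emb_injective hr hm0 (by
    rw [hD, M.emb_coord, Polynomial.derivative_C, mul_zero, map_zero])
  have hy : D M.y = M.coord (R ^ 2) := M.emb_injective hr hm0 (by
    rw [hD, M.emb_coord, M.emb_y, Polynomial.derivative_X, mul_one])
  have key := M'.emb_apply_of_locallyNilpotent hR hm s hs hsR D hnil
  have hne : M'.emb (D M.y) ≠ 0 := by
    rw [hy, map_ne_zero_iff _ (M'.emb_injective hr hm0),
      ← map_ne_zero_iff _ (M.emb_injective hr hm0), M.emb_coord]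
    simpa using hR
  have hDy : M'.emb (D M'.y) ≠ 0 := right_ne_zero_of_mul (key M.y ▸ hne)
  have hdeg : ∀ a, (M'.emb (M.coord a)).natDegree = 0 := fun a => by
    have h := key (M.coord a)
    rw [hcoord, map_zero, eq_comm, mul_eq_zero, or_iff_left hDy] at h
    exact Polynomial.derivative_eq_zero.1 h
  refine ⟨fun a => M'.exists_eq_coord hr hm0 (hdeg a), M'.exists_eq_coord_mul_add hr hm ?_⟩
  have h := congrArg Polynomial.natDegree (key M.y)
  rw [Polynomial.natDegree_mul (left_ne_zero_of_mul (key M.y ▸ hne)) hDy, hy, hdeg,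
    Polynomial.natDegree_derivative] at h
  omega

/-- If two models with parameters `l` and `l'` describe the same ring, then the
parameters agree up to the `m`-th power of a unit of `k`. -/
lemma exists_eq_pow_mul (M : Model k A L B (R ^ 2) m l) (M' : Model k A L B (R ^ 2) m l')
    (hR : R ≠ 0) (hm : 2 ≤ m) {s : Finset A} (hs : Algebra.adjoin k (s : Set A) = ⊤)
    (hsR : ∀ x ∈ s, x ∣ R) (ε : A →ₐ[k] k) (hε : ε R = 0) :
    ∃ α : kˣ, l = (α : k) ^ m * l' := by
  have hm0 : 0 < m := by omega
  have hr : R ^ 2 ≠ 0 := pow_ne_zero _ hR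
  have hρ : algebraMap A L (R ^ 2) ≠ 0 := by simpa using hR
  have hinj := FaithfulSMul.algebraMap_injective A L
  have hcinj : Function.Injective M'.coord := fun a b h => by
    have h := congrArg M'.emb h
    rw [M'.emb_coord, M'.emb_coord] at h
    exact hinj (Polynomial.C_injective h)
  obtain ⟨hσ, a, b, hy⟩ := M.exists_coord_eq_and_y_eq M' hR hm hs hsR
  obtain ⟨hτ, a', b', hy'⟩ := M'.exists_coord_eq_and_y_eq M hR hm hs hsR
  have ha := M.isUnit_of_y_eq M' hσ hy hy'
  have ha' := M'.isUnit_of_y_eq M hτ hy' hy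
  obtain ⟨g, hg⟩ := hσ (R ^ 2)
  obtain ⟨g', hg'⟩ := hτ (R ^ 2)
  obtain ⟨-, ⟨d, hd⟩, e, he⟩ := M.exists_mul_eq M' hr hm hg hy
  obtain ⟨⟨c, hc⟩, -⟩ := M'.exists_mul_eq M hr hm hg' hy'
  obtain ⟨u, hu⟩ := (ha'.pow m).exists_left_inv
  have hdvd : R ^ 2 ∣ g := by
    obtain ⟨v, hv⟩ := hσ (c * u)
    refine ⟨v, hcinj ?_⟩
    rw [map_mul, ← hv, hg', ← map_mul, ← hg]
    congr 1
    linear_combination (-R ^ 2) * hu - u * hc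
  have hεg : ε g = 0 := by
    obtain ⟨v, rfl⟩ := hdvd
    rw [map_mul, map_pow, hε, zero_pow two_ne_zero, zero_mul]
  have hεa := ha.map ε
  have hεb : ε b = 0 := by
    have h := congrArg ε hd
    rw [map_mul, hεg, zero_mul, map_mul, map_mul, map_pow, _root_.map_natCast, eq_comm, mul_eq_zero,
      or_iff_right (Nat.cast_ne_zero.2 hm0.ne'), mul_eq_zero,
      or_iff_right (pow_ne_zero _ hεa.ne_zero)] at h
    exact h
  refine ⟨hεa.unit, ?_⟩
  have h := congrArg ε he
  simp only [map_add, map_mul, map_pow, hεg, hεb, zero_pow hm0.ne', AlgHom.commutes,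
    zero_mul, zero_add, Algebra.algebraMap_self, RingHom.id_apply] at h
  exact h.symm

end Model

section Presentation

variable {k : Type*} [Field k] {n m : ℕ} {l : k} {S : Type*} [CommRing S] [Algebra k S]

variable (n m l) in
/-- The class of the `i`-th variable `xᵢ`. -/
noncomputable def xClass (i : Fin n) : danielewskiRing k n m l :=
  Ideal.Quotient.mk _ (X (Fin.castAdd 2 i))

variable (k n m l) in
/-- The class of the variable `y`. -/
noncomputable def yClass : danielewskiRing k n m l :=
  Ideal.Quotient.mk _ (X (⟨n, by omega⟩ : Fin (n + 2)))

variable (k n m l) in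
/-- The class of the variable `z`. -/
noncomputable def zClass : danielewskiRing k n m l :=
  Ideal.Quotient.mk _ (X (⟨n + 1, by omega⟩ : Fin (n + 2)))

variable (k n m l) in
lemma prod_xClass_mul_zClass : (∏ i, xClass n m l i ^ 2) * zClass k n m l =
    yClass k n m l ^ m + algebraMap k _ l := by
  have h : (Ideal.Quotient.mk _ _ : danielewskiRing k n m l) = 0 :=
    Ideal.Quotient.eq_zero_iff_mem.2 (Ideal.subset_span rfl)
  rw [map_sub, map_sub, map_mul, map_prod, sub_eq_zero, sub_eq_iff_eq_add'] at h
  simp only [map_pow] at h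
  exact h

/-- Images of the generators satisfying the defining relation determine a homomorphism. -/
lemma exists_algHom (v : Fin n → S) (y z : S)
    (h : (∏ i, v i ^ 2) * z = y ^ m + algebraMap k S l) :
    ∃ f : danielewskiRing k n m l →ₐ[k] S, (∀ i, f (xClass n m l i) = v i) ∧
      f (yClass k n m l) = y ∧ f (zClass k n m l) = z := by
  let w : Fin (n + 2) → S := Fin.append v ![y, z]
  have hy : w ⟨n, by omega⟩ = y := Fin.append_right v ![y, z] 0
  have hz : w ⟨n + 1, by omega⟩ = z := Fin.append_right v ![y, z] 1
  have hx : ∀ i, w (Fin.castAdd 2 i) = v i := fun i => Fin.append_left v ![y, z] i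
  refine ⟨Ideal.Quotient.liftₐ _ (aeval w) fun a ha => ?_, fun i => ?_, ?_, ?_⟩
  · refine (Ideal.span_le (I := RingHom.ker (aeval w))).2 ?_ ha
    rintro _ rfl
    simp [hx, hy, hz, h]
  · exact (aeval_X w _).trans (hx i)
  · exact (aeval_X w _).trans hy
  · exact (aeval_X w _).trans hz

lemma induction_on_classes {P : danielewskiRing k n m l → Prop}
    (algebraMap : ∀ c, P (algebraMap k _ c)) (add : ∀ a b, P a → P b → P (a + b))
    (mul_x : ∀ a i, P a → P (a * xClass n m l i)) (mul_y : ∀ a, P a → P (a * yClass k n m l))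
    (mul_z : ∀ a, P a → P (a * zClass k n m l)) (b : danielewskiRing k n m l) : P b := by
  obtain ⟨p, rfl⟩ := Ideal.Quotient.mk_surjective b
  induction p using MvPolynomial.induction_on with
  | C c => exact algebraMap c
  | add p q hp hq => exact add _ _ hp hq
  | mul_X p i hp =>
    rw [map_mul]
    induction i using Fin.addCases with
    | left i => exact mul_x _ i hp
    | right i =>
      fin_cases i
      · exact mul_y _ hp
      · exact mul_z _ hp

lemma algHom_ext {f g : danielewskiRing k n m l →ₐ[k] S}
    (hx : ∀ i, f (xClass n m l i) = g (xClass n m l i))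
    (hy : f (yClass k n m l) = g (yClass k n m l))
    (hz : f (zClass k n m l) = g (zClass k n m l)) : f = g := by
  refine AlgHom.ext fun b => ?_
  induction b using induction_on_classes with
  | algebraMap c => rw [AlgHom.commutes, AlgHom.commutes]
  | add a b ha hb => rw [map_add, map_add, ha, hb]
  | mul_x a i ha => rw [map_mul, map_mul, ha, hx]
  | mul_y a ha => rw [map_mul, map_mul, ha, hy]
  | mul_z a ha => rw [map_mul, map_mul, ha, hz]

/-- `danielewskiRing k n m l` as a ring over `k[x₁, …, xₙ]`. -/
lemma nonempty_model (L : Type*) [Field L] [Algebra k L] [Algebra (MvPolynomial (Fin n) k) L]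
    [IsScalarTower k (MvPolynomial (Fin n) k) L] [IsFractionRing (MvPolynomial (Fin n) k) L]
    (hm : 0 < m) :
    Nonempty (Model k (MvPolynomial (Fin n) k) L (danielewskiRing k n m l)
      ((∏ i, X i) ^ 2) m l) := by
  have hρ : algebraMap (MvPolynomial (Fin n) k) L ((∏ i, X i) ^ 2) ≠ 0 := by
    simp [Finset.prod_eq_zero_iff]
  have hprod : (∏ i : Fin n, (X i : MvPolynomial (Fin n) k)) ^ 2 = ∏ i, X i ^ 2 :=
    (Finset.prod_pow _ _ _).symm
  obtain ⟨f, hfx, hfy, hfz⟩ := exists_algHom (m := m) (l := l)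
    (fun i => (Polynomial.C (algebraMap (MvPolynomial (Fin n) k) L (X i)))) Polynomial.X
    (Polynomial.C (algebraMap (MvPolynomial (Fin n) k) L ((∏ i, X i) ^ 2))⁻¹ *
      (Polynomial.X ^ m + Polynomial.C (algebraMap k L l))) (by
      rw [← mul_assoc, Polynomial.algebraMap_apply]
      simp only [← map_pow, ← map_prod, ← hprod]
      rw [← Polynomial.C_mul, mul_inv_cancel₀ hρ, Polynomial.C_1, one_mul])
  refine ⟨aeval (xClass n m l), yClass k n m l, zClass k n m l, f, fun a => ?_, hfy, hfz, ?_⟩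
  · have h : f.comp (aeval (xClass n m l)) =
        ((Algebra.ofId L (Polynomial L)).restrictScalars k).comp
          (IsScalarTower.toAlgHom k (MvPolynomial (Fin n) k) L) := by
      ext i
      simp [hfx]
    exact DFunLike.congr_fun h a
  · have hrel : ((aeval (xClass n m l) : MvPolynomial (Fin n) k →ₐ[k] _) :
        MvPolynomial (Fin n) k →+* _) ((∏ i, X i) ^ 2) * zClass k n m l =
        yClass k n m l ^ m + ((aeval (xClass n m l) : MvPolynomial (Fin n) k →ₐ[k] _) :
          MvPolynomial (Fin n) k →+* _) (C l) := by
      rw [hprod]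
      simpa using prod_xClass_mul_zClass k n m l
    intro b
    induction b using induction_on_classes with
    | algebraMap c => exact ⟨Polynomial.C (C c), by simp⟩
    | add a b ha hb =>
      obtain ⟨p, rfl⟩ := ha
      obtain ⟨q, rfl⟩ := hb
      exact ⟨p + q, (standardForm_add ..).symm⟩
    | mul_x a i ha => simpa using exists_standardForm_mul_map ha (X i)
    | mul_y a ha => exact exists_standardForm_mul_left hm hrel ha
    | mul_z a ha => exact exists_standardForm_mul_right hm ha

lemma exists_algHom_scale {l' : k} {u : k} (h : u ^ m * l' = l) :
    ∃ f : danielewskiRing k n m l →ₐ[k] danielewskiRing k n m l',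
      (∀ i, f (xClass n m l i) = xClass n m l' i) ∧
      f (yClass k n m l) = u • yClass k n m l' ∧
      f (zClass k n m l) = u ^ m • zClass k n m l' := by
  refine exists_algHom _ _ _ ?_
  rw [mul_smul_comm, prod_xClass_mul_zClass, smul_add, smul_pow, ← h, map_mul, Algebra.smul_def
    (u ^ m) (algebraMap k (danielewskiRing k n m l') l')]

end Presentation

end Danielewski

/-- **Proposition.** Let `k` be a field of characteristic zero, `n ≥ 1` and `m ≥ 2`.
For `λ, λ' ∈ k`, the `k`-algebras `B_λ = k[x₁,…,xₙ,y,z]/(x₁²⋯xₙ²·z − y^m − λ)` and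
`B_{λ'}` are isomorphic if and only if `λ = α^m·λ'` for some `α ∈ k*`. -/
theorem danielewskiRing_iso_iff (k : Type*) [Field k] [CharZero k]
    (n m : ℕ) (hn : 1 ≤ n) (hm : 2 ≤ m) (lam lam' : k) :
    Nonempty (danielewskiRing k n m lam ≃ₐ[k] danielewskiRing k n m lam') ↔
      ∃ α : kˣ, lam = (α : k) ^ m * lam' := by
  classical
  constructor
  · rintro ⟨e⟩
    have hm0 : 0 < m := by omega
    obtain ⟨M⟩ := Danielewski.nonempty_model (n := n) (l := lam)
      (FractionRing (MvPolynomial (Fin n) k)) hm0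
    obtain ⟨M'⟩ := Danielewski.nonempty_model (n := n) (l := lam')
      (FractionRing (MvPolynomial (Fin n) k)) hm0
    refine (M.ofAlgEquiv e).exists_eq_pow_mul M' (s := Finset.univ.image X)
      (by simp [Finset.prod_eq_zero_iff]) hm (by simp [adjoin_range_X])
      (fun x hx => ?_) (aeval 0) ?_
    · obtain ⟨i, -, rfl⟩ := Finset.mem_image.1 hx
      exact Finset.dvd_prod_of_mem _ (Finset.mem_univ i)
    · rw [map_prod]
      exact Finset.prod_eq_zero (Finset.mem_univ ⟨0, hn⟩) (by simp)
  · rintro ⟨α, hα⟩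
    obtain ⟨f, hfx, hfy, hfz⟩ := Danielewski.exists_algHom_scale (n := n) (m := m) hα.symm
    obtain ⟨g, hgx, hgy, hgz⟩ := Danielewski.exists_algHom_scale (n := n) (m := m) (l := lam')
      (l' := lam)
      (u := ((α⁻¹ : kˣ) : k)) (by rw [hα, ← mul_assoc, ← mul_pow]; simp)
    refine ⟨AlgEquiv.ofAlgHom f g (Danielewski.algHom_ext ?_ ?_ ?_)
      (Danielewski.algHom_ext ?_ ?_ ?_)⟩ <;>
      simp [hfx, hfy, hfz, hgx, hgy, hgz, smul_smul]
end

section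
/- Let n ≥ 1, let A = ℂ[x₁,…,xₙ] be the polynomial ring, equipped with two ℤ-gradings 𝒜 and ℬ, each making A a graded ℂ-algebra, let m be a nonzero integer, and let f ∈ A be homogeneous of degree m for 𝒜 and g ∈ A be homogeneous of degree m for ℬ. Let a, b ≥ 1 be integers with a·b ≡ 1 (mod m²). Then for all integers ℓ, ℓ' ≥ 1, the ℂ-algebras R_{f,ℓ} ⊗_ℂ R_{g,ℓ'} and R_{f,aℓ} ⊗_ℂ R_{g,bℓ'} are isomorphic. -/
open LaurentPolynomial TensorProduct

/-- `R_{h,j} = A[T,T⁻¹]/(T^j·h − 1)` for `A = ℂ[x₁,…,xₙ]`, the coordinate ring of the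
hypersurface `X̃_{h,j}` defined by `t^j h = 1`. -/
noncomputable def hypersurfaceRing (n : ℕ) (h : MvPolynomial (Fin n) ℂ) (j : ℤ) :
    Type :=
  LaurentPolynomial (MvPolynomial (Fin n) ℂ) ⧸ Ideal.span {T j * C h - 1}

noncomputable instance (n : ℕ) (h : MvPolynomial (Fin n) ℂ) (j : ℤ) :
    CommRing (hypersurfaceRing n h j) :=
  inferInstanceAs (CommRing (LaurentPolynomial (MvPolynomial (Fin n) ℂ) ⧸
    Ideal.span {T j * C h - 1}))

noncomputable instance (n : ℕ) (h : MvPolynomial (Fin n) ℂ) (j : ℤ) :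
    Algebra ℂ (hypersurfaceRing n h j) :=
  inferInstanceAs (Algebra ℂ (LaurentPolynomial (MvPolynomial (Fin n) ℂ) ⧸
    Ideal.span {T j * C h - 1}))

namespace GradedAlgebra

variable {k A S S' : Type*} [CommRing k] [CommRing A] [Algebra k A] [CommRing S] [Algebra k S]
  [CommRing S'] [Algebra k S'] (𝒜 : ℤ → Submodule k A) [GradedAlgebra 𝒜]

/-- The twist of an algebra homomorphism `φ : A → S` by a unit `w` of `S`: on elements of
degree `i` it is `w ^ i • φ`. -/
noncomputable def twist (w : Sˣ) (φ : A →ₐ[k] S) : A →ₐ[k] S :=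
  (DirectSum.toAlgebra k (fun i => 𝒜 i)
    (fun i => (LinearMap.mulLeft k ((w ^ i : Sˣ) : S)) ∘ₗ φ.toLinearMap ∘ₗ (𝒜 i).subtype)
    (by simp) (by
      intro i j x y
      simp only [LinearMap.comp_apply, LinearMap.mulLeft_apply, Submodule.subtype_apply,
        AlgHom.toLinearMap_apply, SetLike.coe_gMul, map_mul, zpow_add, Units.val_mul]
      ring)).comp (DirectSum.decomposeAlgEquiv 𝒜 : A →ₐ[k] _)

theorem twist_of_mem (w : Sˣ) (φ : A →ₐ[k] S) {i : ℤ} {x : A} (hx : x ∈ 𝒜 i) :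
    twist 𝒜 w φ x = ((w ^ i : Sˣ) : S) * φ x := by
  have : DirectSum.decomposeAlgEquiv 𝒜 x = DirectSum.of (fun i => 𝒜 i) i ⟨x, hx⟩ :=
    DirectSum.decompose_of_mem 𝒜 hx
  exact (congrArg _ this).trans (DirectSum.toAddMonoid_of _ _ _)

theorem algHom_ext_of_mem {φ ψ : A →ₐ[k] S} (h : ∀ i, ∀ x ∈ 𝒜 i, φ x = ψ x) : φ = ψ := by
  ext x
  induction x using DirectSum.Decomposition.inductionOn 𝒜 with
  | zero => simp
  | homogeneous x => exact h _ _ x.2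
  | add x y hx hy => rw [map_add, map_add, hx, hy]

theorem comp_twist (F : S →ₐ[k] S') (w : Sˣ) (φ : A →ₐ[k] S) :
    F.comp (twist 𝒜 w φ) = twist 𝒜 (Units.map (F : S →* S') w) (F.comp φ) :=
  algHom_ext_of_mem 𝒜 fun i x hx => by
    rw [AlgHom.comp_apply, twist_of_mem 𝒜 w φ hx, twist_of_mem 𝒜 _ _ hx, map_mul, ← map_zpow]
    rfl

theorem twist_twist (w w' : Sˣ) (φ : A →ₐ[k] S) :
    twist 𝒜 w (twist 𝒜 w' φ) = twist 𝒜 (w * w') φ :=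
  algHom_ext_of_mem 𝒜 fun i x hx => by
    simp only [twist_of_mem 𝒜 _ _ hx, mul_zpow, Units.val_mul, mul_assoc]

theorem twist_one (φ : A →ₐ[k] S) : twist 𝒜 1 φ = φ :=
  algHom_ext_of_mem 𝒜 fun i x hx => by simp [twist_of_mem 𝒜 _ _ hx]

end GradedAlgebra

namespace hypersurfaceRing

variable {n : ℕ} {h : MvPolynomial (Fin n) ℂ} {j : ℤ} {S : Type*} [CommRing S] [Algebra ℂ S]

variable (h j) in
/-- The quotient map from the Laurent polynomial ring. -/
noncomputable def mk : LaurentPolynomial (MvPolynomial (Fin n) ℂ) →ₐ[ℂ] hypersurfaceRing n h j :=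
  Ideal.Quotient.mkₐ ℂ (Ideal.span {T j * C h - 1})

variable (h j) in
/-- The inclusion of `A` into `R_{h,j}`. -/
noncomputable def coord : MvPolynomial (Fin n) ℂ →ₐ[ℂ] hypersurfaceRing n h j where
  toRingHom := (mk h j : _ →+* _).comp C
  commutes' r := (mk h j).commutes r

variable (h j) in
/-- The class of `T`, as a unit of `R_{h,j}`. -/
noncomputable def unit : (hypersurfaceRing n h j)ˣ where
  val := mk h j (T 1)
  inv := mk h j (T (-1))
  val_inv := by rw [← map_mul, ← T_add]; simp
  inv_val := by rw [← map_mul, ← T_add]; simp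

theorem mk_T (i : ℤ) : mk h j (T i) = ((unit h j ^ i : (hypersurfaceRing n h j)ˣ) : _) := by
  induction i using Int.induction_on with
  | zero => simp
  | succ i ih => rw [T_add, map_mul, ih, zpow_add_one]; rfl
  | pred i ih => rw [sub_eq_add_neg, T_add, map_mul, ih, ← sub_eq_add_neg, zpow_sub_one]; rfl

theorem unit_zpow_mul_coord :
    ((unit h j ^ j : (hypersurfaceRing n h j)ˣ) : hypersurfaceRing n h j) * coord h j h = 1 := by
  have : mk h j (T j * C h - 1) = 0 :=
    Ideal.Quotient.eq_zero_iff_mem.2 (Ideal.subset_span rfl)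
  rw [map_sub, map_mul, mk_T, map_one, sub_eq_zero] at this
  exact this

/-- The universal property of `R_{h,j}`. -/
noncomputable def lift (φ : MvPolynomial (Fin n) ℂ →ₐ[ℂ] S) (u : Sˣ)
    (hu : ((u ^ j : Sˣ) : S) * φ h = 1) : hypersurfaceRing n h j →ₐ[ℂ] S :=
  Ideal.Quotient.liftₐ (Ideal.span {T j * C h - 1})
    { toRingHom := LaurentPolynomial.eval₂ (φ : MvPolynomial (Fin n) ℂ →+* S) u
      commutes' := fun r => by
        rw [LaurentPolynomial.algebraMap_apply]
        exact (LaurentPolynomial.eval₂_C _ _ _).trans (φ.commutes r) }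
    (by
      intro x hx
      refine (Ideal.span_le (I := RingHom.ker
        (LaurentPolynomial.eval₂ (φ : MvPolynomial (Fin n) ℂ →+* S) u))).2 ?_ hx
      rw [Set.singleton_subset_iff, SetLike.mem_coe, RingHom.mem_ker, map_sub, map_mul,
        LaurentPolynomial.eval₂_T, LaurentPolynomial.eval₂_C, map_one, sub_eq_zero]
      exact hu)

theorem lift_comp_coord (φ : MvPolynomial (Fin n) ℂ →ₐ[ℂ] S) (u : Sˣ)
    (hu : ((u ^ j : Sˣ) : S) * φ h = 1) : (lift φ u hu).comp (coord h j) = φ :=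
  AlgHom.ext fun _ => LaurentPolynomial.eval₂_C _ _ _

theorem map_lift_unit (φ : MvPolynomial (Fin n) ℂ →ₐ[ℂ] S) (u : Sˣ)
    (hu : ((u ^ j : Sˣ) : S) * φ h = 1) :
    Units.map (lift φ u hu : hypersurfaceRing n h j →* S) (unit h j) = u :=
  Units.ext <| (LaurentPolynomial.eval₂_T _ _ 1).trans (by simp)

theorem algHom_ext {F G : hypersurfaceRing n h j →ₐ[ℂ] S}
    (hc : F.comp (coord h j) = G.comp (coord h j))
    (hu : Units.map (F : _ →* S) (unit h j) = Units.map (G : _ →* S) (unit h j)) : F = G := by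
  have key (p : LaurentPolynomial (MvPolynomial (Fin n) ℂ)) : F (mk h j p) = G (mk h j p) := by
    induction p using LaurentPolynomial.induction_on' with
    | add p q hp hq => simp only [map_add, hp, hq]
    | C_mul_T i a =>
      have h1 : F (mk h j (C a)) = G (mk h j (C a)) := DFunLike.congr_fun hc a
      have h2 := congrArg (fun w : Sˣ => ((w ^ i : Sˣ) : S)) hu
      simp only [← map_zpow] at h2
      rw [map_mul, map_mul, map_mul, h1, mk_T]
      exact congrArg _ h2
  ext x
  obtain ⟨p, rfl⟩ := Ideal.Quotient.mk_surjective x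
  exact key p

variable {h' : MvPolynomial (Fin n) ℂ} {j' : ℤ}

section Tensor

variable (h j h' j')

/-- The coordinates of the first factor of a product. -/
noncomputable def coordL :
    MvPolynomial (Fin n) ℂ →ₐ[ℂ] hypersurfaceRing n h j ⊗[ℂ] hypersurfaceRing n h' j' :=
  Algebra.TensorProduct.includeLeft.comp (coord h j)

/-- The coordinates of the second factor of a product. -/
noncomputable def coordR :
    MvPolynomial (Fin n) ℂ →ₐ[ℂ] hypersurfaceRing n h j ⊗[ℂ] hypersurfaceRing n h' j' :=
  Algebra.TensorProduct.includeRight.comp (coord h' j')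

/-- The invertible coordinate of the first factor of a product. -/
noncomputable def unitL : (hypersurfaceRing n h j ⊗[ℂ] hypersurfaceRing n h' j')ˣ :=
  Units.map ((Algebra.TensorProduct.includeLeft :
    _ →ₐ[ℂ] hypersurfaceRing n h j ⊗[ℂ] hypersurfaceRing n h' j') : _ →* _) (unit h j)

/-- The invertible coordinate of the second factor of a product. -/
noncomputable def unitR : (hypersurfaceRing n h j ⊗[ℂ] hypersurfaceRing n h' j')ˣ :=
  Units.map ((Algebra.TensorProduct.includeRight :
    _ →ₐ[ℂ] hypersurfaceRing n h j ⊗[ℂ] hypersurfaceRing n h' j') : _ →* _) (unit h' j')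

theorem coordL_apply_self : coordL h j h' j' h = ((unitL h j h' j' ^ (-j) : Units _) : _) := by
  have := congrArg (Algebra.TensorProduct.includeLeft :
    _ →ₐ[ℂ] hypersurfaceRing n h j ⊗[ℂ] hypersurfaceRing n h' j')
    (unit_zpow_mul_coord (h := h) (j := j))
  rw [map_mul, map_one] at this
  rw [zpow_neg, eq_comm, ← Units.mul_eq_one_iff_inv_eq, unitL, ← map_zpow]
  exact this

theorem coordR_apply_self : coordR h j h' j' h' = ((unitR h j h' j' ^ (-j') : Units _) : _) := by
  have := congrArg (Algebra.TensorProduct.includeRight :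
    _ →ₐ[ℂ] hypersurfaceRing n h j ⊗[ℂ] hypersurfaceRing n h' j')
    (unit_zpow_mul_coord (h := h') (j := j'))
  rw [map_mul, map_one] at this
  rw [zpow_neg, eq_comm, ← Units.mul_eq_one_iff_inv_eq, unitR, ← map_zpow]
  exact this

end Tensor

theorem exists_tensor_lift (φ ψ : MvPolynomial (Fin n) ℂ →ₐ[ℂ] S) (u v : Sˣ)
    (hu : ((u ^ j : Sˣ) : S) * φ h = 1) (hv : ((v ^ j' : Sˣ) : S) * ψ h' = 1) :
    ∃ F : hypersurfaceRing n h j ⊗[ℂ] hypersurfaceRing n h' j' →ₐ[ℂ] S,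
      F.comp (coordL h j h' j') = φ ∧ F.comp (coordR h j h' j') = ψ ∧
      Units.map (F : _ →* S) (unitL h j h' j') = u ∧
      Units.map (F : _ →* S) (unitR h j h' j') = v := by
  refine ⟨Algebra.TensorProduct.lift (lift φ u hu) (lift ψ v hv) fun _ _ => .all _ _,
    ?_, ?_, ?_, ?_⟩
  · rw [coordL, ← AlgHom.comp_assoc, Algebra.TensorProduct.lift_comp_includeLeft,
      lift_comp_coord]
  · rw [coordR, ← AlgHom.comp_assoc, Algebra.TensorProduct.lift_comp_includeRight',
      lift_comp_coord]
  · refine Eq.trans ?_ (map_lift_unit φ u hu)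
    ext
    simp [unitL]
  · refine Eq.trans ?_ (map_lift_unit ψ v hv)
    ext
    simp [unitR]

theorem tensor_algHom_ext {F G : hypersurfaceRing n h j ⊗[ℂ] hypersurfaceRing n h' j' →ₐ[ℂ] S}
    (hc : F.comp (coordL h j h' j') = G.comp (coordL h j h' j'))
    (hc' : F.comp (coordR h j h' j') = G.comp (coordR h j h' j'))
    (hu : Units.map (F : _ →* S) (unitL h j h' j') = Units.map (G : _ →* S) (unitL h j h' j'))
    (hv : Units.map (F : _ →* S) (unitR h j h' j') = Units.map (G : _ →* S) (unitR h j h' j')) :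
    F = G :=
  Algebra.TensorProduct.ext (algHom_ext hc hu) (algHom_ext hc' hv)

/-- A homomorphism given by a monomial change of the invertible coordinates, combined with twists
of the two factors by monomials. -/
structure IsMonomialHom (𝒜 ℬ : ℤ → Submodule ℂ (MvPolynomial (Fin n) ℂ))
    [GradedAlgebra 𝒜] [GradedAlgebra ℬ] {i i' : ℤ}
    (F : hypersurfaceRing n h j ⊗[ℂ] hypersurfaceRing n h' j' →ₐ[ℂ]
      hypersurfaceRing n h i ⊗[ℂ] hypersurfaceRing n h' i')
    (α β γ δ p q p' q' : ℤ) : Prop where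
  comp_coordL : F.comp (coordL h j h' j') = GradedAlgebra.twist 𝒜
    (unitL h i h' i' ^ p * unitR h i h' i' ^ q) (coordL h i h' i')
  comp_coordR : F.comp (coordR h j h' j') = GradedAlgebra.twist ℬ
    (unitL h i h' i' ^ p' * unitR h i h' i' ^ q') (coordR h i h' i')
  map_unitL : Units.map (F : _ →* _) (unitL h j h' j') =
    unitL h i h' i' ^ α * unitR h i h' i' ^ β
  map_unitR : Units.map (F : _ →* _) (unitR h j h' j') =
    unitL h i h' i' ^ γ * unitR h i h' i' ^ δ

theorem zpow_mul_zpow_zpow_mul {G : Type*} [CommGroup G] (x y : G) (α β γ δ p q : ℤ) :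
    (x ^ α * y ^ β) ^ p * (x ^ γ * y ^ δ) ^ q =
      x ^ (α * p + γ * q) * y ^ (β * p + δ * q) := by
  simp only [mul_zpow, ← zpow_mul, zpow_add]
  exact mul_mul_mul_comm _ _ _ _

variable {𝒜 ℬ : ℤ → Submodule ℂ (MvPolynomial (Fin n) ℂ)} [GradedAlgebra 𝒜] [GradedAlgebra ℬ]
  {i i' α β γ δ p q p' q' α₂ β₂ γ₂ δ₂ p₂ q₂ p₂' q₂' : ℤ}

theorem exists_isMonomialHom {m : ℤ} (hh : h ∈ 𝒜 m) (hh' : h' ∈ ℬ m)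
    (e₁ : α * j + p * m = i) (e₂ : β * j + q * m = 0)
    (e₃ : γ * j' + p' * m = 0) (e₄ : δ * j' + q' * m = i') :
    ∃ F : hypersurfaceRing n h j ⊗[ℂ] hypersurfaceRing n h' j' →ₐ[ℂ]
        hypersurfaceRing n h i ⊗[ℂ] hypersurfaceRing n h' i',
      IsMonomialHom 𝒜 ℬ F α β γ δ p q p' q' := by
  obtain ⟨F, h₁, h₂, h₃, h₄⟩ := exists_tensor_lift (h := h) (j := j) (h' := h') (j' := j')
    (GradedAlgebra.twist 𝒜 (unitL h i h' i' ^ p * unitR h i h' i' ^ q) (coordL h i h' i'))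
    (GradedAlgebra.twist ℬ (unitL h i h' i' ^ p' * unitR h i h' i' ^ q') (coordR h i h' i'))
    (unitL h i h' i' ^ α * unitR h i h' i' ^ β) (unitL h i h' i' ^ γ * unitR h i h' i' ^ δ)
    (by
      rw [GradedAlgebra.twist_of_mem 𝒜 _ _ hh, coordL_apply_self, ← Units.val_mul,
        ← Units.val_mul, Units.val_eq_one, ← mul_assoc, zpow_mul_zpow_zpow_mul, e₁, e₂]
      simp)
    (by
      rw [GradedAlgebra.twist_of_mem ℬ _ _ hh', coordR_apply_self, ← Units.val_mul,
        ← Units.val_mul, Units.val_eq_one, ← mul_assoc, zpow_mul_zpow_zpow_mul, e₃, e₄]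
      simp)
  exact ⟨F, h₁, h₂, h₃, h₄⟩

theorem IsMonomialHom.comp_eq_id
    {F : hypersurfaceRing n h j ⊗[ℂ] hypersurfaceRing n h' j' →ₐ[ℂ]
      hypersurfaceRing n h i ⊗[ℂ] hypersurfaceRing n h' i'}
    {G : hypersurfaceRing n h i ⊗[ℂ] hypersurfaceRing n h' i' →ₐ[ℂ]
      hypersurfaceRing n h j ⊗[ℂ] hypersurfaceRing n h' j'}
    (hF : IsMonomialHom 𝒜 ℬ F α β γ δ p q p' q')
    (hG : IsMonomialHom 𝒜 ℬ G α₂ β₂ γ₂ δ₂ p₂ q₂ p₂' q₂')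
    (hα : α₂ * α + γ₂ * β = 1) (hβ : β₂ * α + δ₂ * β = 0)
    (hγ : α₂ * γ + γ₂ * δ = 0) (hδ : β₂ * γ + δ₂ * δ = 1)
    (hp : α₂ * p + γ₂ * q + p₂ = 0) (hq : β₂ * p + δ₂ * q + q₂ = 0)
    (hp' : α₂ * p' + γ₂ * q' + p₂' = 0) (hq' : β₂ * p' + δ₂ * q' + q₂' = 0) :
    G.comp F = AlgHom.id ℂ _ := by
  have map_monomial (r s : ℤ) : Units.map (G : _ →* _) (unitL h i h' i' ^ r * unitR h i h' i' ^ s) =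
      unitL h j h' j' ^ (α₂ * r + γ₂ * s) * unitR h j h' j' ^ (β₂ * r + δ₂ * s) := by
    rw [map_mul, map_zpow, map_zpow, hG.map_unitL, hG.map_unitR, zpow_mul_zpow_zpow_mul]
  have map_comp (w : (hypersurfaceRing n h j ⊗[ℂ] hypersurfaceRing n h' j')ˣ) :
      Units.map (MonoidHomClass.toMonoidHom (G.comp F)) w =
        Units.map (MonoidHomClass.toMonoidHom G) (Units.map (MonoidHomClass.toMonoidHom F) w) :=
    rfl
  apply tensor_algHom_ext
  · rw [AlgHom.comp_assoc, hF.comp_coordL, GradedAlgebra.comp_twist, map_monomial,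
      hG.comp_coordL, GradedAlgebra.twist_twist, mul_mul_mul_comm, ← zpow_add, ← zpow_add, hp, hq,
      zpow_zero, zpow_zero, mul_one, GradedAlgebra.twist_one, AlgHom.id_comp]
  · rw [AlgHom.comp_assoc, hF.comp_coordR, GradedAlgebra.comp_twist, map_monomial,
      hG.comp_coordR, GradedAlgebra.twist_twist, mul_mul_mul_comm, ← zpow_add, ← zpow_add, hp', hq',
      zpow_zero, zpow_zero, mul_one, GradedAlgebra.twist_one, AlgHom.id_comp]
  · rw [map_comp, hF.map_unitL, map_monomial, hα, hβ, zpow_one, zpow_zero, mul_one]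
    rfl
  · rw [map_comp, hF.map_unitR, map_monomial, hγ, hδ, zpow_one, zpow_zero, one_mul]
    rfl

end hypersurfaceRing

/-- **Lemma (products).** Let `A = ℂ[x₁,…,xₙ]` carry two `ℤ`-gradings `𝒜` and `ℬ`, let
`m ≠ 0`, and let `f` be `𝒜`-homogeneous of degree `m` and `g` be `ℬ`-homogeneous of
degree `m`.  If `a, b ≥ 1` satisfy `a·b ≡ 1 (mod m²)`, then for all `ℓ, ℓ' ≥ 1` the
products `X̃_{f,ℓ} × X̃_{g,ℓ'}` and `X̃_{f,aℓ} × X̃_{g,bℓ'}` are isomorphic, i.e.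
`R_{f,ℓ} ⊗_ℂ R_{g,ℓ'} ≅ R_{f,aℓ} ⊗_ℂ R_{g,bℓ'}` as `ℂ`-algebras. -/
theorem products_iso (n : ℕ) (hn : 1 ≤ n)
    (𝒜 ℬ : ℤ → Submodule ℂ (MvPolynomial (Fin n) ℂ))
    [GradedAlgebra 𝒜] [GradedAlgebra ℬ]
    (m : ℤ) (hm : m ≠ 0)
    (f g : MvPolynomial (Fin n) ℂ) (hf : f ∈ 𝒜 m) (hg : g ∈ ℬ m)
    (a b : ℤ) (ha : 1 ≤ a) (hb : 1 ≤ b) (hab : a * b ≡ 1 [ZMOD m ^ 2])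
    (ℓ ℓ' : ℤ) (hℓ : 1 ≤ ℓ) (hℓ' : 1 ≤ ℓ') :
    Nonempty ((hypersurfaceRing n f ℓ ⊗[ℂ] hypersurfaceRing n g ℓ') ≃ₐ[ℂ]
      (hypersurfaceRing n f (a * ℓ) ⊗[ℂ] hypersurfaceRing n g (b * ℓ'))) := by
  obtain ⟨k, hk⟩ := hab.symm.dvd
  obtain ⟨F, hF⟩ := hypersurfaceRing.exists_isMonomialHom (h := f) (h' := g)
    (j := ℓ) (j' := ℓ') (i := a * ℓ) (i' := b * ℓ')
    (α := a) (β := m) (γ := m * k) (δ := b) (p := 0) (q := -ℓ) (p' := -(k * ℓ')) (q' := 0) hf hg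
    (by ring) (by ring) (by ring) (by ring)
  obtain ⟨G, hG⟩ := hypersurfaceRing.exists_isMonomialHom (h := f) (h' := g)
    (i := ℓ) (i' := ℓ') (j := a * ℓ) (j' := b * ℓ')
    (α := b) (β := -m) (γ := -(m * k)) (δ := a) (p := -(m * k * ℓ)) (q := a * ℓ)
    (p' := k * b * ℓ') (q' := -(m * k * ℓ')) hf hg
    (by linear_combination ℓ * hk) (by ring) (by ring) (by linear_combination ℓ' * hk)
  refine ⟨AlgEquiv.ofAlgHom F G
    (hG.comp_eq_id hF ?_ ?_ ?_ ?_ ?_ ?_ ?_ ?_) (hF.comp_eq_id hG ?_ ?_ ?_ ?_ ?_ ?_ ?_ ?_)⟩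
  all_goals first
    | linear_combination hk
    | linear_combination ℓ * hk
    | linear_combination k * ℓ' * hk
    | ring
end

section
/- Let n ≥ 1 and let R₁ = ℂ[x₁,…,xₙ,y,z,t]/(t(x₁²⋯xₙ²·z − y⁵) − 1) and R₂ = ℂ[x₁,…,xₙ,y,z,t]/(t²(x₁²⋯xₙ²·z − y⁵) − 1). Then the ℂ-algebras R₁ and R₂ are not isomorphic, but the ℂ-algebras R₁ ⊗_ℂ R₁ and R₂ ⊗_ℂ R₂ are isomorphic. -/
open MvPolynomial TensorProduct

/-- `R_{n,5,ℓ} = ℂ[x₁,…,xₙ,y,z,t]/(t^ℓ(x₁²⋯xₙ²·z − y⁵) − 1)`, the coordinate ring of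
the variety `X_{n,5,ℓ} ⊂ 𝔸^{n+3}`; the variables `x₁,…,xₙ` are indexed by `0,…,n-1`,
`y` by `n`, `z` by `n+1` and `t` by `n+2` in `Fin (n+3)`. -/
noncomputable abbrev negKodairaRing5 (n ℓ : ℕ) : Type :=
  MvPolynomial (Fin (n + 3)) ℂ ⧸ Ideal.span
    {(X (⟨n + 2, by omega⟩ : Fin (n + 3)) : MvPolynomial (Fin (n + 3)) ℂ) ^ ℓ *
      ((∏ i : Fin n, (X (Fin.castAdd 3 i)) ^ 2) * X (⟨n + 1, by omega⟩ : Fin (n + 3)) -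
        (X (⟨n, by omega⟩ : Fin (n + 3))) ^ 5) - 1}

namespace NegKodaira

section LocallyNilpotent

/-- Every element is killed by some iterate of the derivation. -/
def IsLocallyNilpotent {R : Type} [CommRing R] [Algebra ℂ R] (δ : Derivation ℂ R R) : Prop :=
  ∀ r, ∃ N : ℕ, δ^[N] r = 0

/-- `r` has degree exactly `a` with respect to the derivation `δ`. -/
def HasDeg {R : Type} [CommRing R] [Algebra ℂ R] (δ : Derivation ℂ R R) (r : R) (a : ℕ) : Prop :=
  δ^[a] r ≠ 0 ∧ δ^[a + 1] r = 0

variable {R : Type} [CommRing R] [Algebra ℂ R] {δ : Derivation ℂ R R}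

lemma iterate_eq_zero_of_le {r : R} {a b : ℕ} (hab : a ≤ b) (h : δ^[a] r = 0) :
    δ^[b] r = 0 := by
  obtain ⟨c, rfl⟩ := Nat.exists_eq_add_of_le' hab
  rw [Function.iterate_add_apply, h, iterate_map_zero]

lemma iterate_mul_eq_zero (m : ℕ) : ∀ (a b : ℕ) (f g : R), m + 1 = a + b →
    δ^[a] f = 0 → δ^[b] g = 0 → δ^[m] (f * g) = 0 := by
  induction m with
  | zero =>
    intro a b f g hab hf hg
    rcases a with _ | a
    · simp_all
    · obtain rfl : b = 0 := by omega
      simp_all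
  | succ m ih =>
    intro a b f g hab hf hg
    rw [Function.iterate_succ_apply, δ.leibniz, smul_eq_mul, smul_eq_mul, iterate_map_add]
    rcases a with _ | a
    · simp_all
    rcases b with _ | b
    · simp_all
    rw [ih (a + 1) b f (δ g) (by omega) hf (by simpa [Function.iterate_succ_apply] using hg),
      ih (b + 1) a g (δ f) (by omega) hg (by simpa [Function.iterate_succ_apply] using hf),
      add_zero]

lemma iterate_mul_top (m : ℕ) : ∀ (a b : ℕ) (f g : R), m = a + b →
    δ^[a + 1] f = 0 → δ^[b + 1] g = 0 →
      δ^[m] (f * g) = (m.choose a : R) * (δ^[a] f * δ^[b] g) := by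
  induction m with
  | zero =>
    intro a b f g hab hf hg
    obtain rfl : a = 0 := by omega
    obtain rfl : b = 0 := by omega
    simp
  | succ m ih =>
    intro a b f g hab hf hg
    rw [Function.iterate_succ_apply, δ.leibniz, smul_eq_mul, smul_eq_mul, iterate_map_add]
    rcases a with _ | a
    · have hf' : δ f = 0 := by simpa using hf
      obtain rfl : b = m + 1 := by omega
      rw [ih 0 m f (δ g) (by omega) hf (by simpa [Function.iterate_succ_apply] using hg), hf']
      simp [Function.iterate_succ_apply]
    rcases b with _ | b
    · have hg' : δ g = 0 := by simpa using hg
      obtain rfl : a = m := by omega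
      rw [ih 0 a g (δ f) (by omega) hg (by simpa [Function.iterate_succ_apply] using hf), hg']
      simp [Function.iterate_succ_apply, mul_comm]
    rw [ih (a + 1) b f (δ g) (by omega) hf (by simpa [Function.iterate_succ_apply] using hg),
      mul_comm g, ih a (b + 1) (δ f) g (by omega)
        (by simpa [Function.iterate_succ_apply] using hf) hg, Nat.choose_succ_succ]
    simp only [Function.iterate_succ_apply]
    push_cast
    ring

lemma HasDeg.unique {r : R} {a b : ℕ} (ha : HasDeg δ r a) (hb : HasDeg δ r b) : a = b := by
  by_contra hne
  rcases Nat.lt_or_gt_of_ne hne with h | h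
  · exact hb.1 (iterate_eq_zero_of_le h ha.2)
  · exact ha.1 (iterate_eq_zero_of_le h hb.2)

lemma hasDeg_zero {r : R} (hr : r ≠ 0) (h : δ r = 0) : HasDeg δ r 0 := ⟨hr, h⟩

lemma HasDeg.ne_zero {r : R} {a : ℕ} (h : HasDeg δ r a) : r ≠ 0 := by
  rintro rfl
  exact h.1 (iterate_map_zero δ a)

lemma HasDeg.pred {r : R} {a : ℕ} (h : HasDeg δ r (a + 1)) : HasDeg δ (δ r) a := h

lemma HasDeg.add_ker {r s : R} {a : ℕ} (h : HasDeg δ r (a + 1)) (hs : δ s = 0) :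
    HasDeg δ (r + s) (a + 1) := by
  have : δ (r + s) = δ r := by rw [map_add, hs, add_zero]
  unfold HasDeg at *
  rw [Function.iterate_succ_apply, Function.iterate_succ_apply _ (a + 1)] at *
  rwa [this]

lemma IsLocallyNilpotent.exists_hasDeg (hδ : IsLocallyNilpotent δ) {r : R} (hr : r ≠ 0) :
    ∃ a, HasDeg δ r a := by
  classical
  have hex := hδ r
  rcases h : Nat.find hex with _ | a
  · exact absurd (by simpa [h] using Nat.find_spec hex) hr
  · exact ⟨a, Nat.find_min hex (by omega), by simpa [h] using Nat.find_spec hex⟩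

variable [IsDomain R]

lemma HasDeg.mul {f g : R} {a b : ℕ} (hf : HasDeg δ f a) (hg : HasDeg δ g b) :
    HasDeg δ (f * g) (a + b) := by
  have : CharZero R := charZero_of_injective_algebraMap (algebraMap ℂ R).injective
  refine ⟨?_, iterate_mul_eq_zero (a + b + 1) (a + 1) (b + 1) f g (by omega) hf.2 hg.2⟩
  rw [iterate_mul_top (a + b) a b f g rfl hf.2 hg.2]
  refine mul_ne_zero (Nat.cast_ne_zero.2 ?_) (mul_ne_zero hf.1 hg.1)
  exact (Nat.choose_pos (by omega)).ne'

lemma HasDeg.pow {f : R} {a : ℕ} (hf : HasDeg δ f a) (k : ℕ) : HasDeg δ (f ^ k) (k * a) := by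
  induction k with
  | zero => simpa using hasDeg_zero (δ := δ) one_ne_zero (by simp)
  | succ k ih => rw [pow_succ, Nat.succ_mul]; exact ih.mul hf

lemma IsLocallyNilpotent.ker_of_mul (hδ : IsLocallyNilpotent δ) {f g : R} (hfg : f * g ≠ 0)
    (h : δ (f * g) = 0) : δ f = 0 := by
  obtain ⟨a, ha⟩ := hδ.exists_hasDeg (left_ne_zero_of_mul hfg)
  obtain ⟨b, hb⟩ := hδ.exists_hasDeg (right_ne_zero_of_mul hfg)
  have := (ha.mul hb).unique (hasDeg_zero hfg h)
  obtain rfl : a = 0 := by omega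
  exact ha.2

lemma IsLocallyNilpotent.ker_of_dvd (hδ : IsLocallyNilpotent δ) {f g : R} (hg : g ≠ 0)
    (hfg : f ∣ g) (h : δ g = 0) : δ f = 0 := by
  obtain ⟨c, rfl⟩ := hfg
  exact hδ.ker_of_mul hg h

lemma IsLocallyNilpotent.ker_of_isUnit (hδ : IsLocallyNilpotent δ) {u : R} (hu : IsUnit u) :
    δ u = 0 :=
  hδ.ker_of_dvd one_ne_zero hu.dvd δ.map_one_eq_zero

lemma IsLocallyNilpotent.ker_of_dvd_self (hδ : IsLocallyNilpotent δ) {f : R} (h : f ∣ δ f) :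
    δ f = 0 := by
  by_contra hne
  have hf : f ≠ 0 := by rintro rfl; simp at hne
  obtain ⟨c, hc⟩ := h
  have hc0 : c ≠ 0 := by rintro rfl; simp_all
  obtain ⟨a, ha⟩ := hδ.exists_hasDeg hf
  obtain ⟨b, hb⟩ := hδ.exists_hasDeg hc0
  rcases a with _ | a
  · exact hne ha.2
  have h1 := ha.pred
  rw [hc] at h1
  have := h1.unique (ha.mul hb)
  omega

/-- The curve `w² v = y⁵ + s` over the kernel of a locally nilpotent derivation is constant. -/
lemma IsLocallyNilpotent.ker_of_quintic (hδ : IsLocallyNilpotent δ) {w v y s : R}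
    (hrel : w ^ 2 * v = y ^ 5 + s) (hv : δ v = 0) (hs : δ s = 0) (hsu : IsUnit s)
    (hne : y ^ 5 + s ≠ 0) : δ y = 0 := by
  by_contra hy
  have hder : 2 * w * δ w * v = 5 * y ^ 4 * δ y := by
    have := congrArg δ hrel
    simp only [Derivation.leibniz, Derivation.leibniz_pow, map_add, hv, hs, smul_eq_mul,
      nsmul_eq_mul] at this
    push_cast at this
    linear_combination this
  have hw0 : w ≠ 0 := by rintro rfl; exact hne (by rw [← hrel]; ring)
  have hv0 : v ≠ 0 := by rintro rfl; exact hne (by rw [← hrel]; ring)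
  have hy0 : y ≠ 0 := by rintro rfl; exact hy (map_zero δ)
  have hdvd : w ∣ δ y := by
    have h5 : IsUnit (5 : R) := by
      have := (IsUnit.mk0 (5 : ℂ) (by norm_num)).map (algebraMap ℂ R)
      rwa [map_ofNat] at this
    refine ((h5.mul hsu).dvd_mul_left).1 ⟨5 * w * v * δ y - 2 * y * δ w * v, ?_⟩
    linear_combination (-5 * δ y) * hrel + y * hder
  obtain ⟨g, hg⟩ := hdvd
  have hg0 : g ≠ 0 := by rintro rfl; simp_all
  obtain ⟨a, ha⟩ := hδ.exists_hasDeg hw0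
  obtain ⟨b, hb⟩ := hδ.exists_hasDeg hy0
  obtain ⟨c, hc⟩ := hδ.exists_hasDeg hg0
  rcases b with _ | b
  · exact hy hb.2
  have h1 := hb.pred
  rw [hg] at h1
  have h2 := h1.unique (ha.mul hc)
  have h3 : HasDeg δ (y ^ 5 + s) (5 * (b + 1)) := (hb.pow 5).add_ker (a := 5 * b + 4) hs
  rw [← hrel] at h3
  have h4 := h3.unique ((ha.pow 2).mul (hasDeg_zero hv0 hv))
  omega

end LocallyNilpotent

section Grading

/-- A `ℤ`-grading of `R`, given by the map `c` listing the homogeneous components. -/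
structure IsZGrading {R : Type} [CommRing R] [Algebra ℂ R] (c : R →ₗ[ℂ] (ℤ →₀ R)) : Prop where
  homogeneous : ∀ r k, c (c r k) = Finsupp.single k (c r k)
  sum_eq : ∀ r, ((c r).sum fun _ a => a) = r
  mul_left : ∀ a b d, c a = Finsupp.single d a → ∀ k, c (a * b) k = a * c b (k - d)

variable {R : Type} [CommRing R] [Algebra ℂ R] {c : R →ₗ[ℂ] (ℤ →₀ R)}

lemma IsZGrading.induction (hc : IsZGrading c) {P : R → Prop} (zero : P 0)
    (h_add : ∀ a b, P a → P b → P (a + b))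
    (hom : ∀ d a, c a = Finsupp.single d a → P a) (r : R) : P r := by
  classical
  rw [← hc.sum_eq r]
  exact Finset.sum_induction _ P h_add zero fun k _ => hom k _ (hc.homogeneous r k)

lemma IsZGrading.mul_hom (hc : IsZGrading c) {a b : R} {d e : ℤ} (ha : c a = Finsupp.single d a)
    (hb : c b = Finsupp.single e b) : c (a * b) = Finsupp.single (d + e) (a * b) := by
  ext k
  rw [hc.mul_left a b d ha, hb, Finsupp.single_apply, Finsupp.single_apply]
  by_cases h : e = k - d
  · rw [if_pos h, if_pos (by omega)]
  · rw [if_neg h, if_neg (by omega), mul_zero]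

/-- The linear map underlying the degree `m` component of a derivation. -/
noncomputable def componentLinear (c : R →ₗ[ℂ] (ℤ →₀ R)) (δ : Derivation ℂ R R) (m : ℤ) :
    R →ₗ[ℂ] R :=
  (Finsupp.lsum ℂ fun d => Finsupp.lapply (d + m) ∘ₗ c ∘ₗ (δ : R →ₗ[ℂ] R)) ∘ₗ c

lemma componentLinear_of_hom (δ : Derivation ℂ R R) (m : ℤ) {a : R} {d : ℤ}
    (ha : c a = Finsupp.single d a) : componentLinear c δ m a = c (δ a) (d + m) := by
  simp [componentLinear, ha]

lemma IsZGrading.component_leibniz (hc : IsZGrading c) (δ : Derivation ℂ R R) (m : ℤ) (a b : R) :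
    componentLinear c δ m (a * b) =
      a • componentLinear c δ m b + b • componentLinear c δ m a := by
  revert b
  refine hc.induction (P := fun a => ∀ b, componentLinear c δ m (a * b) =
      a • componentLinear c δ m b + b • componentLinear c δ m a) ?_ ?_ ?_ a
  · simp
  · intro a a' ha ha' b
    simp only [add_mul, map_add, ha, ha', smul_eq_mul]
    ring
  · intro d a ha b
    refine hc.induction (P := fun b => componentLinear c δ m (a * b) =
      a • componentLinear c δ m b + b • componentLinear c δ m a) ?_ ?_ ?_ b
    · simp
    · intro b b' hb hb'
      simp only [mul_add, map_add, hb, hb', smul_eq_mul]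
      ring
    · intro e b hb
      rw [componentLinear_of_hom δ m (hc.mul_hom ha hb), componentLinear_of_hom δ m ha,
        componentLinear_of_hom δ m hb, δ.leibniz, map_add c, Finsupp.add_apply, smul_eq_mul,
        smul_eq_mul, hc.mul_left a _ d ha, hc.mul_left b _ e hb]
      congr 3 <;> ring

/-- The degree `m` component of a derivation. -/
noncomputable def IsZGrading.component (hc : IsZGrading c) (δ : Derivation ℂ R R) (m : ℤ) :
    Derivation ℂ R R :=
  Derivation.mk' (componentLinear c δ m) (hc.component_leibniz δ m)

lemma IsZGrading.component_of_hom (hc : IsZGrading c) (δ : Derivation ℂ R R) (m : ℤ) {a : R}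
    {d : ℤ} (ha : c a = Finsupp.single d a) : hc.component δ m a = c (δ a) (d + m) :=
  componentLinear_of_hom δ m ha

lemma IsZGrading.apply_eq_sum (hc : IsZGrading c) (δ : Derivation ℂ R R) (b : R) (k : ℤ) :
    c (δ b) k = (c b).sum fun j a => hc.component δ (k - j) a := by
  conv_lhs => rw [← hc.sum_eq b]
  rw [Finsupp.sum, map_sum, map_sum, Finsupp.finsetSum_apply, Finsupp.sum]
  refine Finset.sum_congr rfl fun j _ => ?_
  rw [hc.component_of_hom δ _ (hc.homogeneous b j), add_sub_cancel]

/-- A lowest component of a locally nilpotent derivation is locally nilpotent. -/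
lemma IsZGrading.component_isLocallyNilpotent (hc : IsZGrading c) {δ : Derivation ℂ R R}
    (hδ : IsLocallyNilpotent δ) {l : ℤ} (hl : ∀ m < l, hc.component δ m = 0) :
    IsLocallyNilpotent (hc.component δ l) := by
  have key : ∀ (N : ℕ) (a : R) (d : ℤ), c a = Finsupp.single d a →
      (∀ k < d + N * l, c (δ^[N] a) k = 0) ∧
        c (δ^[N] a) (d + N * l) = (hc.component δ l)^[N] a := by
    intro N a d ha
    induction N with
    | zero =>
      refine ⟨fun k hk => ?_, ?_⟩
      · rw [Function.iterate_zero_apply, ha, Finsupp.single_apply, if_neg]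
        push_cast at hk
        omega
      · simp [ha]
    | succ N ih =>
      obtain ⟨ih1, ih2⟩ := ih
      have hexp : d + ((N + 1 : ℕ) : ℤ) * l = d + N * l + l := by push_cast; ring
      have hzero : ∀ j k : ℤ, j ≠ d + N * l → k ≤ d + N * l + l →
          hc.component δ (k - j) (c (δ^[N] a) j) = 0 := by
        intro j k hj hk
        rcases lt_or_gt_of_ne hj with h | h
        · rw [ih1 j h, map_zero]
        · rw [hl (k - j) (by omega), Derivation.zero_apply]
      rw [hexp]
      refine ⟨fun k hk => ?_, ?_⟩
      · rw [Function.iterate_succ_apply', hc.apply_eq_sum]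
        refine Finset.sum_eq_zero fun j _ => ?_
        by_cases hj : j = d + N * l
        · beta_reduce
          rw [hl (k - j) (by omega), Derivation.zero_apply]
        · exact hzero j k hj hk.le
      · rw [Function.iterate_succ_apply', Function.iterate_succ_apply', hc.apply_eq_sum, ← ih2,
          Finsupp.sum, Finset.sum_eq_single (d + N * l)]
        · rw [add_sub_cancel_left]
        · intro j _ hj
          exact hzero j _ hj le_rfl
        · intro h
          rw [Finsupp.notMem_support_iff.1 h, map_zero]
  intro r
  refine hc.induction (P := fun r => ∃ N : ℕ, (hc.component δ l)^[N] r = 0) ⟨0, rfl⟩ ?_ ?_ r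
  · rintro a b ⟨N, hN⟩ ⟨M, hM⟩
    exact ⟨N + M, by rw [iterate_map_add, iterate_eq_zero_of_le (by omega) hN,
      iterate_eq_zero_of_le (by omega) hM, add_zero]⟩
  · intro d a ha
    obtain ⟨N, hN⟩ := hδ a
    refine ⟨N, ?_⟩
    rw [← (key N a d ha).2, hN, map_zero, Finsupp.zero_apply]

/-- A nonzero derivation of a finitely generated graded algebra has a lowest component. -/
lemma IsZGrading.exists_lowest (hc : IsZGrading c) {δ : Derivation ℂ R R} (hδ : δ ≠ 0)
    {ι : Type} [Finite ι] {g : ι → R} (hg : Algebra.adjoin ℂ (Set.range g) = ⊤)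
    {d : ι → ℤ} (hgd : ∀ i, c (g i) = Finsupp.single (d i) (g i)) :
    ∃ l, hc.component δ l ≠ 0 ∧ ∀ m < l, hc.component δ m = 0 := by
  classical
  have hzero : ∀ m, (∀ i, c (δ (g i)) (d i + m) = 0) → hc.component δ m = 0 := by
    intro m hm
    refine Derivation.ext_of_adjoin_eq_top _ hg ?_
    rintro _ ⟨i, rfl⟩
    rw [hc.component_of_hom δ m (hgd i), hm, Derivation.zero_apply]
  have hbdd : ∀ i, ∃ B : ℤ, ∀ m < B, c (δ (g i)) (d i + m) = 0 := by
    intro i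
    obtain ⟨B, hB⟩ := ((c (δ (g i))).support.finite_toSet).bddBelow
    refine ⟨B - d i, fun m hm => ?_⟩
    by_contra hne
    have := hB (Finsupp.mem_support_iff.2 hne)
    omega
  choose B hB using hbdd
  obtain ⟨b, hb⟩ := (Set.finite_range B).bddBelow
  have hex : ∃ m, hc.component δ m ≠ 0 := by
    by_contra! hall
    refine hδ (Derivation.ext_of_adjoin_eq_top _ hg ?_)
    rintro _ ⟨i, rfl⟩
    rw [Derivation.zero_apply, ← hc.sum_eq (δ (g i))]
    refine Finset.sum_eq_zero fun k _ => ?_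
    have := hc.component_of_hom δ (k - d i) (hgd i)
    rw [hall, add_sub_cancel, Derivation.zero_apply] at this
    exact this.symm
  obtain ⟨l, hl, hmin⟩ := Int.exists_least_of_bdd (P := fun m => hc.component δ m ≠ 0)
    ⟨b, fun m hm => by
      by_contra! hlt
      exact hm (hzero m fun i => hB i m (lt_of_lt_of_le hlt (hb ⟨i, rfl⟩)))⟩ hex
  refine ⟨l, hl, fun m hm => ?_⟩
  by_contra hne
  have := hmin m hne
  omega

end Grading

/-- The kernel `ℂ[t^{±1}, x₁, …, xₙ]` of the standard locally nilpotent derivation. -/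
abbrev Base (n : ℕ) : Type := MvPolynomial (Fin n) (LaurentPolynomial ℂ)

/-- The element `t` of the base, as a unit. -/
noncomputable def baseT (n : ℕ) : (Base n)ˣ where
  val := MvPolynomial.C (LaurentPolynomial.T 1)
  inv := MvPolynomial.C (LaurentPolynomial.T (-1))
  val_inv := by rw [← map_mul, ← LaurentPolynomial.T_add]; simp
  inv_val := by rw [← map_mul, ← LaurentPolynomial.T_add]; simp

lemma coe_baseT_zpow (n : ℕ) (k : ℤ) :
    ((baseT n ^ k : (Base n)ˣ) : Base n) = MvPolynomial.C (LaurentPolynomial.T k) := by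
  induction k with
  | zero => simp
  | succ k ih =>
    rw [zpow_add_one, Units.val_mul, ih, LaurentPolynomial.T_add, map_mul]
    rfl
  | pred k ih =>
    rw [zpow_sub_one, Units.val_mul, ih, sub_eq_add_neg, LaurentPolynomial.T_add, map_mul]
    rfl

lemma base_algHom_ext {n : ℕ} {S : Type} [CommRing S] [Algebra ℂ S] {f g : Base n →ₐ[ℂ] S}
    (hx : ∀ i, f (X i) = g (X i)) (ht : f (baseT n) = g (baseT n)) : f = g := by
  have hu : Units.map (f : Base n →* S) (baseT n) = Units.map (g : Base n →* S) (baseT n) :=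
    Units.ext ht
  have hT : ∀ k, f (MvPolynomial.C (LaurentPolynomial.T k)) =
      g (MvPolynomial.C (LaurentPolynomial.T k)) := by
    intro k
    have := congrArg (fun u : Sˣ => ((u ^ k : Sˣ) : S)) hu
    simpa only [← map_zpow, Units.coe_map, MonoidHom.coe_coe, coe_baseT_zpow] using this
  have h : (f : Base n →+* S) = g := by
    refine MvPolynomial.ringHom_ext (fun p => ?_) hx
    induction p using LaurentPolynomial.induction_on' with
    | add p q hp hq => rw [map_add, map_add, map_add, hp, hq]
    | C_mul_T k a =>
      have hC : (MvPolynomial.C (LaurentPolynomial.C a) : Base n) = algebraMap ℂ (Base n) a := rfl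
      rw [map_mul, map_mul, map_mul, hC, RingHom.coe_coe, RingHom.coe_coe, f.commutes, g.commutes,
        hT]
  exact AlgHom.ext fun a => congrArg (fun h : Base n →+* S => h a) h

/-- The product of the variables. -/
noncomputable def baseW (n : ℕ) : Base n := ∏ i, X i

lemma baseW_ne_zero (n : ℕ) : baseW n ≠ 0 := Finset.prod_ne_zero_iff.2 fun i _ => X_ne_zero i

lemma laurent_eq_of_isUnit {p : LaurentPolynomial ℂ} (hp : IsUnit p) :
    ∃ (c : ℂ) (k : ℤ), p = LaurentPolynomial.C c * LaurentPolynomial.T k := by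
  obtain ⟨q, hq⟩ := hp.exists_right_inv
  obtain ⟨a, f, hf⟩ := p.exists_T_pow
  obtain ⟨b, g, hg⟩ := q.exists_T_pow
  have h : f * g = Polynomial.X ^ (a + b) := by
    refine Polynomial.toLaurent_injective ?_
    rw [map_mul, hf, hg, Polynomial.toLaurent_X_pow, Nat.cast_add, LaurentPolynomial.T_add]
    linear_combination (LaurentPolynomial.T a * LaurentPolynomial.T b) * hq
  obtain ⟨i, -, hi⟩ := (dvd_prime_pow Polynomial.prime_X _).1 (Dvd.intro g h)
  obtain ⟨u, hu⟩ := hi.symm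
  obtain ⟨c, -, hc⟩ := Polynomial.isUnit_iff.1 u.isUnit
  refine ⟨c, i - a, ?_⟩
  have h1 : p * LaurentPolynomial.T a = LaurentPolynomial.C c * LaurentPolynomial.T i := by
    rw [← hf, ← hu, ← hc, map_mul, Polynomial.toLaurent_X_pow, Polynomial.toLaurent_C, mul_comm]
  calc p = p * LaurentPolynomial.T a * LaurentPolynomial.T (-a) := by
        rw [mul_assoc, ← LaurentPolynomial.T_add]
        simp
    _ = _ := by rw [h1, mul_assoc, ← LaurentPolynomial.T_add, sub_eq_add_neg]

lemma laurent_C_mul_T_inj {c : ℂ} {k l : ℤ}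
    (h : (LaurentPolynomial.C c * LaurentPolynomial.T k : LaurentPolynomial ℂ) =
      LaurentPolynomial.T l) : k = l := by
  have h1 := congrArg (fun p : LaurentPolynomial ℂ => p.coeff l) h
  rw [← LaurentPolynomial.single_eq_C_mul_T, LaurentPolynomial.T] at h1
  simp only [AddMonoidAlgebra.coeff_single, Finsupp.single_apply, if_true] at h1
  by_contra hne
  simp [hne] at h1

lemma base_eq_of_isUnit {n : ℕ} {p : Base n} (hp : IsUnit p) :
    ∃ (c : ℂ) (k : ℤ), p = algebraMap ℂ (Base n) c * ((baseT n ^ k : (Base n)ˣ) : Base n) := by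
  obtain ⟨q, hq, rfl⟩ := MvPolynomial.isUnit_iff_eq_C_of_isReduced.1 hp
  obtain ⟨c, k, rfl⟩ := laurent_eq_of_isUnit hq
  exact ⟨c, k, by rw [coe_baseT_zpow, map_mul]; rfl⟩

/-- `R` is the algebra `ℂ[x₁,…,xₙ,y,z,t]/(t^ℓ(x₁²⋯xₙ²·z − y⁵) − 1)`, given by its generators, its
universal property, and the fact that the `xᵢ` are not zero divisors. -/
structure Model (n ℓ : ℕ) (R : Type) [CommRing R] [Algebra ℂ R] where
  /-- the generators `xᵢ` -/
  x : Fin n → R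
  /-- the generator `y` -/
  y : R
  /-- the generator `z` -/
  z : R
  /-- the generator `t` -/
  t : R
  rel : t ^ ℓ * ((∏ i, x i ^ 2) * z - y ^ 5) = 1
  exists_lift : ∀ (S : Type) [CommRing S] [Algebra ℂ S] (x' : Fin n → S) (y' z' t' : S),
    t' ^ ℓ * ((∏ i, x' i ^ 2) * z' - y' ^ 5) = 1 →
      ∃ f : R →ₐ[ℂ] S, (∀ i, f (x i) = x' i) ∧ f y = y' ∧ f z = z' ∧ f t = t'
  adjoin_eq_top : Algebra.adjoin ℂ (Set.range (Sum.elim x ![y, z, t])) = ⊤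
  eq_zero_of_x_mul : ∀ i r, x i * r = 0 → r = 0

namespace Model

variable {n ℓ : ℕ} {R : Type} [CommRing R] [Algebra ℂ R] (M : Model n ℓ R)

/-- The product of the `xᵢ`. -/
def w : R := ∏ i, M.x i

/-- The inverse `x₁²⋯xₙ²·z − y⁵` of `t^ℓ`. -/
def s : R := (∏ i, M.x i ^ 2) * M.z - M.y ^ 5

lemma t_pow_mul_s : M.t ^ ℓ * M.s = 1 := M.rel

lemma w_sq_mul_z : M.w ^ 2 * M.z = M.y ^ 5 + M.s := by
  rw [w, s, Finset.prod_pow]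
  ring

lemma isUnit_s : IsUnit M.s := .of_mul_eq_one_right _ M.t_pow_mul_s

lemma isUnit_t [NeZero ℓ] : IsUnit M.t :=
  (isUnit_pow_iff (NeZero.ne ℓ)).1 (.of_mul_eq_one _ M.t_pow_mul_s)

include M in
lemma algHom_ext {S : Type} [CommRing S] [Algebra ℂ S] {f g : R →ₐ[ℂ] S}
    (hx : ∀ i, f (M.x i) = g (M.x i)) (hy : f M.y = g M.y) (hz : f M.z = g M.z)
    (ht : f M.t = g M.t) : f = g := by
  refine AlgHom.ext_of_adjoin_eq_top M.adjoin_eq_top ?_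
  rintro _ ⟨i | i, rfl⟩
  · exact hx i
  · fin_cases i
    exacts [hy, hz, ht]

include M in
lemma derivation_ext {d d' : Derivation ℂ R R}
    (hx : ∀ i, d (M.x i) = d' (M.x i)) (hy : d M.y = d' M.y) (hz : d M.z = d' M.z)
    (ht : d M.t = d' M.t) : d = d' := by
  refine Derivation.ext_of_adjoin_eq_top _ M.adjoin_eq_top ?_
  rintro _ ⟨i | i, rfl⟩
  · exact hx i
  · fin_cases i
    exacts [hy, hz, ht]

open LaurentPolynomial in
/-- The grading in which `xᵢ` has degree `1`, `z` has degree `-2` and the other generators have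
degree `0`. -/
lemma exists_grading (i : Fin n) : ∃ c : R →ₗ[ℂ] (ℤ →₀ R), IsZGrading c ∧
    (∀ r, ∀ k, 1 ≤ k → M.x i ∣ c r k) ∧ (∀ r, ∀ k ≤ -1, M.z ∣ c r k) ∧
    (∀ j, c (M.x j) = Finsupp.single (if j = i then 1 else 0) (M.x j)) ∧
    c M.y = Finsupp.single 0 M.y ∧ c M.z = Finsupp.single (-2) M.z ∧
    c M.t = Finsupp.single 0 M.t := by
  obtain ⟨ρ, hx, hy, hz, ht⟩ := M.exists_lift R[T;T⁻¹]
    (fun j => LaurentPolynomial.C (M.x j) * T (if j = i then 1 else 0)) (LaurentPolynomial.C M.y)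
    (LaurentPolynomial.C M.z * T (-2)) (LaurentPolynomial.C M.t) (by
      have h1 : ∏ j, (LaurentPolynomial.C (M.x j) * T (if j = i then 1 else 0) : R[T;T⁻¹]) ^ 2 =
          LaurentPolynomial.C (∏ j, M.x j ^ 2) * T 2 := by
        simp only [mul_pow, Finset.prod_mul_distrib, map_prod, map_pow]
        congr 1
        rw [Finset.prod_eq_single i]
        · simp
        · intro j _ hj
          simp [hj]
        · simp
      have h2 : (T 2 * T (-2) : R[T;T⁻¹]) = 1 := by rw [← T_add]; simp
      rw [h1, ← map_one LaurentPolynomial.C, ← M.rel]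
      simp only [map_mul, map_sub, map_pow]
      linear_combination (LaurentPolynomial.C M.t ^ ℓ *
        LaurentPolynomial.C (∏ j, M.x j ^ 2) * LaurentPolynomial.C M.z) * h2)
  let c : R →ₗ[ℂ] (ℤ →₀ R) :=
    (AddMonoidAlgebra.coeffLinearEquiv (M := ℤ) (S := R) ℂ).toLinearMap ∘ₗ ρ.toLinearMap
  have hc : ∀ r, c r = (ρ r).coeff := fun r => rfl
  have hcs : ∀ r d, c r = Finsupp.single d r ↔ ρ r = LaurentPolynomial.C r * T d := by
    intro r d
    rw [hc, ← single_eq_C_mul_T, ← AddMonoidAlgebra.coeff_inj, AddMonoidAlgebra.coeff_single]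
  have hcx : ∀ j, c (M.x j) = Finsupp.single (if j = i then 1 else 0) (M.x j) :=
    fun j => (hcs _ _).2 (hx j)
  have hcy : c M.y = Finsupp.single 0 M.y := (hcs _ _).2 (by simp [hy])
  have hcz : c M.z = Finsupp.single (-2) M.z := (hcs _ _).2 hz
  have hct : c M.t = Finsupp.single 0 M.t := (hcs _ _).2 (by simp [ht])
  let H : Submonoid R :=
    { carrier := {a | ∃ d, c a = Finsupp.single d a ∧ (1 ≤ d → M.x i ∣ a) ∧ (d ≤ -1 → M.z ∣ a)}
      one_mem' := ⟨0, (hcs _ _).2 (by simp), by simp, by simp⟩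
      mul_mem' := by
        rintro a b ⟨d, had, ha1, ha2⟩ ⟨e, hbe, hb1, hb2⟩
        refine ⟨d + e, (hcs _ _).2 ?_, fun h => ?_, fun h => ?_⟩
        · rw [map_mul, (hcs _ _).1 had, (hcs _ _).1 hbe, map_mul, T_add]
          ring
        · by_cases hd : 1 ≤ d
          · exact (ha1 hd).mul_right b
          · exact (hb1 (by omega)).mul_left a
        · by_cases hd : d ≤ -1
          · exact (ha2 hd).mul_right b
          · exact (hb2 (by omega)).mul_left a }
  have hspan : Submodule.span ℂ (H : Set R) = ⊤ := by
    rw [eq_top_iff, ← Algebra.top_toSubmodule, ← M.adjoin_eq_top, Algebra.adjoin_eq_span]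
    refine Submodule.span_mono (SetLike.coe_subset_coe.2 (Submonoid.closure_le.2 ?_))
    rintro _ ⟨j | j, rfl⟩
    · refine ⟨_, hcx j, fun h => ?_, fun h => ?_⟩
      · by_cases hj : j = i
        · simp [hj]
        · simp [hj] at h
      · split_ifs at h <;> omega
    · fin_cases j
      · exact ⟨0, hcy, by simp, by simp⟩
      · exact ⟨-2, hcz, by simp, by simp⟩
      · exact ⟨0, hct, by simp, by simp⟩
  have hind : ∀ {P : R → Prop}, (∀ a ∈ H, P a) → P 0 → (∀ a b, P a → P b → P (a + b)) →
      (∀ (u : ℂ) a, P a → P (u • a)) → ∀ r, P r := by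
    intro P hP h0 hadd hsmul r
    exact Submodule.span_induction (p := fun r _ => P r) hP h0 (fun a b _ _ => hadd a b)
      (fun u a _ => hsmul u a) (hspan ▸ Submodule.mem_top : r ∈ Submodule.span ℂ (H : Set R))
  refine ⟨c, ⟨?_, ?_, ?_⟩, ?_, ?_, hcx, hcy, hcz, hct⟩
  · refine hind ?_ ?_ ?_ ?_
    · rintro a ⟨d, had, -⟩ k
      rw [had, Finsupp.single_apply]
      split_ifs with h
      · rw [had, h]
      · simp
    · simp
    · intro a b ha hb k
      simp [ha, hb]
    · intro u a ha k
      simp [ha]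
  · refine hind ?_ ?_ ?_ ?_
    · rintro a ⟨d, had, -⟩
      simp [had]
    · simp
    · intro a b ha hb
      rw [map_add, Finsupp.sum_add_index' (fun _ => rfl) (fun _ _ _ => rfl), ha, hb]
    · intro u a ha
      rw [map_smul, Finsupp.sum_smul_index' (fun _ => rfl)]
      conv_rhs => rw [← ha]
      rw [Finsupp.sum, Finsupp.sum, Finset.smul_sum]
  · intro a b d ha k
    rw [hc, map_mul, (hcs _ _).1 ha, ← single_eq_C_mul_T,
      AddMonoidAlgebra.coeff_single_mul_apply, hc, neg_add_eq_sub]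
  · intro r k hk
    revert r
    refine hind ?_ ?_ ?_ ?_
    · rintro a ⟨d, had, h, -⟩
      rw [had, Finsupp.single_apply]
      split_ifs with hd
      · exact h (hd ▸ hk)
      · exact dvd_zero _
    · simp
    · intro a b ha hb
      rw [map_add]
      exact dvd_add ha hb
    · intro u a ha
      rw [map_smul, Finsupp.smul_apply, Algebra.smul_def]
      exact ha.mul_left _
  · intro r k hk
    revert r
    refine hind ?_ ?_ ?_ ?_
    · rintro a ⟨d, had, -, h⟩
      rw [had, Finsupp.single_apply]
      split_ifs with hd
      · exact h (hd ▸ hk)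
      · exact dvd_zero _
    · simp
    · intro a b ha hb
      rw [map_add]
      exact dvd_add ha hb
    · intro u a ha
      rw [map_smul, Finsupp.smul_apply, Algebra.smul_def]
      exact ha.mul_left _

/-- Every locally nilpotent derivation kills the `xᵢ`. -/
theorem locallyNilpotent_x [IsDomain R] [NeZero ℓ] (hz0 : M.z ≠ 0) (hw0 : M.w ≠ 0)
    {δ : Derivation ℂ R R} (hδ : IsLocallyNilpotent δ) (i : Fin n) : δ (M.x i) = 0 := by
  by_cases hδ0 : δ = 0
  · simp [hδ0]
  obtain ⟨c, hc, hcpos, hcneg, hcx, hcy, hcz, hct⟩ := M.exists_grading i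
  obtain ⟨l, hl0, hl⟩ := hc.exists_lowest hδ0 M.adjoin_eq_top
    (d := Sum.elim (fun j => if j = i then 1 else 0) ![0, -2, 0]) (by
      rintro (j | j)
      · exact hcx j
      · fin_cases j
        exacts [hcy, hcz, hct])
  have hlnd := hc.component_isLocallyNilpotent hδ hl
  have hl_nonneg : 0 ≤ l := by
    by_contra! hneg
    refine hl0 ?_
    have hrel := M.w_sq_mul_z
    have hne : M.y ^ 5 + M.s ≠ 0 := hrel ▸ mul_ne_zero (pow_ne_zero 2 hw0) hz0
    have hδz : hc.component δ l M.z = 0 := by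
      refine hlnd.ker_of_dvd_self ?_
      rw [hc.component_of_hom δ l hcz]
      exact hcneg _ _ (by omega)
    have hδs : hc.component δ l M.s = 0 := hlnd.ker_of_isUnit M.isUnit_s
    have hδt : hc.component δ l M.t = 0 := hlnd.ker_of_isUnit M.isUnit_t
    have hδy := hlnd.ker_of_quintic hrel hδz hδs M.isUnit_s hne
    have hδp : hc.component δ l (M.y ^ 5 + M.s) = 0 := by
      rw [map_add, hδs, Derivation.leibniz_pow, hδy]
      simp
    refine M.derivation_ext (fun j => ?_) hδy hδz hδt
    refine hlnd.ker_of_dvd hne ?_ hδp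
    rw [← hrel]
    exact ((Finset.dvd_prod_of_mem M.x (Finset.mem_univ j)).trans
      (dvd_pow_self _ two_ne_zero)).mul_right _
  refine hδ.ker_of_dvd_self ?_
  rw [← hc.sum_eq (δ (M.x i))]
  refine Finset.dvd_sum fun k _ => ?_
  rcases le_or_gt 1 k with hk | hk
  · exact hcpos _ _ hk
  · have h := hc.component_of_hom δ (k - 1) ((hcx i).trans (by rw [if_pos rfl]))
    rw [hl _ (by omega), Derivation.zero_apply, add_sub_cancel] at h
    rw [← h]
    exact dvd_zero _

/-- Homomorphisms between algebras of different levels which rescale `y` and `z`. -/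
lemma exists_twist {m : ℕ} {R' A : Type} [CommRing R'] [Algebra ℂ R'] [CommRing A] [Algebra ℂ A]
    (M : Model n ℓ R) (N : Model n m R') (ι : R →ₐ[ℂ] A) (c τ : A)
    (h : τ ^ m * (c ^ 5 * ι M.s) = 1) :
    ∃ f : R' →ₐ[ℂ] A, (∀ i, f (N.x i) = ι (M.x i)) ∧ f N.y = c * ι M.y ∧
      f N.z = c ^ 5 * ι M.z ∧ f N.t = τ ∧ f N.s = c ^ 5 * ι M.s := by
  have hs : c ^ 5 * ι M.s = (∏ i, ι (M.x i) ^ 2) * (c ^ 5 * ι M.z) - (c * ι M.y) ^ 5 := by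
    simp only [s, map_sub, map_mul, map_prod, map_pow]
    ring
  obtain ⟨f, hx, hy, hz, ht⟩ := N.exists_lift A (fun i => ι (M.x i)) (c * ι M.y)
    (c ^ 5 * ι M.z) τ (by rw [← hs, h])
  refine ⟨f, hx, hy, hz, ht, ?_⟩
  simp only [s, map_sub, map_mul, map_prod, map_pow, hx, hy, hz]
  ring

variable [NeZero ℓ]

/-- The inclusion of the base. -/
noncomputable def incl : Base n →ₐ[ℂ] R where
  __ := MvPolynomial.eval₂Hom (LaurentPolynomial.eval₂ (algebraMap ℂ R) M.isUnit_t.unit) M.x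
  commutes' a := by
    have hC : (algebraMap ℂ (Base n) a) = MvPolynomial.C (LaurentPolynomial.C a) := rfl
    simp [hC]

@[simp] lemma incl_X (i : Fin n) : M.incl (X i) = M.x i :=
  MvPolynomial.eval₂Hom_X' _ _ _

@[simp] lemma incl_baseT : M.incl (baseT n) = M.t := by
  refine (MvPolynomial.eval₂Hom_C _ _ _).trans ?_
  rw [LaurentPolynomial.eval₂_T, zpow_one, IsUnit.unit_spec]

@[simp] lemma incl_baseW : M.incl (baseW n) = M.w := by simp [baseW, w]

lemma incl_s : M.incl ((baseT n ^ (-ℓ : ℤ) : (Base n)ˣ) : Base n) = M.s := by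
  have h : M.t ^ ℓ * M.incl ((baseT n ^ (-ℓ : ℤ) : (Base n)ˣ) : Base n) = 1 := by
    rw [← M.incl_baseT, ← map_pow, ← map_mul, ← Units.val_pow_eq_pow_val, ← Units.val_mul]
    simp
  calc _ = (M.t ^ ℓ * M.s) * M.incl ((baseT n ^ (-ℓ : ℤ) : (Base n)ˣ) : Base n) := by
        rw [M.t_pow_mul_s, one_mul]
    _ = M.s := by rw [mul_right_comm, h, one_mul]

/-- Specialisation of the variables into an algebra over the base. -/
lemma exists_specialization {S : Type} [CommRing S] [Algebra ℂ S] (κ : Base n →ₐ[ℂ] S) (y' z' : S)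
    (h : κ (baseW n) ^ 2 * z' = y' ^ 5 + κ ((baseT n ^ (-ℓ : ℤ) : (Base n)ˣ) : Base n)) :
    ∃ f : R →ₐ[ℂ] S, f.comp M.incl = κ ∧ f M.y = y' ∧ f M.z = z' := by
  obtain ⟨f, hx, hy, hz, ht⟩ := M.exists_lift S (fun i => κ (X i)) y' z' (κ (baseT n)) (by
    have h1 : κ (baseT n) ^ ℓ * κ ((baseT n ^ (-ℓ : ℤ) : (Base n)ˣ) : Base n) = 1 := by
      rw [← map_pow, ← map_mul, ← Units.val_pow_eq_pow_val, ← Units.val_mul]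
      simp
    have h2 : ∏ i, κ (X i) ^ 2 = κ (baseW n) ^ 2 := by
      rw [Finset.prod_pow, baseW, map_prod]
    rw [h2, h, add_sub_cancel_left, h1])
  exact ⟨f, base_algHom_ext (by simpa using hx) (by simpa using ht), hy, hz⟩

/-- The evaluation at `y` of polynomials over the base. -/
noncomputable def evalY : Polynomial (Base n) →+* R := Polynomial.eval₂RingHom M.incl M.y

lemma exists_w_pow_mul (r : R) : ∃ (N : ℕ) (q : Polynomial (Base n)),
    M.w ^ N * r = M.evalY q := by
  have hr : r ∈ Algebra.adjoin ℂ (Set.range (Sum.elim M.x ![M.y, M.z, M.t])) :=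
    M.adjoin_eq_top ▸ Algebra.mem_top
  induction hr using Algebra.adjoin_induction with
  | mem a ha =>
    obtain ⟨i | i, rfl⟩ := ha
    · exact ⟨0, .C (X i), by simp [evalY]⟩
    · fin_cases i
      · exact ⟨0, .X, by simp [evalY]⟩
      · refine ⟨2, .X ^ 5 + .C ((baseT n ^ (-ℓ : ℤ) : (Base n)ˣ) : Base n), ?_⟩
        rw [map_add, map_pow]
        simp only [evalY, Polynomial.coe_eval₂RingHom, Polynomial.eval₂_X, Polynomial.eval₂_C,
          RingHom.coe_coe, incl_s]
        exact M.w_sq_mul_z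
      · exact ⟨0, .C (baseT n), by simp [evalY]⟩
  | algebraMap a => exact ⟨0, .C (algebraMap ℂ _ a), by
      simp only [evalY, Polynomial.coe_eval₂RingHom, Polynomial.eval₂_C, RingHom.coe_coe,
        AlgHom.commutes, pow_zero, one_mul]⟩
  | add a b _ _ ha hb =>
    obtain ⟨N, q, hq⟩ := ha
    obtain ⟨N', q', hq'⟩ := hb
    refine ⟨N + N', .C (baseW n ^ N') * q + .C (baseW n ^ N) * q', ?_⟩
    have hC : ∀ k, M.evalY (.C (baseW n ^ k)) = M.w ^ k := fun k => by
      rw [evalY, Polynomial.coe_eval₂RingHom, Polynomial.eval₂_C, RingHom.coe_coe, map_pow,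
        incl_baseW]
    rw [map_add, map_mul, map_mul, hC, hC, ← hq, ← hq']
    ring
  | mul a b _ _ ha hb =>
    obtain ⟨N, q, hq⟩ := ha
    obtain ⟨N', q', hq'⟩ := hb
    refine ⟨N + N', q * q', ?_⟩
    rw [map_mul, ← hq, ← hq']
    ring

/-- The embedding into the polynomial ring in `y` over the fraction field of the base. -/
lemma exists_embedding : ∃ f : R →ₐ[ℂ] Polynomial (FractionRing (Base n)),
    Function.Injective f ∧ (∀ a, f (M.incl a) = .C (algebraMap _ _ a)) ∧ f M.y = .X := by
  let κ : Base n →ₐ[ℂ] Polynomial (FractionRing (Base n)) :=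
    (Algebra.ofId (FractionRing (Base n)) _).restrictScalars ℂ |>.comp
      (Algebra.algHom ℂ (Base n) (FractionRing (Base n)))
  have hκ : ∀ a, κ a = .C (algebraMap _ _ a) := fun a => rfl
  have hW : algebraMap (Base n) (FractionRing (Base n)) (baseW n) ≠ 0 := by
    simpa using baseW_ne_zero n
  obtain ⟨f, hf, hy, -⟩ := M.exists_specialization κ .X
    (.C (algebraMap _ _ (baseW n))⁻¹ ^ 2 *
      (.X ^ 5 + κ ((baseT n ^ (-ℓ : ℤ) : (Base n)ˣ) : Base n))) (by
    have : (Polynomial.C (algebraMap (Base n) (FractionRing (Base n)) (baseW n))) *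
        Polynomial.C (algebraMap (Base n) (FractionRing (Base n)) (baseW n))⁻¹ = 1 := by
      rw [← map_mul, mul_inv_cancel₀ hW, map_one]
    rw [hκ (baseW n), ← mul_assoc, ← mul_pow, this, one_pow, one_mul])
  have hfa : ∀ a, f (M.incl a) = .C (algebraMap _ _ a) := fun a => by
    rw [← hκ, ← hf]; rfl
  refine ⟨f, (injective_iff_map_eq_zero f).2 fun r hr => ?_, hfa, hy⟩
  obtain ⟨N, q, hq⟩ := M.exists_w_pow_mul r
  have hcomp : (f : R →+* Polynomial (FractionRing (Base n))).comp M.evalY =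
      Polynomial.mapRingHom (algebraMap (Base n) (FractionRing (Base n))) := by
    refine Polynomial.ringHom_ext (fun a => ?_) ?_
    · simp [evalY, hfa]
    · simp [evalY, hy]
  have h0 := congrArg f hq
  rw [map_mul, hr, mul_zero] at h0
  have h1 : Polynomial.map (algebraMap (Base n) (FractionRing (Base n))) q = 0 := by
    rw [← Polynomial.coe_mapRingHom, ← hcomp]
    exact h0.symm
  rw [Polynomial.map_eq_zero_iff (IsFractionRing.injective _ _)] at h1
  rw [h1, map_zero] at hq
  have hprod : ∀ (s : Finset (Fin n)) r, (∏ i ∈ s, M.x i) * r = 0 → r = 0 := by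
    intro s
    induction s using Finset.induction_on with
    | empty => simp
    | insert i s hi ih =>
      intro r hr
      rw [Finset.prod_insert hi, mul_assoc] at hr
      exact ih r (M.eq_zero_of_x_mul i _ hr)
  clear h0 hr h1
  induction N with
  | zero => simpa using hq
  | succ N ih =>
    rw [pow_succ', mul_assoc] at hq
    exact ih (hprod _ _ hq)

include M in
lemma isDomain : IsDomain R := by
  obtain ⟨f, hf, -⟩ := M.exists_embedding
  exact Function.Injective.isDomain (f : R →+* Polynomial (FractionRing (Base n))) hf

lemma incl_injective : Function.Injective M.incl := by
  obtain ⟨f, -, hf, -⟩ := M.exists_embedding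
  intro a b hab
  have := congrArg f hab
  rw [hf, hf] at this
  exact IsFractionRing.injective _ _ (Polynomial.C_injective this)

lemma evalY_injective : Function.Injective M.evalY := by
  obtain ⟨f, -, hf, hy⟩ := M.exists_embedding
  have hcomp : (f : R →+* Polynomial (FractionRing (Base n))).comp M.evalY =
      Polynomial.mapRingHom (algebraMap (Base n) (FractionRing (Base n))) := by
    refine Polynomial.ringHom_ext (fun a => ?_) ?_
    · simp [evalY, hf]
    · simp [evalY, hy]
  have : Function.Injective
      ((f : R →+* Polynomial (FractionRing (Base n))).comp M.evalY) := by
    rw [hcomp]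
    exact Polynomial.map_injective _ (IsFractionRing.injective _ _)
  exact Function.Injective.of_comp this

lemma w_ne_zero : M.w ≠ 0 := by
  rw [← M.incl_baseW, Ne, map_eq_zero_iff _ M.incl_injective]
  exact baseW_ne_zero n

lemma z_ne_zero : M.z ≠ 0 := by
  intro hz
  have h := M.w_sq_mul_z
  rw [hz, mul_zero, ← M.incl_s] at h
  have h2 : M.evalY (.X ^ 5 + .C ((baseT n ^ (-ℓ : ℤ) : (Base n)ˣ) : Base n)) = M.evalY 0 := by
    simp only [evalY, Polynomial.coe_eval₂RingHom, Polynomial.eval₂_add, Polynomial.eval₂_pow,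
      Polynomial.eval₂_X, Polynomial.eval₂_C, RingHom.coe_coe, Polynomial.eval₂_zero]
    exact h.symm
  exact (Polynomial.monic_X_pow_add_C _ (by norm_num)).ne_zero (M.evalY_injective h2)

lemma coeff_eq_zero_of_specialization {S : Type} [CommRing S] [Algebra ℂ S] (π : Base n →ₐ[ℂ] S)
    (hπ : π (baseW n) ^ 2 = 0) {r : R} {a b c d e : Base n}
    (h : M.w ^ 2 * r = M.incl a * M.y ^ 4 + M.incl b * M.y ^ 3 + M.incl c * M.y ^ 2 +
      M.incl d * M.y + M.incl e) :
    π a = 0 ∧ π d = 0 ∧ π e = 0 := by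
  let g : Polynomial S := .X ^ 5 + .C (π ((baseT n ^ (-ℓ : ℤ) : (Base n)ˣ) : Base n))
  have hg : g.Monic := Polynomial.monic_X_pow_add_C _ (by norm_num)
  let κ : Base n →ₐ[ℂ] AdjoinRoot g := (AdjoinRoot.ofAlgHom ℂ g).comp π
  have hκ : ∀ p, κ p = AdjoinRoot.mk g (.C (π p)) := fun p => rfl
  obtain ⟨f, hf, hy, -⟩ := M.exists_specialization κ (AdjoinRoot.root g) 0 (by
    rw [mul_zero, hκ, ← AdjoinRoot.mk_X, ← map_pow, ← map_add]
    exact AdjoinRoot.mk_self.symm)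
  have hfa : ∀ p, f (M.incl p) = AdjoinRoot.mk g (.C (π p)) := fun p => by
    rw [← hκ, ← hf]; rfl
  have hw : f M.w ^ 2 = 0 := by
    rw [← M.incl_baseW, hfa, ← map_pow, ← map_pow, hπ, map_zero, map_zero]
  let q : Polynomial S := .C (π a) * .X ^ 4 + .C (π b) * .X ^ 3 + .C (π c) * .X ^ 2 +
    .C (π d) * .X + .C (π e)
  have hq : AdjoinRoot.mk g q = 0 := by
    have h1 := congrArg f h
    simp only [map_add, map_mul, map_pow, hy, hfa, hw, zero_mul, ← AdjoinRoot.mk_X] at h1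
    simp only [q, map_add, map_mul, map_pow]
    exact h1.symm
  have hq0 : q = 0 := by
    rcases subsingleton_or_nontrivial S with hI | hI
    · exact Subsingleton.elim _ _
    by_contra hne
    refine hg.not_dvd_of_natDegree_lt hne ?_ (AdjoinRoot.mk_eq_zero.1 hq)
    have h1 : g.natDegree = 5 := Polynomial.natDegree_X_pow_add_C
    have h2 : q.natDegree ≤ 4 := by
      simp only [q]
      compute_degree
    omega
  have hcoeff : ∀ k, q.coeff k = 0 := fun k => by rw [hq0, Polynomial.coeff_zero]
  refine ⟨?_, ?_, ?_⟩
  · simpa [q, Polynomial.coeff_X, Polynomial.coeff_C, Polynomial.coeff_X_pow] using hcoeff 4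
  · simpa [q, Polynomial.coeff_X, Polynomial.coeff_C, Polynomial.coeff_X_pow] using hcoeff 1
  · simpa [q, Polynomial.coeff_X, Polynomial.coeff_C, Polynomial.coeff_X_pow] using hcoeff 0

/-- Modulo `w²`, the powers `1, y, …, y⁴` are linearly independent over the base. -/
lemma baseW_sq_dvd {r : R} {a b c d e : Base n}
    (h : M.w ^ 2 * r = M.incl a * M.y ^ 4 + M.incl b * M.y ^ 3 + M.incl c * M.y ^ 2 +
      M.incl d * M.y + M.incl e) :
    baseW n ^ 2 ∣ a ∧ baseW n ^ 2 ∣ d ∧ baseW n ^ 2 ∣ e := by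
  let I : Ideal (Base n) := Ideal.span {baseW n ^ 2}
  let π : Base n →ₐ[ℂ] Base n ⧸ I := { Ideal.Quotient.mk I with commutes' := fun _ => rfl }
  have hmem : ∀ p, π p = 0 ↔ baseW n ^ 2 ∣ p := fun p =>
    Ideal.Quotient.eq_zero_iff_mem.trans Ideal.mem_span_singleton
  have := M.coeff_eq_zero_of_specialization (S := Base n ⧸ I) π (by rw [← map_pow, hmem]) h
  simpa only [hmem] using this

/-- `D` is the locally nilpotent derivation `w² ∂/∂y + 5y⁴ ∂/∂z`. -/
structure IsStandard (D : Derivation ℂ R R) : Prop where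
  apply_incl : ∀ a, D (M.incl a) = 0
  apply_y : D M.y = M.w ^ 2
  apply_z : D M.z = 5 * M.y ^ 4
  isLocallyNilpotent : IsLocallyNilpotent D

lemma isLocallyNilpotent_of_apply {D : Derivation ℂ R R} (hD : ∀ a, D (M.incl a) = 0)
    (hy : D M.y = M.w ^ 2) (hz : D M.z = 5 * M.y ^ 4) : IsLocallyNilpotent D := by
  have hmul : ∀ a b, (∃ N : ℕ, D^[N] a = 0) → (∃ N : ℕ, D^[N] b = 0) →
      ∃ N : ℕ, D^[N] (a * b) = 0 := by
    rintro a b ⟨N, hN⟩ ⟨N', hN'⟩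
    exact ⟨N + N', iterate_mul_eq_zero (N + N') (N + 1) N' a b (by omega)
      (iterate_eq_zero_of_le (Nat.le_succ N) hN) hN'⟩
  have hone : ∀ a, D a = 0 → ∃ N : ℕ, D^[N] a = 0 := fun a ha => ⟨1, ha⟩
  have hy' : ∃ N : ℕ, D^[N] M.y = 0 := by
    refine ⟨2, ?_⟩
    change D (D M.y) = 0
    rw [hy, ← M.incl_baseW, ← map_pow, hD]
  intro r
  have hr : r ∈ Algebra.adjoin ℂ (Set.range (Sum.elim M.x ![M.y, M.z, M.t])) :=
    M.adjoin_eq_top ▸ Algebra.mem_top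
  induction hr using Algebra.adjoin_induction with
  | mem a ha =>
    obtain ⟨i | i, rfl⟩ := ha
    · exact hone _ (by simpa using hD (X i))
    · fin_cases i
      · exact hy'
      · obtain ⟨N, hN⟩ : ∃ N : ℕ, D^[N] (5 * (M.y * M.y * M.y * M.y)) = 0 :=
          hmul _ _ (hone _ (by exact_mod_cast D.map_natCast 5))
            (hmul _ _ (hmul _ _ (hmul _ _ hy' hy') hy') hy')
        refine ⟨N + 1, ?_⟩
        change D^[N] (D M.z) = 0
        rw [hz, ← hN]
        congr 1
        ring
      · exact hone _ (by simpa using hD (baseT n))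
  | algebraMap a => exact hone _ (D.map_algebraMap a)
  | add a b _ _ ha hb =>
    obtain ⟨N, hN⟩ := ha
    obtain ⟨N', hN'⟩ := hb
    refine ⟨N + N', ?_⟩
    rw [iterate_map_add, iterate_eq_zero_of_le (Nat.le_add_right _ _) hN,
      iterate_eq_zero_of_le (Nat.le_add_left _ _) hN', add_zero]
  | mul a b _ _ ha hb => exact hmul a b ha hb

lemma exists_isStandard : ∃ D : Derivation ℂ R R, M.IsStandard D := by
  let κ : Base n →ₐ[ℂ] Polynomial R := Polynomial.CAlgHom.comp M.incl
  have hκ : ∀ a, κ a = .C (M.incl a) := fun a => rfl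
  obtain ⟨f, hf, hy, hz⟩ := M.exists_specialization κ (.C M.y + .C (M.w ^ 2) * .X)
    (.C M.z + .C (5 * M.y ^ 4) * .X + .C (10 * M.y ^ 3 * M.w ^ 2) * .X ^ 2 +
      .C (10 * M.y ^ 2 * M.w ^ 4) * .X ^ 3 + .C (5 * M.y * M.w ^ 6) * .X ^ 4 +
      .C (M.w ^ 8) * .X ^ 5) (by
    have h := congrArg (Polynomial.C : R →+* Polynomial R) M.w_sq_mul_z
    rw [hκ, hκ, incl_baseW, incl_s]
    simp only [map_add, map_mul, map_pow, map_ofNat] at h ⊢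
    linear_combination h)
  have hfa : ∀ a, f (M.incl a) = .C (M.incl a) := fun a => by rw [← hκ, ← hf]; rfl
  have h0 : ∀ r, (f r).coeff 0 = r := by
    have h : ((Polynomial.aeval (0 : R)).restrictScalars ℂ).comp f = AlgHom.id ℂ R := by
      refine M.algHom_ext (fun i => ?_) ?_ ?_ ?_
      · change Polynomial.aeval (0 : R) (f (M.x i)) = M.x i
        rw [← M.incl_X, hfa, Polynomial.aeval_C, Algebra.algebraMap_self_apply]
      · simp [hy]
      · simp [hz]
      · change Polynomial.aeval (0 : R) (f M.t) = M.t
        rw [← M.incl_baseT, hfa, Polynomial.aeval_C, Algebra.algebraMap_self_apply]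
    intro r
    rw [Polynomial.coeff_zero_eq_aeval_zero]
    exact congrArg (fun g : R →ₐ[ℂ] R => g r) h
  let D : Derivation ℂ R R := Derivation.mk'
    ((Polynomial.lcoeff R 1).restrictScalars ℂ ∘ₗ f.toLinearMap) (fun a b => by
      change (f (a * b)).coeff 1 = a * (f b).coeff 1 + b * (f a).coeff 1
      rw [map_mul, Polynomial.mul_coeff_one, h0, h0]
      ring)
  have hD : ∀ r, D r = (f r).coeff 1 := fun r => rfl
  have hDa : ∀ a, D (M.incl a) = 0 := fun a => by rw [hD, hfa, Polynomial.coeff_C_succ]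
  have hDy : D M.y = M.w ^ 2 := by
    rw [hD, hy]
    simp [Polynomial.coeff_C, -map_pow]
  have hDz : D M.z = 5 * M.y ^ 4 := by
    rw [hD, hz]
    simp only [Polynomial.coeff_add, Polynomial.coeff_C_mul, Polynomial.coeff_X_pow,
      Polynomial.coeff_X_one, Polynomial.coeff_C]
    simp
  exact ⟨D, hDa, hDy, hDz, M.isLocallyNilpotent_of_apply hDa hDy hDz⟩

lemma exists_incl_of_w_pow_mul {N : ℕ} {r : R} {a : Base n} (h : M.w ^ N * r = M.incl a) :
    ∃ b, r = M.incl b := by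
  have := M.isDomain
  induction N generalizing a with
  | zero => exact ⟨a, by simpa using h⟩
  | succ N ih =>
    have h1 : M.w ^ 2 * (M.w ^ N * r) = M.incl 0 * M.y ^ 4 + M.incl 0 * M.y ^ 3 +
        M.incl 0 * M.y ^ 2 + M.incl 0 * M.y + M.incl (baseW n * a) := by
      rw [map_zero, map_mul, incl_baseW, ← h]
      ring
    obtain ⟨-, -, c, hc⟩ := M.baseW_sq_dvd h1
    rw [pow_two, mul_assoc] at hc
    have hc' := mul_left_cancel₀ (baseW_ne_zero n) hc
    refine ih (a := c) (mul_left_cancel₀ M.w_ne_zero ?_)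
    rw [← mul_assoc, ← pow_succ', h, hc', map_mul, incl_baseW]

namespace IsStandard

variable {M} {D : Derivation ℂ R R} (hD : M.IsStandard D)

include hD

lemma apply_w_pow_mul (N : ℕ) (r : R) : D (M.w ^ N * r) = M.w ^ N * D r := by
  rw [← M.incl_baseW, ← map_pow, D.leibniz, hD.apply_incl, smul_zero, add_zero, smul_eq_mul]

lemma apply_evalY (q : Polynomial (Base n)) :
    D (M.evalY q) = M.w ^ 2 * M.evalY (Polynomial.derivative q) := by
  induction q using Polynomial.induction_on' with
  | add p q hp hq => simp only [map_add, hp, hq, mul_add]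
  | monomial k a =>
    rw [Polynomial.derivative_monomial]
    simp only [evalY, Polynomial.coe_eval₂RingHom, Polynomial.eval₂_monomial, RingHom.coe_coe,
      D.leibniz, D.leibniz_pow, hD.apply_incl, hD.apply_y, smul_eq_mul, map_mul, map_natCast,
      nsmul_eq_mul]
    ring

lemma exists_incl {r : R} (h : D r = 0) : ∃ a, r = M.incl a := by
  have := M.isDomain
  obtain ⟨N, q, hq⟩ := M.exists_w_pow_mul r
  have h1 := hD.apply_evalY q
  rw [← hq, hD.apply_w_pow_mul, h, mul_zero] at h1
  have h2 : Polynomial.derivative q = 0 := by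
    refine M.evalY_injective ?_
    rw [map_zero]
    exact (mul_eq_zero.1 h1.symm).resolve_left (pow_ne_zero 2 M.w_ne_zero)
  have : CharZero (Base n) := charZero_of_injective_algebraMap (algebraMap ℂ (Base n)).injective
  have h3 := Polynomial.eq_C_of_natDegree_eq_zero
    (Polynomial.derivative_eq_zero.1 h2)
  refine M.exists_incl_of_w_pow_mul (N := N) (a := q.coeff 0) ?_
  rw [hq, h3]
  simp [evalY]

lemma exists_eq_of_apply {u : R} {c : Base n} (h : D u = M.incl c) :
    ∃ b a, u = M.incl b * M.y + M.incl a := by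
  have := M.isDomain
  have h1 : D (M.w ^ 2 * u - M.incl c * M.y) = 0 := by
    rw [map_sub, hD.apply_w_pow_mul, h, D.leibniz, hD.apply_y, hD.apply_incl]
    simp only [smul_eq_mul]
    ring
  obtain ⟨a, ha⟩ := hD.exists_incl h1
  have h2 : M.w ^ 2 * u = M.incl 0 * M.y ^ 4 + M.incl 0 * M.y ^ 3 + M.incl 0 * M.y ^ 2 +
      M.incl c * M.y + M.incl a := by
    rw [map_zero]
    linear_combination ha
  obtain ⟨-, ⟨c', hc⟩, ⟨a', ha'⟩⟩ := M.baseW_sq_dvd h2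
  refine ⟨c', a', mul_left_cancel₀ (pow_ne_zero 2 M.w_ne_zero) ?_⟩
  rw [h2, hc, ha']
  simp only [map_mul, map_pow, incl_baseW, map_zero]
  ring

/-- A derivation killing the `xᵢ`, `t` and `s` is a multiple of the standard one. -/
lemma exists_multiple {d : Derivation ℂ R R} (hx : ∀ i, d (M.x i) = 0) (ht : d M.t = 0)
    (hs : d M.s = 0) : ∃ g, ∀ r, d r = g * D r := by
  have := M.isDomain
  have hw : d M.w = 0 := by
    rw [w]
    refine Finset.prod_induction _ (fun r => d r = 0) (fun a b ha hb => ?_) d.map_one_eq_zero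
      fun i _ => hx i
    simp [ha, hb]
  have h1 : M.w ^ 2 * d M.z = 5 * M.y ^ 4 * d M.y := by
    have h := congrArg d M.w_sq_mul_z
    simp only [map_add, hs, d.leibniz, d.leibniz_pow, hw, smul_eq_mul, nsmul_eq_mul] at h
    push_cast at h
    linear_combination h
  obtain ⟨c, hc⟩ : ∃ c : R, 5 * c = 1 := ⟨algebraMap ℂ R 5⁻¹, by
    rw [← map_ofNat (algebraMap ℂ R) 5, ← map_mul]
    norm_num⟩
  let g := M.t ^ ℓ * (M.z * d M.y - c * M.y * d M.z)
  have hy : d M.y = M.w ^ 2 * g := by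
    simp only [g]
    linear_combination (-d M.y) * M.t_pow_mul_s - M.t ^ ℓ * d M.y * M.w_sq_mul_z +
      M.t ^ ℓ * c * M.y * h1 + M.t ^ ℓ * M.y ^ 5 * d M.y * hc
  have hz : d M.z = g * (5 * M.y ^ 4) := by
    refine mul_left_cancel₀ (pow_ne_zero 2 M.w_ne_zero) ?_
    rw [h1, hy]
    ring
  have : d = g • D := by
    refine M.derivation_ext (fun i => ?_) ?_ ?_ ?_
    · rw [hx, Derivation.smul_apply, ← M.incl_X, hD.apply_incl, smul_zero]
    · rw [hy, Derivation.smul_apply, hD.apply_y, smul_eq_mul, mul_comm]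
    · rw [hz, Derivation.smul_apply, hD.apply_z, smul_eq_mul]
    · rw [ht, Derivation.smul_apply, ← M.incl_baseT, hD.apply_incl, smul_zero]
  exact ⟨g, fun r => by rw [this]; rfl⟩

end IsStandard

lemma exists_isUnit_multiple {m : ℕ} [NeZero m] {R' : Type} [CommRing R'] [Algebra ℂ R']
    {M : Model n ℓ R} {M' : Model n m R'} {D : Derivation ℂ R R} (hD : M.IsStandard D)
    {D' : Derivation ℂ R' R'} (hD' : M'.IsStandard D') (φ : R ≃ₐ[ℂ] R') :
    ∃ g, ∀ r, D' (φ r) = φ g * φ (D r) := by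
  have := M.isDomain
  let d : Derivation ℂ R R := Derivation.mk'
    (φ.symm.toLinearMap ∘ₗ (D' : R' →ₗ[ℂ] R') ∘ₗ φ.toLinearMap) (fun a b => by
      change φ.symm (D' (φ (a * b))) = a * φ.symm (D' (φ b)) + b * φ.symm (D' (φ a))
      simp [D'.leibniz])
  have hd : ∀ r, d r = φ.symm (D' (φ r)) := fun r => rfl
  have hdN : ∀ N r, d^[N] r = φ.symm (D'^[N] (φ r)) := by
    intro N
    induction N with
    | zero => simp
    | succ N ih =>
      intro r
      rw [Function.iterate_succ_apply', Function.iterate_succ_apply', ih, hd,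
        AlgEquiv.apply_symm_apply]
  have hnil : IsLocallyNilpotent d := fun r => by
    obtain ⟨N, hN⟩ := hD'.isLocallyNilpotent (φ r)
    exact ⟨N, by rw [hdN, hN, map_zero]⟩
  obtain ⟨g, hg⟩ := hD.exists_multiple (M.locallyNilpotent_x M.z_ne_zero M.w_ne_zero hnil)
    (hnil.ker_of_isUnit M.isUnit_t) (hnil.ker_of_isUnit M.isUnit_s)
  refine ⟨g, fun r => ?_⟩
  rw [← map_mul, ← hg, hd, AlgEquiv.apply_symm_apply]

/-- The shape of an isomorphism between two models. -/
structure IsShape {m : ℕ} [NeZero m] {R' : Type} [CommRing R'] [Algebra ℂ R']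
    (M : Model n ℓ R) (M' : Model n m R') (φ : R ≃ₐ[ℂ] R') (g : R) (b a : Base n) : Prop where
  isUnit : IsUnit g
  map_w_sq : φ g * φ M.w ^ 2 = M'.incl b * M'.w ^ 2
  map_y : φ M.y = M'.incl b * M'.y + M'.incl a
  map_incl : ∀ p, ∃ q, φ (M.incl p) = M'.incl q

lemma exists_isShape {m : ℕ} [NeZero m] {R' : Type} [CommRing R'] [Algebra ℂ R']
    (M : Model n ℓ R) (M' : Model n m R') (φ : R ≃ₐ[ℂ] R') :
    ∃ g b a, M.IsShape M' φ g b a := by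
  have := M.isDomain
  have := M'.isDomain
  obtain ⟨D, hD⟩ := M.exists_isStandard
  obtain ⟨D', hD'⟩ := M'.exists_isStandard
  obtain ⟨g, hg⟩ := exists_isUnit_multiple hD hD' φ
  obtain ⟨g', hg'⟩ := exists_isUnit_multiple hD' hD φ.symm
  have hgg : φ.symm g' * g = 1 := by
    have h := hg' (φ M.y)
    rw [hg, AlgEquiv.symm_apply_apply, map_mul, AlgEquiv.symm_apply_apply,
      AlgEquiv.symm_apply_apply, hD.apply_y, ← mul_assoc] at h
    exact mul_right_cancel₀ (pow_ne_zero 2 M.w_ne_zero) (by rw [one_mul, ← h])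
  have hgu : IsUnit g := .of_mul_eq_one_right _ hgg
  have hincl : ∀ p, ∃ q, φ (M.incl p) = M'.incl q := fun p =>
    hD'.exists_incl (by rw [hg, hD.apply_incl, map_zero, mul_zero])
  obtain ⟨γ, hγ⟩ := hD'.exists_incl
    (hD'.isLocallyNilpotent.ker_of_isUnit (hgu.map φ))
  obtain ⟨ω, hω⟩ := hincl (baseW n)
  rw [incl_baseW] at hω
  have h1 : D' (φ M.y) = φ g * φ M.w ^ 2 := by rw [hg, hD.apply_y, map_pow]
  obtain ⟨b, a, hy⟩ := hD'.exists_eq_of_apply (u := φ M.y) (c := γ * ω ^ 2)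
    (by rw [h1, hγ, hω, map_mul, map_pow])
  refine ⟨g, b, a, hgu, ?_, hy, hincl⟩
  rw [← h1, hy, map_add, hD'.apply_incl, D'.leibniz, hD'.apply_incl, hD'.apply_y]
  simp

lemma isUnit_of_isShape {m : ℕ} [NeZero m] {R' : Type} [CommRing R'] [Algebra ℂ R']
    {M : Model n ℓ R} {M' : Model n m R'} {φ : R ≃ₐ[ℂ] R'} {g : R} {b a : Base n}
    (h : M.IsShape M' φ g b a) : IsUnit b := by
  have := M'.isDomain
  obtain ⟨g', b', a', h'⟩ := M'.exists_isShape M φ.symm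
  obtain ⟨D', hD'⟩ := M'.exists_isStandard
  obtain ⟨β, hβ⟩ := h.map_incl b'
  obtain ⟨α, hα⟩ := h.map_incl a'
  have h1 := congrArg φ h'.map_y
  rw [AlgEquiv.apply_symm_apply, map_add, map_mul, hβ, hα, h.map_y] at h1
  have h2 := congrArg D' h1
  simp only [map_add, D'.leibniz, hD'.apply_incl, hD'.apply_y, smul_eq_mul, mul_zero, add_zero]
    at h2
  refine .of_mul_eq_one_right β (M'.incl_injective ?_)
  rw [map_mul, map_one]
  refine mul_right_cancel₀ (pow_ne_zero 2 M'.w_ne_zero) ?_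
  rw [one_mul, mul_assoc]
  exact h2.symm

lemma dvd_of_isShape {m : ℕ} [NeZero m] {R' : Type} [CommRing R'] [Algebra ℂ R']
    {M : Model n ℓ R} {M' : Model n m R'} {φ : R ≃ₐ[ℂ] R'} {g : R} {b a σ : Base n}
    (h : M.IsShape M' φ g b a) (hσ : φ M.s = M'.incl σ) :
    baseW n ^ 2 ∣ σ - b ^ 5 * ((baseT n ^ (-m : ℤ) : (Base n)ˣ) : Base n) := by
  have hb := isUnit_of_isShape h
  obtain ⟨g', hg'⟩ := h.isUnit.map φ |>.exists_left_inv
  have h0 := congrArg φ M.w_sq_mul_z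
  rw [map_mul, map_add, map_pow, map_pow, hσ, h.map_y] at h0
  have h1 : M'.w ^ 2 * (g' * M'.incl b * φ M.z - M'.incl b ^ 5 * M'.z) =
      M'.incl (5 * b ^ 4 * a) * M'.y ^ 4 + M'.incl (10 * b ^ 3 * a ^ 2) * M'.y ^ 3 +
      M'.incl (10 * b ^ 2 * a ^ 3) * M'.y ^ 2 + M'.incl (5 * b * a ^ 4) * M'.y +
      M'.incl (a ^ 5 + (σ - b ^ 5 * ((baseT n ^ (-m : ℤ) : (Base n)ˣ) : Base n))) := by
    simp only [map_add, map_sub, map_mul, map_pow, map_ofNat, incl_s]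
    linear_combination h0 - M'.incl b ^ 5 * M'.w_sq_mul_z - g' * φ M.z * h.map_w_sq +
      φ M.w ^ 2 * φ M.z * hg'
  obtain ⟨ha, -, he⟩ := M'.baseW_sq_dvd h1
  have h5 : IsUnit (5 : Base n) := by
    have := (IsUnit.mk0 (5 : ℂ) (by norm_num)).map (algebraMap ℂ (Base n))
    rwa [map_ofNat] at this
  rw [(h5.mul (hb.pow 4)).dvd_mul_left] at ha
  exact (dvd_add_right (dvd_pow ha (by norm_num))).1 he

variable {m : ℕ} [NeZero m] {R' : Type} [CommRing R'] [Algebra ℂ R']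

lemma exists_map_t (M : Model n ℓ R) (M' : Model n m R') (φ : R ≃ₐ[ℂ] R') :
    ∃ (c : ℂ) (k : ℤ), (k = 1 ∨ k = -1) ∧
      φ M.t = M'.incl (algebraMap ℂ (Base n) c * ((baseT n ^ k : (Base n)ˣ) : Base n)) := by
  have key : ∀ {ℓ m : ℕ} [NeZero ℓ] [NeZero m] {R R' : Type} [CommRing R] [Algebra ℂ R]
      [CommRing R'] [Algebra ℂ R'] (M : Model n ℓ R) (M' : Model n m R') (φ : R ≃ₐ[ℂ] R'),
      ∃ (c : ℂ) (k : ℤ), ∀ j : ℤ, φ (M.incl ((baseT n ^ j : (Base n)ˣ) : Base n)) =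
        M'.incl (algebraMap ℂ (Base n) (c ^ j) * ((baseT n ^ (k * j) : (Base n)ˣ) : Base n)) := by
    intro ℓ m _ _ R R' _ _ _ _ M M' φ
    obtain ⟨g, b, a, h⟩ := M.exists_isShape M' φ
    obtain ⟨τ, hτ⟩ := h.map_incl (baseT n)
    obtain ⟨τ', hτ'⟩ := h.map_incl ((baseT n)⁻¹ : (Base n)ˣ)
    have hu : IsUnit τ := by
      refine .of_mul_eq_one τ' (M'.incl_injective ?_)
      rw [map_mul, ← hτ, ← hτ', ← map_mul, ← map_mul]
      simp
    obtain ⟨c, k, hck⟩ := base_eq_of_isUnit hu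
    have hc : c ≠ 0 := by
      rintro rfl
      have := hu.ne_zero
      simp [hck] at this
    refine ⟨c, k, fun j => ?_⟩
    have h1 : Units.map ((φ : R →* R').comp (M.incl : Base n →* R)) (baseT n) =
        Units.map (M'.incl : Base n →* R') (Units.map (algebraMap ℂ (Base n) : ℂ →* Base n)
          (Units.mk0 c hc) * baseT n ^ k) := by
      refine Units.ext ?_
      refine hτ.trans ?_
      rw [hck]
      rfl
    have h2 := congrArg (fun u : R'ˣ => ((u ^ j : R'ˣ) : R')) h1
    simp only [← map_zpow, mul_zpow, ← zpow_mul] at h2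
    have h3 : ((Units.mk0 c hc ^ j : ℂˣ) : ℂ) = c ^ j := by simp
    rw [← h3]
    exact h2
  obtain ⟨c, k, hk⟩ := key M M' φ
  obtain ⟨c', k', hk'⟩ := key M' M φ.symm
  refine ⟨c, k, ?_, ?_⟩
  · have h1 := hk 1
    have h2 := congrArg φ.symm h1
    rw [AlgEquiv.symm_apply_apply, map_mul, map_mul, hk', AlgHom.commutes, AlgEquiv.commutes,
      ← M.incl.commutes, ← map_mul] at h2
    have h3 := M.incl_injective h2
    rw [← mul_assoc, ← map_mul, coe_baseT_zpow, coe_baseT_zpow] at h3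
    have h4 := MvPolynomial.C_injective (Fin n) _ (h3.trans (map_mul MvPolynomial.C
      (LaurentPolynomial.C (c ^ (1 : ℤ) * c' ^ (k * 1))) _).symm)
    have h5 := laurent_C_mul_T_inj h4.symm
    have h6 : k ∣ 1 := ⟨k', by rw [← h5]; ring⟩
    exact Int.isUnit_iff.1 (isUnit_of_dvd_one h6)
  · simpa using hk 1

/-- The algebras of levels `1` and `2` are not isomorphic. -/
theorem not_nonempty_algEquiv (hn : 1 ≤ n) (M : Model n 1 R) (M' : Model n 2 R') :
    ¬ Nonempty (R ≃ₐ[ℂ] R') := by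
  rintro ⟨φ⟩
  obtain ⟨g, b, a, h⟩ := M.exists_isShape M' φ
  obtain ⟨c, k, hk, ht⟩ := M.exists_map_t M' φ
  obtain ⟨σ, hσ⟩ : ∃ σ, φ M.s = M'.incl σ := by
    rw [← M.incl_s]
    exact h.map_incl _
  have hσt : σ * (algebraMap ℂ (Base n) c * ((baseT n ^ k : (Base n)ˣ) : Base n)) = 1 := by
    refine M'.incl_injective ?_
    rw [map_mul, ← ht, ← hσ, ← map_mul, mul_comm, map_one]
    simpa using congrArg φ M.t_pow_mul_s
  have hW : constantCoeff (baseW n) = 0 := by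
    rw [baseW, map_prod]
    exact Finset.prod_eq_zero (Finset.mem_univ (⟨0, hn⟩ : Fin n)) (constantCoeff_X _ _)
  obtain ⟨e, he⟩ := dvd_of_isShape h hσ
  have he' := congrArg constantCoeff he
  rw [map_mul, map_pow, hW, zero_pow two_ne_zero, zero_mul, map_sub, sub_eq_zero, map_mul,
    map_pow, coe_baseT_zpow, constantCoeff_C] at he'
  obtain ⟨c', j, hj⟩ := laurent_eq_of_isUnit ((isUnit_of_isShape h).map constantCoeff)
  have h1 := congrArg constantCoeff hσt
  rw [map_mul, map_mul, he', hj, coe_baseT_zpow, constantCoeff_C, map_one] at h1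
  have h2 : constantCoeff (algebraMap ℂ (Base n) c) = LaurentPolynomial.C c :=
    constantCoeff_C _ _
  rw [h2, mul_pow, LaurentPolynomial.T_pow] at h1
  have h3 : (LaurentPolynomial.C (c' ^ 5 * c) *
      LaurentPolynomial.T ((5 : ℕ) * j + -(2 : ℕ) + k) : LaurentPolynomial ℂ) =
      LaurentPolynomial.T 0 := by
    rw [LaurentPolynomial.T_add, LaurentPolynomial.T_add, LaurentPolynomial.T_zero, ← h1, map_mul,
      map_pow]
    ring
  have h4 := laurent_C_mul_T_inj h3
  omega

/-- The tensor squares of the algebras of levels `1` and `2` are isomorphic. -/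
theorem nonempty_tensorSquare_algEquiv (M : Model n 1 R) (N : Model n 2 R') :
    Nonempty ((R ⊗[ℂ] R) ≃ₐ[ℂ] (R' ⊗[ℂ] R')) := by
  let α₁ : R →ₐ[ℂ] R ⊗[ℂ] R := Algebra.TensorProduct.includeLeft
  let α₂ : R →ₐ[ℂ] R ⊗[ℂ] R := Algebra.TensorProduct.includeRight
  let β₁ : R' →ₐ[ℂ] R' ⊗[ℂ] R' := Algebra.TensorProduct.includeLeft
  let β₂ : R' →ₐ[ℂ] R' ⊗[ℂ] R' := Algebra.TensorProduct.includeRight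
  have hα : ∀ α : R →ₐ[ℂ] R ⊗[ℂ] R, α M.t * α M.s = 1 := fun α => by
    simpa using congrArg α M.t_pow_mul_s
  have hβ : ∀ β : R' →ₐ[ℂ] R' ⊗[ℂ] R', β N.t ^ 2 * β N.s = 1 := fun β => by
    simpa using congrArg β N.t_pow_mul_s
  have hα₁ := hα α₁
  have hα₂ := hα α₂
  have hβ₁ := hβ β₁
  have hβ₂ := hβ β₂
  obtain ⟨f₁, f₁x, f₁y, f₁z, f₁t, f₁s⟩ := N.exists_twist M β₁ (β₂ N.t * β₂ N.s)
    (β₁ N.t ^ 2 * β₂ N.t ^ 5) (by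
      calc _ = (β₁ N.t ^ 2 * β₁ N.s) * (β₂ N.t ^ 2 * β₂ N.s) ^ 5 := by ring
        _ = 1 := by rw [hβ₁, hβ₂]; simp)
  obtain ⟨f₂, f₂x, f₂y, f₂z, f₂t, f₂s⟩ := N.exists_twist M β₂
    (β₁ N.t * β₁ N.s * (β₂ N.t * β₂ N.s) ^ 2) (β₁ N.t ^ 5 * β₂ N.t ^ 12) (by
      calc _ = (β₁ N.t ^ 2 * β₁ N.s) ^ 5 * (β₂ N.t ^ 2 * β₂ N.s) ^ 11 := by ring
        _ = 1 := by rw [hβ₁, hβ₂]; simp)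
  obtain ⟨g₁, g₁x, g₁y, g₁z, g₁t, g₁s⟩ := M.exists_twist N α₁ (α₁ M.t ^ 5 * α₂ M.s ^ 2)
    (α₁ M.s ^ 12 * α₂ M.t ^ 5) (by
      calc _ = (α₁ M.t * α₁ M.s) ^ 25 * (α₂ M.t * α₂ M.s) ^ 10 := by ring
        _ = 1 := by rw [hα₁, hα₂]; simp)
  obtain ⟨g₂, g₂x, g₂y, g₂z, g₂t, g₂s⟩ := M.exists_twist N α₂ (α₁ M.s ^ 2 * α₂ M.t)
    (α₁ M.t ^ 5 * α₂ M.s ^ 2) (by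
      calc _ = (α₁ M.t * α₁ M.s) ^ 10 * (α₂ M.t * α₂ M.s) ^ 5 := by ring
        _ = 1 := by rw [hα₁, hα₂]; simp)
  let Φ : R ⊗[ℂ] R →ₐ[ℂ] R' ⊗[ℂ] R' := Algebra.TensorProduct.productMap f₁ f₂
  let Ψ : R' ⊗[ℂ] R' →ₐ[ℂ] R ⊗[ℂ] R := Algebra.TensorProduct.productMap g₁ g₂
  have hΦ₁ : ∀ r, Φ (α₁ r) = f₁ r := Algebra.TensorProduct.productMap_left_apply f₁ f₂
  have hΦ₂ : ∀ r, Φ (α₂ r) = f₂ r := Algebra.TensorProduct.productMap_right_apply f₁ f₂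
  have hΨ₁ : ∀ r, Ψ (β₁ r) = g₁ r := Algebra.TensorProduct.productMap_left_apply g₁ g₂
  have hΨ₂ : ∀ r, Ψ (β₂ r) = g₂ r := Algebra.TensorProduct.productMap_right_apply g₁ g₂
  have hΨΦ : Ψ.comp Φ = AlgHom.id ℂ (R ⊗[ℂ] R) := by
    have h₁ : Ψ (β₂ N.t * β₂ N.s) * (α₁ M.t ^ 5 * α₂ M.s ^ 2) = 1 := by
      rw [map_mul, hΨ₂, hΨ₂, g₂t, g₂s]
      calc _ = (α₁ M.t * α₁ M.s) ^ 10 * (α₂ M.t * α₂ M.s) ^ 5 := by ring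
        _ = 1 := by rw [hα₁, hα₂]; simp
    have h₂ : Ψ (β₁ N.t * β₁ N.s * (β₂ N.t * β₂ N.s) ^ 2) * (α₁ M.s ^ 2 * α₂ M.t) = 1 := by
      simp only [map_mul, map_pow, hΨ₁, hΨ₂, g₁t, g₁s, g₂t, g₂s]
      calc _ = (α₁ M.t * α₁ M.s) ^ 35 * (α₂ M.t * α₂ M.s) ^ 16 := by ring
        _ = 1 := by rw [hα₁, hα₂]; simp
    refine Algebra.TensorProduct.ext' ?_
    suffices h : (∀ r, Ψ (Φ (α₁ r)) = α₁ r) ∧ ∀ r, Ψ (Φ (α₂ r)) = α₂ r by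
      intro a b
      have hab : a ⊗ₜ[ℂ] b = α₁ a * α₂ b := by simp [α₁, α₂]
      rw [hab, AlgHom.comp_apply, map_mul, map_mul, h.1, h.2]
      rfl
    constructor
    · refine fun r => congrArg (fun f : R →ₐ[ℂ] R ⊗[ℂ] R => f r)
        (M.algHom_ext (f := Ψ.comp (Φ.comp α₁)) (g := α₁) (fun i => ?_) ?_ ?_ ?_)
      · simp only [AlgHom.comp_apply, hΦ₁, f₁x, hΨ₁, g₁x]
      · rw [AlgHom.comp_apply, AlgHom.comp_apply, hΦ₁, f₁y, map_mul Ψ, hΨ₁, g₁y, ← mul_assoc, h₁,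
          one_mul]
      · rw [AlgHom.comp_apply, AlgHom.comp_apply, hΦ₁, f₁z, map_mul Ψ, map_pow, hΨ₁, g₁z,
          ← mul_assoc, ← mul_pow, h₁, one_pow, one_mul]
      · rw [AlgHom.comp_apply, AlgHom.comp_apply, hΦ₁, f₁t, map_mul, map_pow, map_pow, hΨ₁, hΨ₂,
          g₁t, g₂t]
        calc _ = (α₁ M.t * α₁ M.s) ^ 24 * (α₂ M.t * α₂ M.s) ^ 10 * α₁ M.t := by ring
          _ = α₁ M.t := by rw [hα₁, hα₂]; simp
    · refine fun r => congrArg (fun f : R →ₐ[ℂ] R ⊗[ℂ] R => f r)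
        (M.algHom_ext (f := Ψ.comp (Φ.comp α₂)) (g := α₂) (fun i => ?_) ?_ ?_ ?_)
      · simp only [AlgHom.comp_apply, hΦ₂, f₂x, hΨ₂, g₂x]
      · rw [AlgHom.comp_apply, AlgHom.comp_apply, hΦ₂, f₂y, map_mul Ψ, hΨ₂, g₂y, ← mul_assoc, h₂,
          one_mul]
      · rw [AlgHom.comp_apply, AlgHom.comp_apply, hΦ₂, f₂z, map_mul Ψ, map_pow, hΨ₂, g₂z,
          ← mul_assoc, ← mul_pow, h₂, one_pow, one_mul]
      · rw [AlgHom.comp_apply, AlgHom.comp_apply, hΦ₂, f₂t, map_mul, map_pow, map_pow, hΨ₁, hΨ₂,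
          g₁t, g₂t]
        calc _ = (α₁ M.t * α₁ M.s) ^ 60 * (α₂ M.t * α₂ M.s) ^ 24 * α₂ M.t := by ring
          _ = α₂ M.t := by rw [hα₁, hα₂]; simp
  have hΦΨ : Φ.comp Ψ = AlgHom.id ℂ (R' ⊗[ℂ] R') := by
    have h₁ : Φ (α₁ M.t ^ 5 * α₂ M.s ^ 2) * (β₂ N.t * β₂ N.s) = 1 := by
      simp only [map_mul, map_pow, hΦ₁, hΦ₂, f₁t, f₂s]
      calc _ = (β₁ N.t ^ 2 * β₁ N.s) ^ 10 * (β₂ N.t ^ 2 * β₂ N.s) ^ 23 := by ring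
        _ = 1 := by rw [hβ₁, hβ₂]; simp
    have h₂ : Φ (α₁ M.s ^ 2 * α₂ M.t) * (β₁ N.t * β₁ N.s * (β₂ N.t * β₂ N.s) ^ 2) = 1 := by
      simp only [map_mul, map_pow, hΦ₁, hΦ₂, f₁s, f₂t]
      calc _ = (β₁ N.t ^ 2 * β₁ N.s) ^ 3 * (β₂ N.t ^ 2 * β₂ N.s) ^ 12 := by ring
        _ = 1 := by rw [hβ₁, hβ₂]; simp
    refine Algebra.TensorProduct.ext' ?_
    suffices h : (∀ r, Φ (Ψ (β₁ r)) = β₁ r) ∧ ∀ r, Φ (Ψ (β₂ r)) = β₂ r by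
      intro a b
      have hab : a ⊗ₜ[ℂ] b = β₁ a * β₂ b := by simp [β₁, β₂]
      rw [hab, AlgHom.comp_apply, map_mul, map_mul, h.1, h.2]
      rfl
    constructor
    · refine fun r => congrArg (fun f : R' →ₐ[ℂ] R' ⊗[ℂ] R' => f r)
        (N.algHom_ext (f := Φ.comp (Ψ.comp β₁)) (g := β₁) (fun i => ?_) ?_ ?_ ?_)
      · simp only [AlgHom.comp_apply, hΦ₁, f₁x, hΨ₁, g₁x]
      · rw [AlgHom.comp_apply, AlgHom.comp_apply, hΨ₁, g₁y, map_mul Φ, hΦ₁, f₁y, ← mul_assoc, h₁,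
          one_mul]
      · rw [AlgHom.comp_apply, AlgHom.comp_apply, hΨ₁, g₁z, map_mul Φ, map_pow, hΦ₁, f₁z,
          ← mul_assoc, ← mul_pow, h₁, one_pow, one_mul]
      · rw [AlgHom.comp_apply, AlgHom.comp_apply, hΨ₁, g₁t, map_mul, map_pow, map_pow, hΦ₁, hΦ₂,
          f₁s, f₂t]
        calc _ = (β₁ N.t ^ 2 * β₁ N.s) ^ 12 * (β₂ N.t ^ 2 * β₂ N.s) ^ 60 * β₁ N.t := by ring
          _ = β₁ N.t := by rw [hβ₁, hβ₂]; simp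
    · refine fun r => congrArg (fun f : R' →ₐ[ℂ] R' ⊗[ℂ] R' => f r)
        (N.algHom_ext (f := Φ.comp (Ψ.comp β₂)) (g := β₂) (fun i => ?_) ?_ ?_ ?_)
      · simp only [AlgHom.comp_apply, hΦ₂, f₂x, hΨ₂, g₂x]
      · rw [AlgHom.comp_apply, AlgHom.comp_apply, hΨ₂, g₂y, map_mul Φ, hΦ₂, f₂y, ← mul_assoc, h₂,
          one_mul]
      · rw [AlgHom.comp_apply, AlgHom.comp_apply, hΨ₂, g₂z, map_mul Φ, map_pow, hΦ₂, f₂z,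
          ← mul_assoc, ← mul_pow, h₂, one_pow, one_mul]
      · rw [AlgHom.comp_apply, AlgHom.comp_apply, hΨ₂, g₂t, map_mul, map_pow, map_pow, hΦ₁, hΦ₂,
          f₁t, f₂s]
        calc _ = (β₁ N.t ^ 2 * β₁ N.s) ^ 10 * (β₂ N.t ^ 2 * β₂ N.s) ^ 22 * β₂ N.t := by ring
          _ = β₂ N.t := by rw [hβ₁, hβ₂]; simp
  exact ⟨AlgEquiv.ofAlgHom Φ Ψ hΦΨ hΨΦ⟩

end Model

lemma dvd_of_X_mul_mem_span {N : ℕ} {i : Fin N} {G p : MvPolynomial (Fin N) ℂ}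
    (hG : eval 0 G ≠ 0) (h : X i * p ∈ Ideal.span {G}) : p ∈ Ideal.span {G} := by
  rw [Ideal.mem_span_singleton] at h ⊢
  obtain ⟨q, hq⟩ := h
  rcases X_prime.dvd_or_dvd (Dvd.intro p hq) with ⟨k, hk⟩ | ⟨k, rfl⟩
  · simp [hk] at hG
  · refine ⟨k, mul_left_cancel₀ (X_ne_zero i) ?_⟩
    rw [hq]
    ring

/-- The quotient of the polynomial ring as a model. -/
noncomputable def quotientModel (n ℓ : ℕ) : Model n ℓ (negKodairaRing5 n ℓ) where
  x i := Ideal.Quotient.mk _ (X (Fin.castAdd 3 i))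
  y := Ideal.Quotient.mk _ (X ⟨n, by omega⟩)
  z := Ideal.Quotient.mk _ (X ⟨n + 1, by omega⟩)
  t := Ideal.Quotient.mk _ (X ⟨n + 2, by omega⟩)
  rel := by
    simp only [← map_pow, ← map_prod, ← map_mul, ← map_sub]
    rw [← map_one (Ideal.Quotient.mk _), Ideal.Quotient.eq]
    exact Ideal.mem_span_singleton_self _
  exists_lift S _ _ x' y' z' t' h := by
    let v : Fin (n + 3) → S := Fin.append x' ![y', z', t']
    have hx : ∀ i, v (Fin.castAdd 3 i) = x' i := Fin.append_left _ _
    have hy : v ⟨n, by omega⟩ = y' := Fin.append_right x' ![y', z', t'] 0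
    have hz : v ⟨n + 1, by omega⟩ = z' := Fin.append_right x' ![y', z', t'] 1
    have ht : v ⟨n + 2, by omega⟩ = t' := Fin.append_right x' ![y', z', t'] 2
    refine ⟨Ideal.Quotient.liftₐ _ (aeval v) fun a ha => ?_, fun i => ?_, ?_, ?_, ?_⟩
    · obtain ⟨b, rfl⟩ := Ideal.mem_span_singleton.1 ha
      rw [map_mul]
      simp [hx, hy, hz, ht, h]
    · exact (aeval_X v _).trans (hx i)
    · exact (aeval_X v _).trans hy
    · exact (aeval_X v _).trans hz
    · exact (aeval_X v _).trans ht
  adjoin_eq_top := by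
    refine eq_top_iff.2 fun r _ => ?_
    obtain ⟨p, rfl⟩ := Ideal.Quotient.mk_surjective r
    induction p using MvPolynomial.induction_on with
    | C a => exact Subalgebra.algebraMap_mem _ a
    | add p q hp hq => rw [map_add]; exact add_mem (hp trivial) (hq trivial)
    | mul_X p i hp =>
      rw [map_mul]
      refine mul_mem (hp trivial) (Algebra.subset_adjoin ?_)
      refine Fin.addCases (fun j => ⟨.inl j, rfl⟩) (fun j => ⟨.inr j, ?_⟩) i
      fin_cases j <;> rfl
  eq_zero_of_x_mul i r h := by
    obtain ⟨p, rfl⟩ := Ideal.Quotient.mk_surjective r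
    rw [← map_mul, Ideal.Quotient.eq_zero_iff_mem] at h
    exact Ideal.Quotient.eq_zero_iff_mem.2 (dvd_of_X_mul_mem_span (by simp) h)

end NegKodaira

/-- **Proposition (nonisomorphic varieties with isomorphic squares).** For every
`n ≥ 1`, the varieties `X = X_{n,5,1} = {t(x₁²⋯xₙ²·z − y⁵) = 1}` and
`Y = X_{n,5,2} = {t²(x₁²⋯xₙ²·z − y⁵) = 1}` are not isomorphic, but their squares
`X × X` and `Y × Y` are: the `ℂ`-algebras `R₁` and `R₂` are not isomorphic, but
`R₁ ⊗_ℂ R₁` and `R₂ ⊗_ℂ R₂` are isomorphic. -/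
theorem negKodaira5_square_iso (n : ℕ) (hn : 1 ≤ n) :
    (¬ Nonempty (negKodairaRing5 n 1 ≃ₐ[ℂ] negKodairaRing5 n 2)) ∧
    Nonempty ((negKodairaRing5 n 1 ⊗[ℂ] negKodairaRing5 n 1) ≃ₐ[ℂ]
      (negKodairaRing5 n 2 ⊗[ℂ] negKodairaRing5 n 2)) := by
  exact ⟨NegKodaira.Model.not_nonempty_algEquiv hn (NegKodaira.quotientModel n 1)
      (NegKodaira.quotientModel n 2),
    NegKodaira.Model.nonempty_tensorSquare_algEquiv (NegKodaira.quotientModel n 1)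
      (NegKodaira.quotientModel n 2)⟩
end
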